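/- arXiv:2508.14238 — 5 statements merged into one kernel-verified Lean document; each statement's English description precedes it below -/
import Mathlib

section
/- Let G be a bipartite graph with bipartition (A, B), |A| = a, |B| = b, and let m be an integer with 2 ≤ m ≤ b ≤ a. If |E(G)| > b + (a−1)(m−1) in the case b ≤ 2m−2, or |E(G)| > (b + a − 2m + 3)(m−1) in the case b ≥ 2m−2, then G contains a cycle of length at least 2m. -/
/-- The number of edges of a graph (classical version). -/
noncomputable def edgeCount {V : Type*} [Fintype V] (G : SimpleGraph V) : ℕ := by
  classical exact G.edgeFinset.card

namespace BipartiteCycle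

variable {V : Type*} {G : SimpleGraph V}

/-- `l` lists the vertices of a path of `G` from `u` to `v`. -/
def PathList (G : SimpleGraph V) (u v : V) (l : List V) : Prop :=
  l.Nodup ∧ l.IsChain G.Adj ∧ l.head? = some u ∧ l.getLast? = some v

/-- `l` lists the vertices of a cycle of `G` in cyclic order; a single edge counts as a cycle
of length two. -/
def CycleList (G : SimpleGraph V) (l : List V) : Prop :=
  ∃ u v, PathList G u v l ∧ G.Adj v u

namespace PathList

theorem single (v : V) : PathList G v v [v] := by
  simp [PathList]

theorem ne_nil {u v : V} {l : List V} (h : PathList G u v l) : l ≠ [] := by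
  rintro rfl
  simpa using h.2.2.1

theorem left_mem {u v : V} {l : List V} (h : PathList G u v l) : u ∈ l :=
  List.mem_of_mem_head? h.2.2.1

theorem right_mem {u v : V} {l : List V} (h : PathList G u v l) : v ∈ l :=
  List.mem_of_mem_getLast? h.2.2.2

theorem length_pos {u v : V} {l : List V} (h : PathList G u v l) : 0 < l.length :=
  List.length_pos_of_mem h.left_mem

theorem two_le_length {u v : V} {l : List V} (h : PathList G u v l) (huv : u ≠ v) :
    2 ≤ l.length := by
  obtain ⟨h1, h2, h3, h4⟩ := h
  match l with
  | [] => simp at h3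
  | [a] =>
    simp only [List.head?_cons, List.getLast?_singleton, Option.some.injEq] at h3 h4
    exact absurd (h3.symm.trans h4) huv
  | a :: b :: l => simp

theorem append {u v u' v' : V} {l l' : List V} (h : PathList G u v l) (h' : PathList G u' v' l')
    (hadj : G.Adj v u') (hd : ∀ x ∈ l, x ∉ l') : PathList G u v' (l ++ l') := by
  refine ⟨?_, ?_, ?_, ?_⟩
  · exact h.1.append h'.1 (fun x hx hx' => hd x hx hx')
  · refine h.2.1.append h'.2.1 ?_
    intro x hx y hy
    rw [h.2.2.2] at hx
    rw [h'.2.2.1] at hy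
    simp only [Option.mem_def, Option.some.injEq] at hx hy
    subst hx hy
    exact hadj
  · simp [List.head?_append, h.2.2.1]
  · simp [List.getLast?_append, h'.2.2.2]

theorem reverse {u v : V} {l : List V} (h : PathList G u v l) : PathList G v u l.reverse := by
  refine ⟨List.nodup_reverse.2 h.1, ?_, ?_, ?_⟩
  · rw [List.isChain_reverse]
    exact h.2.1.imp fun a b hab => hab.symm
  · simp [h.2.2.2]
  · simp [h.2.2.1]

theorem exists_cons {u v : V} {l : List V} (h : PathList G u v l) : ∃ t, l = u :: t := by
  cases l with
  | nil => exact absurd rfl h.ne_nil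
  | cons a t =>
    have := h.2.2.1
    simp only [List.head?_cons, Option.some.injEq] at this
    exact ⟨t, by rw [this]⟩

theorem tail_path {u v : V} {t : List V} (h : PathList G u v (u :: t)) (ht : t ≠ []) :
    ∃ w, G.Adj u w ∧ PathList G w v t := by
  cases t with
  | nil => exact absurd rfl ht
  | cons w t =>
    obtain ⟨h1, h2, h3, h4⟩ := h
    rw [List.isChain_cons_cons] at h2
    refine ⟨w, h2.1, (List.nodup_cons.1 h1).2, h2.2, by simp, ?_⟩
    simpa [List.getLast?_cons_cons] using h4

theorem glue {u v w : V} {l l' : List V} (h : PathList G u v l) (h' : PathList G v w l')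
    (hd : ∀ x ∈ l, x ∈ l' → x = v) :
    ∃ m, PathList G u w m ∧ (∀ x, x ∈ m ↔ x ∈ l ∨ x ∈ l') ∧
      m.length + 1 = l.length + l'.length := by
  obtain ⟨t, rfl⟩ := h'.exists_cons
  have hv := h.right_mem
  refine ⟨l ++ t, ?_, ?_, by simp; omega⟩
  · by_cases ht : t = []
    · subst ht
      have := h'.2.2.2
      simp only [List.getLast?_singleton, Option.some.injEq] at this
      subst this
      simpa using h
    · obtain ⟨x, hx, hp⟩ := h'.tail_path ht
      refine h.append hp hx ?_
      intro y hy hy'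
      have := hd y hy (List.mem_cons_of_mem _ hy')
      subst this
      exact (List.nodup_cons.1 h'.1).1 hy'
  · intro x
    simp only [List.mem_append, List.mem_cons]
    constructor
    · rintro (h | h) <;> simp [h]
    · rintro (h | h | h)
      · exact Or.inl h
      · exact Or.inl (h ▸ hv)
      · exact Or.inr h

theorem split {u v w : V} {l : List V} (h : PathList G u v l) (hw : w ∈ l) :
    ∃ l₁ l₂, l = l₁ ++ w :: l₂ ∧ PathList G u w (l₁ ++ [w]) ∧ PathList G w v (w :: l₂) := by
  obtain ⟨l₁, l₂, rfl⟩ := List.append_of_mem hw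
  obtain ⟨h1, h2, h3, h4⟩ := h
  refine ⟨l₁, l₂, rfl, ⟨?_, ?_, ?_, by simp⟩, ⟨?_, ?_, by simp, ?_⟩⟩
  · refine h1.sublist ?_
    simp
  · rw [List.append_cons] at h2
    exact h2.left_of_append
  · cases l₁ <;> simpa using h3
  · exact h1.sublist (by simp)
  · exact h2.right_of_append
  · simpa [List.getLast?_append] using h4

theorem cut {u v w : V} {l : List V} (h : PathList G u v l) (hw : w ∈ l) :
    ∃ m, PathList G u w m ∧ m ⊆ l ∧ (w ≠ v → v ∉ m) := by
  obtain ⟨l₁, l₂, rfl, h1, h2⟩ := h.split hw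
  refine ⟨_, h1, ?_, ?_⟩
  · intro x hx
    simp only [List.mem_append, List.mem_cons] at hx ⊢
    tauto
  · intro hne hv
    have hv2 := h2.right_mem
    have hn := h.1
    rw [List.nodup_append] at hn
    simp only [List.mem_append, List.mem_singleton] at hv
    rcases hv with hv | hv
    · exact hn.2.2 _ hv _ hv2 rfl
    · exact hne hv.symm

end PathList

namespace CycleList

theorem rotate {l : List V} (h : CycleList G l) {w : V} (hw : w ∈ l) :
    ∃ l' z, PathList G w z l' ∧ G.Adj z w ∧ l'.Perm l := by
  obtain ⟨u, v, hp, hadj⟩ := h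
  obtain ⟨l₁, l₂, rfl, h1, h2⟩ := hp.split hw
  rcases List.eq_nil_or_concat l₁ with rfl | ⟨l₃, x, rfl⟩
  · have : w = u := by
      have := h1.2.2.1
      simpa using this
    subst this
    exact ⟨_, v, hp, hadj, List.Perm.refl _⟩
  · simp only [List.concat_eq_append] at h1 hp hw ⊢
    have h3 : PathList G u x (l₃ ++ [x]) ∧ G.Adj x w := by
      obtain ⟨a1, a2, a3, a4⟩ := h1
      refine ⟨⟨a1.sublist (by simp), a2.left_of_append, ?_, by simp⟩, ?_⟩
      · cases l₃ <;> simpa using a3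
      · rw [List.isChain_append] at a2
        exact a2.2.2 x (by simp) w (by simp)
    refine ⟨_, x, h2.append h3.1 hadj ?_, h3.2, List.perm_append_comm⟩
    intro y hy hy'
    have hn := hp.1
    rw [List.nodup_append] at hn
    exact hn.2.2 _ hy' _ hy rfl

theorem of_two_paths {u v : V} {l m : List V} (hl : PathList G u v l) (hm : PathList G u v m)
    (hd : ∀ x ∈ l, x ∈ m → x = u ∨ x = v) (huv : u ≠ v) :
    ∃ c, CycleList G c ∧ c.length + 2 = l.length + m.length ∧ ∀ x, x ∈ c ↔ x ∈ l ∨ x ∈ m := by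
  obtain ⟨t, rfl⟩ := hm.exists_cons
  have ht : t ≠ [] := by
    rintro rfl
    have := hm.2.2.2
    simp at this
    exact huv this
  obtain ⟨x, hx, hp⟩ := hm.tail_path ht
  have hr := hp.reverse
  obtain ⟨s, hs⟩ := hr.exists_cons
  rw [hs] at hr
  have hst : t = s.reverse ++ [v] := by
    rw [← List.reverse_reverse t, hs]; simp
  subst hst
  by_cases hs0 : s = []
  · subst hs0
    have hxv : x = v := by
      have := hp.2.2.1
      simpa using this.symm
    subst hxv
    refine ⟨l, ⟨u, x, hl, hx.symm⟩, by simp, ?_⟩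
    have := hl.left_mem
    have := hl.right_mem
    intro z
    simp only [List.reverse_nil, List.nil_append, List.mem_cons, List.not_mem_nil, or_false]
    constructor
    · tauto
    · rintro (h | rfl | rfl) <;> assumption
  obtain ⟨y, hy, hq⟩ := hr.tail_path hs0
  refine ⟨l ++ s, ⟨u, x, hl.append hq hy ?_, hx.symm⟩, by simp; omega, ?_⟩
  · intro z hz hz'
    have hn := hm.1
    rcases hd z hz (by simp [hz']) with rfl | rfl
    · simp [hz'] at hn
    · have := hr.1
      simp [hz'] at this
  · have := hl.left_mem
    have := hl.right_mem
    intro z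
    simp only [List.mem_append, List.mem_cons, List.mem_reverse,
      List.not_mem_nil, or_false]
    constructor
    · tauto
    · rintro (h | rfl | h | rfl) <;> tauto

end CycleList

/-- The vertices `p 0, …, p (N - 1)` form a path of `G`, in this order. -/
structure PathFn (G : SimpleGraph V) (p : ℕ → V) (N : ℕ) : Prop where
  inj : ∀ i < N, ∀ j < N, p i = p j → i = j
  adj : ∀ i, i + 1 < N → G.Adj (p i) (p (i + 1))

/-- The list `p i, …, p j`. -/
def seg (p : ℕ → V) (i j : ℕ) : List V := (List.range' i (j + 1 - i)).map p

theorem mem_seg {p : ℕ → V} {i j : ℕ} {x : V} : x ∈ seg p i j ↔ ∃ q, i ≤ q ∧ q ≤ j ∧ p q = x := by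
  simp only [seg, List.mem_map, List.mem_range'_1]
  constructor
  · rintro ⟨q, hq, rfl⟩
    exact ⟨q, by omega, by omega, rfl⟩
  · rintro ⟨q, h1, h2, rfl⟩
    exact ⟨q, by omega, rfl⟩

theorem length_seg (p : ℕ → V) (i j : ℕ) : (seg p i j).length = j + 1 - i := by
  simp [seg]

theorem PathFn.pathList_seg {p : ℕ → V} {N i j : ℕ} (hp : PathFn G p N) (hij : i ≤ j)
    (hj : j < N) : PathList G (p i) (p j) (seg p i j) := by
  refine ⟨?_, ?_, ?_, ?_⟩
  · refine List.Nodup.map_on ?_ List.nodup_range'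
    intro x hx y hy hxy
    rw [List.mem_range'_1] at hx hy
    exact hp.inj x (by omega) y (by omega) hxy
  · rw [List.isChain_iff_getElem]
    intro q hq
    simp only [seg, List.getElem_map, List.getElem_range'] 
    rw [length_seg] at hq
    have := hp.adj (i + q) (by omega)
    simpa [add_assoc] using this
  · obtain ⟨d, hd⟩ : ∃ d, j + 1 - i = d + 1 := ⟨j - i, by omega⟩
    simp [seg, hd, List.range'_succ]
  · obtain ⟨d, rfl⟩ : ∃ d, j = i + d := ⟨j - i, by omega⟩
    have : i + d + 1 - i = d + 1 := by omega
    simp [seg, this, List.range'_concat]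

theorem PathList.exists_pathFn {u v : V} {l : List V} (h : PathList G u v l) :
    ∃ p, PathFn G p l.length ∧ p 0 = u ∧ p (l.length - 1) = v ∧
      ∀ x, x ∈ l ↔ ∃ q < l.length, p q = x := by
  have h0 := h.length_pos
  obtain ⟨h1, h2, h3, h4⟩ := h
  refine ⟨fun i => l.getD i u, ⟨?_, ?_⟩, ?_, ?_, ?_⟩
  · intro i hi j hj hij
    simp only [List.getD_eq_getElem _ _ hi, List.getD_eq_getElem _ _ hj] at hij
    exact (h1.getElem_inj_iff).1 hij
  · intro i hi
    rw [List.isChain_iff_getElem] at h2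
    simp only [List.getD_eq_getElem _ _ hi, List.getD_eq_getElem _ _ (show i < l.length by omega)]
    exact h2 i hi
  · cases l <;> simp_all
  · rw [List.getLast?_eq_getElem?] at h4
    simp [List.getD, h4]
  · intro x
    rw [List.mem_iff_getElem]
    constructor
    · rintro ⟨i, hi, rfl⟩
      exact ⟨i, hi, List.getD_eq_getElem _ _ hi⟩
    · rintro ⟨i, hi, rfl⟩
      exact ⟨i, hi, (List.getD_eq_getElem _ _ hi).symm⟩

theorem PathFn.reverse {p : ℕ → V} {N : ℕ} (hp : PathFn G p N) :
    PathFn G (fun i => p (N - 1 - i)) N := by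
  constructor
  · intro i hi j hj hij
    have := hp.inj _ (by omega) _ (by omega) hij
    omega
  · intro i hi
    have := hp.adj (N - 1 - (i + 1)) (by omega)
    rw [show N - 1 - (i + 1) + 1 = N - 1 - i by omega] at this
    exact this.symm

/-- Deleting any vertex `v` leaves a connected graph: every proper nonempty part of the
remaining vertices sends an edge to the rest. -/
def TwoConnected (G : SimpleGraph V) : Prop :=
  ∀ v : V, ∀ S : Set V, S.Nonempty → v ∉ S → (∃ w, w ∉ S ∧ w ≠ v) →
    ∃ u ∈ S, ∃ w, w ∉ S ∧ w ≠ v ∧ G.Adj u w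

/-- In a 2-connected graph two disjoint vertex sets are joined by a path that avoids a given
vertex and is internally disjoint from both sets. -/
theorem TwoConnected.exists_bridge (hG : TwoConnected G) {U W : Set V} {v : V}
    (hU : U.Nonempty) (hW : W.Nonempty) (hUW : ∀ x ∈ U, x ∉ W) (hvU : v ∉ U) (hvW : v ∉ W) :
    ∃ z ∈ U, ∃ w ∈ W, ∃ D, PathList G z w D ∧ v ∉ D ∧ (∀ x ∈ D, x ∈ U → x = z) ∧
      ∀ x ∈ D, x ∈ W → x = w := by
  set T : Set V := {x | ∃ z ∈ U, ∃ D, PathList G z x D ∧ v ∉ D ∧ (∀ y ∈ D, y ∈ U → y = z) ∧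
    ∀ y ∈ D, y ∉ W} with hT
  have hUT : U ⊆ T := by
    intro z hz
    refine ⟨z, hz, [z], PathList.single z, ?_, ?_, ?_⟩
    · simp only [List.mem_singleton]
      rintro rfl
      exact hvU hz
    · simp
    · simpa using hUW z hz
  obtain ⟨w₀, hw₀⟩ := hW
  obtain ⟨u, ⟨z, hz, D, hD, hvD, hDU, hDW⟩, w, hwT, hwv, hadj⟩ := hG v T (hU.mono hUT)
    (fun ⟨z, hz, D, hD, hvD, _⟩ => hvD hD.right_mem)
    ⟨w₀, fun ⟨z, hz, D, hD, _, _, hDW⟩ => hDW _ hD.right_mem hw₀, fun h => hvW (h ▸ hw₀)⟩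
  have hwU : w ∉ U := fun h => hwT (hUT h)
  have hwD : w ∉ D := by
    intro hw
    obtain ⟨m, hm, hmD, -⟩ := hD.cut hw
    exact hwT ⟨z, hz, m, hm, fun h => hvD (hmD h), fun y hy => hDU y (hmD hy),
      fun y hy => hDW y (hmD hy)⟩
  have hD' : PathList G z w (D ++ [w]) := by
    refine hD.append (PathList.single w) hadj ?_
    rintro x hx hxw
    rw [List.mem_singleton] at hxw
    exact hwD (hxw ▸ hx)
  have hvD' : v ∉ D ++ [w] := by
    simp [hvD, hwv.symm]
  have hDU' : ∀ y ∈ D ++ [w], y ∈ U → y = z := by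
    intro y hy hyU
    simp only [List.mem_append, List.mem_singleton] at hy
    rcases hy with hy | rfl
    · exact hDU y hy hyU
    · exact absurd hyU hwU
  by_cases hwW : w ∈ W
  · refine ⟨z, hz, w, hwW, _, hD', hvD', hDU', ?_⟩
    intro y hy hyW
    simp only [List.mem_append, List.mem_singleton] at hy
    rcases hy with hy | rfl
    · exact absurd hyW (hDW y hy)
    · rfl
  · refine absurd ⟨z, hz, _, hD', hvD', hDU', ?_⟩ hwT
    intro y hy
    simp only [List.mem_append, List.mem_singleton] at hy
    rcases hy with hy | rfl
    · exact hDW y hy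
    · exact hwW

/-- Two disjoint strands `Sa` and `Sb` that leave the initial part `p 0, …, p s` of a path from
its vertices `p s` and `p i`, and end in `p m` and `p e` respectively, meeting the part of the path
beyond `p e` only in `p m`. -/
structure IsLadder (G : SimpleGraph V) (p : ℕ → V) (N s e m i : ℕ) (Sa Sb : List V)
    (sa sb : V) : Prop where
  lt_s : i < s
  s_le : s ≤ e
  e_lt : e < m
  m_lt : m < N
  starts : (sa = p s ∧ sb = p i) ∨ (sa = p i ∧ sb = p s)
  pathA : PathList G sa (p m) Sa
  pathB : PathList G sb (p e) Sb
  disj : ∀ x ∈ Sa, x ∉ Sb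
  low : ∀ q ≤ s, p q ∈ Sa ∨ p q ∈ Sb → q = s ∨ q = i
  high : ∀ q, e < q → q < N → p q ∈ Sa ∨ p q ∈ Sb → q = m

theorem IsLadder.extend {p : ℕ → V} {N s e m i e' : ℕ} {Sa Sb : List V} {sa sb : V}
    (hp : PathFn G p N) (h : IsLadder G p N s e m i Sa Sb sa sb) (he : e ≤ e') (he' : e' < m) :
    ∃ Sb', IsLadder G p N s e' m i Sa Sb' sa sb := by
  obtain ⟨h1, h2, h3, h4, h5, h6, h7, h8, h9, h10⟩ := h
  have hseg := hp.pathList_seg he (he'.trans h4)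
  have key : ∀ x ∈ seg p e e', x ∈ Sa ∨ x ∈ Sb → x = p e := by
    intro x hx hx'
    obtain ⟨q, hq1, hq2, rfl⟩ := mem_seg.1 hx
    by_contra hne
    have : e ≠ q := fun h => hne (h ▸ rfl)
    have := h10 q (by omega) (by omega) hx'
    omega
  obtain ⟨Sb', hSb', hmem, -⟩ := h7.glue hseg (fun x hx hx' => key x hx' (Or.inr hx))
  refine ⟨Sb', h1, h2.trans he, he', h4, h5, h6, hSb', ?_, ?_, ?_⟩
  · intro x hx hx'
    rcases (hmem x).1 hx' with hx' | hx'
    · exact h8 x hx hx'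
    · have := key x hx' (Or.inl hx)
      subst this
      exact h8 _ hx h7.right_mem
  · intro q hq hq'
    rw [hmem] at hq'
    rcases hq' with hq' | hq' | hq'
    · exact h9 q hq (Or.inl hq')
    · exact h9 q hq (Or.inr hq')
    · obtain ⟨r, hr1, hr2, hr⟩ := mem_seg.1 hq'
      have := hp.inj r (by omega) q (by omega) hr
      omega
  · intro q hq hqN hq'
    rw [hmem] at hq'
    rcases hq' with hq' | hq' | hq'
    · exact h10 q (by omega) hqN (Or.inl hq')
    · exact h10 q (by omega) hqN (Or.inr hq')
    · obtain ⟨r, hr1, hr2, hr⟩ := mem_seg.1 hq'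
      have := hp.inj r (by omega) q (by omega) hr
      omega

theorem TwoConnected.exists_isLadder_base (hG : TwoConnected G) {p : ℕ → V} {N s : ℕ}
    (hp : PathFn G p N) (hs : 1 ≤ s) (hsN : s + 1 < N) :
    ∃ m i Sa Sb sa sb, IsLadder G p N s s m i Sa Sb sa sb := by
  obtain ⟨z, ⟨i, hi, rfl⟩, w, ⟨m, ⟨hm1, hm2⟩, rfl⟩, D, hD, hvD, hDU, hDW⟩ :=
    hG.exists_bridge (U := p '' {q | q < s}) (W := p '' {q | s < q ∧ q < N}) (v := p s)
      ⟨p 0, 0, hs, rfl⟩ ⟨p (s + 1), s + 1, ⟨by omega, hsN⟩, rfl⟩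
      (by
        rintro x ⟨q, hq, rfl⟩ ⟨r, ⟨hr1, hr2⟩, hr⟩
        simp only [Set.mem_ofPred_eq] at hq
        have := hp.inj r (by omega) q (by omega) hr
        omega)
      (by
        rintro ⟨q, hq, hq'⟩
        simp only [Set.mem_ofPred_eq] at hq
        have := hp.inj q (by omega) s (by omega) hq'
        omega)
      (by
        rintro ⟨q, ⟨hq1, hq2⟩, hq'⟩
        have := hp.inj q (by omega) s (by omega) hq'
        omega)
  simp only [Set.mem_ofPred_eq] at hi
  refine ⟨m, i, D, [p s], p i, p s, hi, le_rfl, hm1, hm2, Or.inr ⟨rfl, rfl⟩, hD,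
    PathList.single _, ?_, ?_, ?_⟩
  · intro x hx hx'
    rw [List.mem_singleton] at hx'
    exact hvD (hx' ▸ hx)
  · intro q hq hq'
    rcases hq.lt_or_eq with hlt | rfl
    · rcases hq' with hq' | hq'
      · exact Or.inr (hp.inj q (by omega) i (by omega) (hDU _ hq' ⟨q, hlt, rfl⟩))
      · rw [List.mem_singleton] at hq'
        exact Or.inl (hp.inj q (by omega) s (by omega) hq')
    · exact Or.inl rfl
  · intro q hq hqN hq'
    rcases hq' with hq' | hq'
    · exact hp.inj q hqN m hm2 (hDW _ hq' ⟨q, ⟨hq, hqN⟩, rfl⟩)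
    · rw [List.mem_singleton] at hq'
      have := hp.inj q (by omega) s (by omega) hq'
      omega

theorem TwoConnected.exists_isLadder_succ (hG : TwoConnected G) {p : ℕ → V} {N s e m i : ℕ}
    {Sa Sb : List V} {sa sb : V} (hp : PathFn G p N) (h : IsLadder G p N s e m i Sa Sb sa sb)
    (hem : e + 1 = m) (hmN : m + 1 < N) :
    ∃ m' i' Sa' Sb' sa' sb', IsLadder G p N s m m' i' Sa' Sb' sa' sb' := by
  obtain ⟨h1, h2, h3, h4, h5, h6, h7, h8, h9, h10⟩ := h
  have hmB : p m ∉ Sb := h8 _ h6.right_mem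
  have hsw : ∀ q ≤ s, p q ≠ p m := by
    intro q hq hqm
    have := hp.inj q (by omega) m (by omega) hqm
    omega
  obtain ⟨z, ⟨hz, hzm⟩, w, ⟨m', ⟨hm1, hm2⟩, rfl⟩, D, hD, hvD, hDU, hDW⟩ :=
    hG.exists_bridge (U := {x | ((∃ q ≤ s, p q = x) ∨ x ∈ Sa ∨ x ∈ Sb) ∧ x ≠ p m})
      (W := p '' {q | m < q ∧ q < N}) (v := p m)
      ⟨p 0, Or.inl ⟨0, by omega, rfl⟩, hsw 0 (by omega)⟩
      ⟨p (m + 1), m + 1, ⟨by omega, hmN⟩, rfl⟩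
      (by
        rintro x ⟨hx, hxm⟩ ⟨r, ⟨hr1, hr2⟩, rfl⟩
        rcases hx with ⟨q, hq, hqr⟩ | hx
        · have := hp.inj q (by omega) r (by omega) hqr
          omega
        · have := h10 r (by omega) hr2 hx
          omega)
      (fun hx => hx.2 rfl)
      (by
        rintro ⟨q, ⟨hq1, hq2⟩, hq'⟩
        have := hp.inj q (by omega) m (by omega) hq'
        omega)
  have hDS : ∀ x ∈ D, x ∈ Sa ∨ x ∈ Sb → x = z := by
    intro x hx hx'
    exact hDU x hx ⟨Or.inr hx', fun hxm => hvD (hxm ▸ hx)⟩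
  have hDlow : ∀ q ≤ s, p q ∈ D → p q = z := fun q hq hqD =>
    hDU _ hqD ⟨Or.inl ⟨q, hq, rfl⟩, hsw q hq⟩
  have hDhigh : ∀ q, m < q → q < N → p q ∈ D → q = m' := fun q hq hqN hqD =>
    hp.inj q hqN m' hm2 (hDW _ hqD ⟨q, ⟨hq, hqN⟩, rfl⟩)
  have hhigh : ∀ q, m < q → q < N → p q ∈ Sa ∨ p q ∈ Sb → False := by
    intro q hq hqN hqD
    have := h10 q (by omega) hqN hqD
    omega
  have hBm : PathList G sb (p m) (Sb ++ [p m]) := by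
    refine h7.append (PathList.single _) ?_ ?_
    · rw [← hem]
      exact hp.adj e (by omega)
    · intro x hx hx'
      rw [List.mem_singleton] at hx'
      exact hmB (hx' ▸ hx)
  have hBm' : ∀ x, x ∈ Sb ++ [p m] ↔ x ∈ Sb ∨ x = p m := by simp
  by_cases hzB : z ∈ Sb
  · obtain ⟨L, hL, hLS, -⟩ := h7.cut hzB
    obtain ⟨M, hM, hmem, -⟩ := hL.glue hD (fun x hx hx' => hDS x hx' (Or.inr (hLS hx)))
    refine ⟨m', i, M, Sa, sb, sa, h1, by omega, hm1, hm2, by tauto, hM, h6, ?_, ?_, ?_⟩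
    · intro x hx hxA
      rcases (hmem x).1 hx with hx | hx
      · exact h8 x hxA (hLS hx)
      · have := hDS x hx (Or.inl hxA)
        subst this
        exact h8 x hxA hzB
    · intro q hq hq'
      rw [hmem] at hq'
      rcases hq' with (hq' | hq') | hq'
      · exact h9 q hq (Or.inr (hLS hq'))
      · exact h9 q hq (Or.inr (hDlow q hq hq' ▸ hzB))
      · exact h9 q hq (Or.inl hq')
    · intro q hq hqN hq'
      rw [hmem] at hq'
      rcases hq' with (hq' | hq') | hq'
      · exact (hhigh q hq hqN (Or.inr (hLS hq'))).elim
      · exact hDhigh q hq hqN hq'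
      · exact (hhigh q hq hqN (Or.inl hq')).elim
  by_cases hzA : z ∈ Sa
  · obtain ⟨L, hL, hLS, hLm⟩ := h6.cut hzA
    obtain ⟨M, hM, hmem, -⟩ := hL.glue hD (fun x hx hx' => hDS x hx' (Or.inl (hLS hx)))
    refine ⟨m', i, M, Sb ++ [p m], sa, sb, h1, by omega, hm1, hm2, h5, hM, hBm, ?_, ?_, ?_⟩
    · intro x hx hxB
      rw [hBm'] at hxB
      rcases (hmem x).1 hx with hx | hx
      · rcases hxB with hxB | rfl
        · exact h8 x (hLS hx) hxB
        · exact hLm hzm hx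
      · rcases hxB with hxB | rfl
        · exact hzB (hDS x hx (Or.inr hxB) ▸ hxB)
        · exact hvD hx
    · intro q hq hq'
      rw [hmem, hBm'] at hq'
      rcases hq' with (hq' | hq') | hq' | hq'
      · exact h9 q hq (Or.inl (hLS hq'))
      · exact h9 q hq (Or.inl (hDlow q hq hq' ▸ hzA))
      · exact h9 q hq (Or.inr hq')
      · exact absurd hq' (hsw q hq)
    · intro q hq hqN hq'
      rw [hmem, hBm'] at hq'
      rcases hq' with (hq' | hq') | hq' | hq'
      · exact (hhigh q hq hqN (Or.inl (hLS hq'))).elim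
      · exact hDhigh q hq hqN hq'
      · exact (hhigh q hq hqN (Or.inr hq')).elim
      · have := hp.inj q hqN m h4 hq'
        omega
  obtain ⟨q₀, hq₀, rfl⟩ : ∃ q ≤ s, p q = z := by tauto
  have hq₀s : q₀ < s := by
    refine lt_of_le_of_ne hq₀ ?_
    rintro rfl
    rcases h5 with ⟨h5, -⟩ | ⟨-, h5⟩
    · exact hzA (h5 ▸ h6.left_mem)
    · exact hzB (h5 ▸ h7.left_mem)
  have hDS' : ∀ x ∈ D, x ∉ Sa ∧ x ∉ Sb := by
    intro x hx
    constructor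
    · intro hx'
      exact hzA (hDS x hx (Or.inl hx') ▸ hx')
    · intro hx'
      exact hzB (hDS x hx (Or.inr hx') ▸ hx')
  have hDlow' : ∀ q ≤ s, p q ∈ D → q = q₀ := fun q hq hqD =>
    hp.inj q (by omega) q₀ (by omega) (hDlow q hq hqD)
  rcases h5 with ⟨rfl, rfl⟩ | ⟨rfl, rfl⟩
  · refine ⟨m', q₀, D, Sa, _, _, hq₀s, by omega, hm1, hm2, Or.inr ⟨rfl, rfl⟩, hD, h6, ?_, ?_, ?_⟩
    · exact fun x hx => (hDS' x hx).1
    · rintro q hq (hq' | hq')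
      · exact Or.inr (hDlow' q hq hq')
      · rcases h9 q hq (Or.inl hq') with rfl | rfl
        · exact Or.inl rfl
        · exact absurd h7.left_mem (h8 _ hq')
    · rintro q hq hqN (hq' | hq')
      · exact hDhigh q hq hqN hq'
      · exact (hhigh q hq hqN (Or.inl hq')).elim
  · refine ⟨m', q₀, D, Sb ++ [p m], _, _, hq₀s, by omega, hm1, hm2, Or.inr ⟨rfl, rfl⟩, hD, hBm,
      ?_, ?_, ?_⟩
    · intro x hx hxB
      rw [hBm'] at hxB
      rcases hxB with hxB | rfl
      · exact (hDS' x hx).2 hxB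
      · exact hvD hx
    · intro q hq hq'
      rw [hBm'] at hq'
      rcases hq' with hq' | hq' | hq'
      · exact Or.inr (hDlow' q hq hq')
      · rcases h9 q hq (Or.inr hq') with rfl | rfl
        · exact Or.inl rfl
        · exact absurd hq' (h8 _ h6.left_mem)
      · exact absurd hq' (hsw q hq)
    · intro q hq hqN hq'
      rw [hBm'] at hq'
      rcases hq' with hq' | hq' | hq'
      · exact hDhigh q hq hqN hq'
      · exact (hhigh q hq hqN (Or.inr hq')).elim
      · have := hp.inj q hqN m h4 hq'
        omega

/-- In a 2-connected graph the parts `p 0, …, p s` and `p t, …, p (N - 1)` of a path are joined by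
two disjoint strands, one leaving from `p s` and one arriving at `p t`. -/
theorem TwoConnected.exists_isLadder (hG : TwoConnected G) {p : ℕ → V} {N s t : ℕ}
    (hp : PathFn G p N) (hs : 1 ≤ s) (hst : s < t) (htN : t + 1 < N) :
    ∃ m i Sa Sb sa sb, IsLadder G p N s t m i Sa Sb sa sb := by
  suffices H : ∃ e ≤ t, ∃ m > t, ∃ i Sa Sb sa sb, IsLadder G p N s e m i Sa Sb sa sb by
    obtain ⟨e, he, m, hm, i, Sa, Sb, sa, sb, h⟩ := H
    obtain ⟨Sb', h'⟩ := h.extend hp he hm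
    exact ⟨m, i, Sa, Sb', sa, sb, h'⟩
  have key : ∀ d e : ℕ, t - e = d → e ≤ t → (∃ m i Sa Sb sa sb, IsLadder G p N s e m i Sa Sb sa sb) →
      ∃ e ≤ t, ∃ m > t, ∃ i Sa Sb sa sb, IsLadder G p N s e m i Sa Sb sa sb := by
    intro d
    induction d using Nat.strong_induction_on with
    | _ d ih =>
      rintro e hd he ⟨m, i, Sa, Sb, sa, sb, h⟩
      by_cases hm : t < m
      · exact ⟨e, he, m, hm, i, Sa, Sb, sa, sb, h⟩
      · have h3 := h.e_lt
        obtain ⟨Sb', h'⟩ := h.extend hp (e' := m - 1) (by omega) (by omega)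
        exact ih (t - m) (by omega) m rfl (by omega)
          (hG.exists_isLadder_succ hp h' (by omega) (by omega))
  exact key _ s rfl hst.le (hG.exists_isLadder_base hp hs (by omega))

theorem CycleList.of_four_paths {x y z w : V} {L S M T : List V} (hL : PathList G x y L)
    (hS : PathList G y z S) (hM : PathList G z w M) (hT : PathList G x w T)
    (hLS : ∀ v ∈ L, v ∈ S → v = y) (hSM : ∀ v ∈ S, v ∈ M → v = z) (hLM : ∀ v ∈ L, v ∉ M)
    (hLT : ∀ v ∈ L, v ∈ T → v = x) (hMT : ∀ v ∈ M, v ∈ T → v = w) (hST : ∀ v ∈ S, v ∉ T) :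
    ∃ c, CycleList G c ∧ L.length + M.length ≤ c.length := by
  obtain ⟨A, hA, hAm, hAl⟩ := hL.glue hS hLS
  obtain ⟨B, hB, hBm, hBl⟩ := hA.glue hM (by
    intro v hv hv'
    rcases (hAm v).1 hv with h | h
    · exact absurd hv' (hLM v h)
    · exact hSM v h hv')
  have hxw : x ≠ w := by
    rintro rfl
    exact hLM _ hL.left_mem hM.right_mem
  have hyz : y ≠ z := by
    rintro rfl
    exact hLM _ hL.right_mem hM.left_mem
  obtain ⟨c, hc, hcl, -⟩ := CycleList.of_two_paths hB hT (by
    intro v hv hvT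
    rcases (hBm v).1 hv with h | h
    · rcases (hAm v).1 h with h | h
      · exact Or.inl (hLT v h hvT)
      · exact absurd hvT (hST v h)
    · exact Or.inr (hMT v h hvT)) hxw
  have := hS.two_le_length hyz
  have := hT.two_le_length hxw
  exact ⟨c, hc, by omega⟩

theorem two_mul_countP_le {col : V → Bool} (c : Bool) :
    ∀ l : List V, l.IsChain (fun u v => col u ≠ col v) →
      2 * l.countP (fun v => col v = c) ≤ l.length + if l.head?.map col = some c then 1 else 0 := by
  intro l
  induction l with
  | nil => simp
  | cons x t ih =>
    intro h
    have ih := ih h.tail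
    rw [List.countP_cons]
    cases t with
    | nil =>
      by_cases hx : col x = c <;> simp [hx]
    | cons y t =>
      have hxy := (List.isChain_cons_cons.1 h).1
      simp only [List.head?_cons, Option.map_some, Option.some.injEq, List.length_cons,
        decide_eq_true_eq] at ih ⊢
      by_cases hx : col x = c
      · have : ¬ col y = c := fun h => hxy (hx.trans h.symm)
        simp only [hx, this, if_true, if_false] at ih ⊢
        omega
      · simp only [hx, if_false] at ih ⊢
        split_ifs at ih <;> omega

theorem card_le_countP [DecidableEq V] {f : V → Bool} {T : Finset V} {l : List V}
    (hT : ∀ x ∈ T, x ∈ l ∧ f x) : T.card ≤ l.countP f := by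
  rw [List.countP_eq_length_filter]
  calc T.card ≤ (l.filter f).toFinset.card := by
        refine Finset.card_le_card fun x hx => ?_
        simpa using hT x hx
    _ ≤ _ := List.toFinset_card_le _

theorem PathList.two_mul_card_le [DecidableEq V] {col : V → Bool}
    (hcol : ∀ u v, G.Adj u v → col u ≠ col v) {u v : V} {l : List V} (h : PathList G u v l)
    {c : Bool} {T : Finset V} (hT : ∀ x ∈ T, x ∈ l ∧ col x = c) : 2 * T.card ≤ l.length + 1 := by
  have h1 := card_le_countP (f := fun v => decide (col v = c)) (T := T) (l := l)
    (by simpa using hT)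
  have h2 := two_mul_countP_le c l (h.2.1.imp hcol)
  split_ifs at h2 <;> omega

theorem PathList.two_mul_card_le_of_right [DecidableEq V] {col : V → Bool}
    (hcol : ∀ u v, G.Adj u v → col u ≠ col v) {u v : V} {l : List V} (h : PathList G u v l)
    {c : Bool} (hv : col v ≠ c) {T : Finset V} (hT : ∀ x ∈ T, x ∈ l ∧ col x = c) :
    2 * T.card ≤ l.length := by
  have h1 := card_le_countP (f := fun v => decide (col v = c)) (T := T) (l := l.reverse)
    (by simpa using hT)
  have h2 := two_mul_countP_le c l.reverse (h.reverse.2.1.imp hcol)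
  have h3 := h.reverse.2.2.1
  rw [h3] at h2
  simp only [Option.map_some, Option.some.injEq, hv, if_false, List.length_reverse] at h2
  omega

theorem PathFn.col_eq_iff {col : V → Bool} (hcol : ∀ u v, G.Adj u v → col u ≠ col v)
    {p : ℕ → V} {N : ℕ} (hp : PathFn G p N) : ∀ q < N, (col (p q) = col (p 0) ↔ q % 2 = 0) := by
  intro q
  induction q with
  | zero => simp
  | succ q ih =>
    intro hq
    have ih := ih (by omega)
    have h := hcol _ _ (hp.adj q hq)
    generalize col (p q) = x at *
    generalize col (p (q + 1)) = y at *
    generalize col (p 0) = z at *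
    have h2 : y = z ↔ ¬ x = z := by
      revert h
      cases x <;> cases y <;> cases z <;> simp
    rw [h2, ih]
    omega

theorem PathFn.cycleList_crossing {p : ℕ → V} {N i j : ℕ} (hp : PathFn G p N) (hji : j < i)
    (hi : i < N) (h0 : G.Adj (p 0) (p i)) (hN : G.Adj (p (N - 1)) (p j)) :
    CycleList G (seg p 0 j ++ (seg p i (N - 1)).reverse) := by
  refine ⟨p 0, p i, (hp.pathList_seg (Nat.zero_le j) (by omega)).append
    (hp.pathList_seg (by omega) (by omega)).reverse hN.symm ?_, h0.symm⟩
  intro x hx hx'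
  rw [List.mem_reverse] at hx'
  obtain ⟨a, ha1, ha2, rfl⟩ := mem_seg.1 hx
  obtain ⟨b, hb1, hb2, hb⟩ := mem_seg.1 hx'
  have := hp.inj b (by omega) a (by omega) hb
  omega

section LongestPath

variable [Fintype V] [DecidableRel G.Adj]

theorem PathFn.exists_long_pathList_left {col : V → Bool}
    (hcol : ∀ u v, G.Adj u v → col u ≠ col v) {p : ℕ → V} {N s i : ℕ}
    (hp : PathFn G p N) (hsN : s < N) (his : i < s) (hs : G.Adj (p 0) (p s))
    (hnb : ∀ x, G.Adj (p 0) x → ∃ q ≤ s, p q = x) :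
    ∃ L, PathList G (p i) (p s) L ∧ (∀ x ∈ L, ∃ q ≤ s, p q = x) ∧
      2 * G.degree (p 0) ≤ L.length + 1 := by
  classical
  have hex : ∃ q, i < q ∧ G.Adj (p 0) (p q) := ⟨s, his, hs⟩
  obtain ⟨h1, h2⟩ := Nat.find_spec hex
  have hmin := fun q => Nat.find_min' hex (m := q)
  generalize Nat.find hex = r at *
  have hrs : r ≤ s := hmin s ⟨his, hs⟩
  have hL : PathList G (p i) (p s) ((seg p 0 i).reverse ++ seg p r s) := by
    refine (hp.pathList_seg (Nat.zero_le i) (by omega)).reverse.append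
      (hp.pathList_seg hrs hsN) h2 ?_
    intro x hx hx'
    rw [List.mem_reverse] at hx
    obtain ⟨a, ha1, ha2, rfl⟩ := mem_seg.1 hx
    obtain ⟨b, hb1, hb2, hb⟩ := mem_seg.1 hx'
    have := hp.inj b (by omega) a (by omega) hb
    omega
  refine ⟨_, hL, ?_, ?_⟩
  · intro x hx
    simp only [List.mem_append, List.mem_reverse] at hx
    rcases hx with hx | hx <;>
    · obtain ⟨a, ha1, ha2, rfl⟩ := mem_seg.1 hx
      exact ⟨a, by omega, rfl⟩
  · rw [← SimpleGraph.card_neighborFinset_eq_degree]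
    refine hL.two_mul_card_le hcol (c := !col (p 0)) ?_
    intro x hx
    rw [SimpleGraph.mem_neighborFinset] at hx
    refine ⟨?_, ?_⟩
    · obtain ⟨q, hq, rfl⟩ := hnb x hx
      simp only [List.mem_append, List.mem_reverse, mem_seg]
      by_cases hqi : q ≤ i
      · exact Or.inl ⟨q, by omega, hqi, rfl⟩
      · exact Or.inr ⟨q, hmin q ⟨by omega, hx⟩, hq, rfl⟩
    · have := hcol _ _ hx
      revert this
      cases col x <;> cases col (p 0) <;> simp

/-- If the neighbours of the first vertex of a path all precede those of its last vertex, then a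
2-connected bipartite graph has a cycle through essentially all these neighbours. -/
theorem TwoConnected.exists_cycleList_of_lt {col : V → Bool}
    (hcol : ∀ u v, G.Adj u v → col u ≠ col v) (hG : TwoConnected G) {p : ℕ → V} {N s t : ℕ}
    (hp : PathFn G p N) (hs1 : 1 ≤ s) (hst : s < t) (htN : t + 1 < N) (hs : G.Adj (p 0) (p s))
    (ht : G.Adj (p (N - 1)) (p t)) (hnbs : ∀ x, G.Adj (p 0) x → ∃ q ≤ s, p q = x)
    (hnbt : ∀ x, G.Adj (p (N - 1)) x → ∃ q, t ≤ q ∧ q < N ∧ p q = x) :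
    ∃ c, CycleList G c ∧ 2 * (G.degree (p 0) + G.degree (p (N - 1))) ≤ c.length + 2 := by
  obtain ⟨m, i, Sa, Sb, sa, sb, h⟩ := hG.exists_isLadder hp hs1 hst htN
  obtain ⟨h1, h2, h3, h4, h5, h6, h7, h8, h9, h10⟩ := h
  obtain ⟨L, hL, hLm, hLl⟩ := hp.exists_long_pathList_left hcol (by omega) h1 hs hnbs
  obtain ⟨M, hM, hMm, hMl⟩ := hp.reverse.exists_long_pathList_left hcol (s := N - 1 - t)
    (i := N - 1 - m) (by omega) (by omega)
    (by simpa [show N - 1 - (N - 1 - t) = t by omega] using ht)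
    (by
      intro x hx
      obtain ⟨q, hq1, hq2, rfl⟩ := hnbt x (by simpa using hx)
      exact ⟨N - 1 - q, by omega, by congr 1; omega⟩)
  simp only [show N - 1 - (N - 1 - t) = t by omega, show N - 1 - (N - 1 - m) = m by omega,
    Nat.sub_zero] at hM hMl
  have hMm' : ∀ x ∈ M, ∃ q, t ≤ q ∧ q < N ∧ p q = x := by
    intro x hx
    obtain ⟨q, hq, rfl⟩ := hMm x hx
    exact ⟨N - 1 - q, by omega, by omega, rfl⟩
  have hLM : ∀ v ∈ L, v ∉ M := by
    intro v hv hv'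
    obtain ⟨a, ha, rfl⟩ := hLm v hv
    obtain ⟨b, hb1, hb2, hb⟩ := hMm' _ hv'
    have := hp.inj b (by omega) a (by omega) hb
    omega
  have hpi : ∀ x ∈ L, x ∈ Sa ∨ x ∈ Sb → x = p s ∨ x = p i := by
    intro x hx hx'
    obtain ⟨a, ha, rfl⟩ := hLm x hx
    rcases h9 a ha hx' with rfl | rfl
    · exact Or.inl rfl
    · exact Or.inr rfl
  have hpt : ∀ x ∈ M, x ∈ Sa ∨ x ∈ Sb → x = p t ∨ x = p m := by
    intro x hx hx'
    obtain ⟨a, ha, ha2, rfl⟩ := hMm' x hx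
    rcases ha.eq_or_lt with rfl | ha
    · exact Or.inl rfl
    · exact Or.inr (by rw [h10 a ha ha2 hx'])
  have hA := h6.left_mem
  have hA' := h6.right_mem
  have hB := h7.left_mem
  have hB' := h7.right_mem
  rcases h5 with ⟨rfl, rfl⟩ | ⟨rfl, rfl⟩
  · obtain ⟨c, hc, hcl⟩ := CycleList.of_four_paths hL h6 hM h7
      (fun v hv hv' => (hpi v hv (Or.inl hv')).resolve_right fun h => h8 _ hv' (h ▸ hB))
      (fun v hv hv' => (hpt v hv' (Or.inl hv)).resolve_left fun h => h8 _ hv (h ▸ hB'))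
      hLM
      (fun v hv hv' => (hpi v hv (Or.inr hv')).resolve_left fun h => h8 _ (h ▸ hA) hv')
      (fun v hv hv' => (hpt v hv (Or.inr hv')).resolve_right fun h => h8 _ (h ▸ hA') hv')
      h8
    exact ⟨c, hc, by omega⟩
  · obtain ⟨c, hc, hcl⟩ := CycleList.of_four_paths hL h7 hM.reverse h6
      (fun v hv hv' => (hpi v hv (Or.inr hv')).resolve_right fun h => h8 _ (h ▸ hA) hv')
      (fun v hv hv' => (hpt v (List.mem_reverse.1 hv') (Or.inr hv)).resolve_right
        fun h => h8 _ (h ▸ hA') hv)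
      (fun v hv hv' => hLM v hv (List.mem_reverse.1 hv'))
      (fun v hv hv' => (hpi v hv (Or.inl hv')).resolve_left fun h => h8 _ hv' (h ▸ hB))
      (fun v hv hv' => (hpt v (List.mem_reverse.1 hv) (Or.inl hv')).resolve_left
        fun h => h8 _ hv' (h ▸ hB'))
      (fun v hv hv' => h8 v hv' hv)
    rw [List.length_reverse] at hcl
    exact ⟨c, hc, by omega⟩

/-- Under the degree-sum condition, a path with an even number of vertices whose ends have all
their neighbours on it either has its vertex set spanned by a cycle, or yields a long cycle. -/
theorem TwoConnected.exists_spanning_or_long {col : V → Bool}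
    (hcol : ∀ u v, G.Adj u v → col u ≠ col v) (hG : TwoConnected G) {k : ℕ}
    (hdeg : ∀ u v, col u ≠ col v → k + 2 ≤ G.degree u + G.degree v)
    (hno : ∀ c, CycleList G c → c.length < 2 * k + 2) {p : ℕ → V} {l : ℕ} (hl : 1 ≤ l)
    (hp : PathFn G p (2 * l)) (h0 : ∀ x, G.Adj (p 0) x → ∃ q < 2 * l, p q = x)
    (hN : ∀ x, G.Adj (p (2 * l - 1)) x → ∃ q < 2 * l, p q = x) :
    ∃ c, CycleList G c ∧ c.length = 2 * l ∧ ∀ x, x ∈ c ↔ ∃ q < 2 * l, p q = x := by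
  classical
  by_contra hspan
  have hpar := hp.col_eq_iff hcol
  have hend : col (p (2 * l - 1)) ≠ col (p 0) := by
    rw [Ne, hpar _ (by omega)]
    omega
  have hodd : ∀ x, G.Adj (p 0) x → ∃ m < l, p (2 * m + 1) = x := by
    intro x hx
    obtain ⟨q, hq, rfl⟩ := h0 x hx
    have h1 := (hcol _ _ hx).symm
    rw [Ne, hpar q hq] at h1
    exact ⟨q / 2, by omega, by congr 1; omega⟩
  have heven : ∀ x, G.Adj (p (2 * l - 1)) x → ∃ m < l, p (2 * m) = x := by
    intro x hx
    obtain ⟨q, hq, rfl⟩ := hN x hx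
    have h1 : col (p q) = col (p 0) := by
      have := hcol _ _ hx
      revert this hend
      cases col (p q) <;> cases col (p 0) <;> cases col (p (2 * l - 1)) <;> simp
    rw [hpar q hq] at h1
    exact ⟨q / 2, by omega, by congr 1; omega⟩
  set I := (Finset.range l).filter fun m => G.Adj (p 0) (p (2 * m + 1)) with hI
  set J := (Finset.range l).filter fun m => G.Adj (p (2 * l - 1)) (p (2 * m)) with hJ
  have hIm : ∀ m, m ∈ I ↔ m < l ∧ G.Adj (p 0) (p (2 * m + 1)) := by simp [hI]
  have hJm : ∀ m, m ∈ J ↔ m < l ∧ G.Adj (p (2 * l - 1)) (p (2 * m)) := by simp [hJ]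
  have hIc : G.degree (p 0) ≤ I.card := by
    rw [← SimpleGraph.card_neighborFinset_eq_degree]
    refine (Finset.card_le_card (t := I.image fun m => p (2 * m + 1)) ?_).trans
      Finset.card_image_le
    intro x hx
    rw [SimpleGraph.mem_neighborFinset] at hx
    obtain ⟨m, hm, rfl⟩ := hodd x hx
    exact Finset.mem_image_of_mem _ ((hIm m).2 ⟨hm, hx⟩)
  have hJc : G.degree (p (2 * l - 1)) ≤ J.card := by
    rw [← SimpleGraph.card_neighborFinset_eq_degree]
    refine (Finset.card_le_card (t := J.image fun m => p (2 * m)) ?_).trans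
      Finset.card_image_le
    intro x hx
    rw [SimpleGraph.mem_neighborFinset] at hx
    obtain ⟨m, hm, rfl⟩ := heven x hx
    exact Finset.mem_image_of_mem _ ((hJm m).2 ⟨hm, hx⟩)
  have hsum := hdeg _ _ hend
  have hcross : ∀ b ∈ J, ∀ a ∈ I, b ≤ a → CycleList G
      (seg p 0 (2 * b) ++ (seg p (2 * a + 1) (2 * l - 1)).reverse) := by
    intro b hb a ha hba
    rw [hIm] at ha
    rw [hJm] at hb
    exact hp.cycleList_crossing (by omega) (by omega) ha.2 hb.2
  have hdis : Disjoint I J := by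
    rw [Finset.disjoint_left]
    intro m hmI hmJ
    have hc := hcross m hmJ m hmI le_rfl
    have := ((hIm m).1 hmI).1
    refine hspan ⟨_, hc, ?_, ?_⟩
    · rw [List.length_append, List.length_reverse, length_seg, length_seg]
      omega
    · intro x
      simp only [List.mem_append, List.mem_reverse, mem_seg]
      constructor
      · rintro (⟨q, h1, h2, rfl⟩ | ⟨q, h1, h2, rfl⟩)
        · exact ⟨q, by omega, rfl⟩
        · exact ⟨q, by omega, rfl⟩
      · rintro ⟨q, hq, rfl⟩
        by_cases h : q ≤ 2 * m
        · exact Or.inl ⟨q, by omega, h, rfl⟩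
        · exact Or.inr ⟨q, by omega, by omega, rfl⟩
  have hcard := Finset.card_union_of_disjoint hdis
  by_cases hX : ∃ b ∈ J, ∃ a ∈ I, b < a
  · have hne : ((J ×ˢ I).filter fun x => x.1 < x.2).Nonempty := by
      obtain ⟨b, hb, a, ha, hba⟩ := hX
      exact ⟨(b, a), by simp [hb, ha, hba]⟩
    obtain ⟨⟨b, a⟩, hmem, hmin⟩ := Finset.exists_min_image _ (fun x => x.2 - x.1) hne
    simp only [Finset.mem_filter, Finset.mem_product, and_imp, Prod.forall] at hmem hmin
    obtain ⟨⟨hb, ha⟩, hba⟩ := hmem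
    have hlen := hno _ (hcross b hb a ha hba.le)
    have hal := ((hIm a).1 ha).1
    rw [List.length_append, List.length_reverse, length_seg, length_seg] at hlen
    have hsub : I ∪ J ⊆ Finset.range l \ Finset.Ioo b a := by
      intro x hx
      rw [Finset.mem_union] at hx
      rw [Finset.mem_sdiff, Finset.mem_Ioo, Finset.mem_range]
      refine ⟨?_, ?_⟩
      · rcases hx with hx | hx
        · exact ((hIm x).1 hx).1
        · exact ((hJm x).1 hx).1
      · rintro ⟨hbx, hxa⟩
        rcases hx with hx | hx
        · have := hmin b x hb hx hbx
          omega
        · have := hmin x a hx ha hxa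
          omega
    have hle := Finset.card_le_card hsub
    rw [Finset.card_sdiff_of_subset, Finset.card_range, Nat.card_Ioo] at hle
    · omega
    · intro x hx
      rw [Finset.mem_Ioo] at hx
      rw [Finset.mem_range]
      omega
  · push Not at hX
    have hI0 : 0 ∈ I := (hIm 0).2 ⟨hl, by simpa using hp.adj 0 (by omega)⟩
    have hJl : l - 1 ∈ J := by
      refine (hJm _).2 ⟨by omega, ?_⟩
      have := hp.adj (2 * (l - 1)) (by omega)
      rw [show 2 * (l - 1) + 1 = 2 * l - 1 by omega] at this
      exact this.symm
    obtain ⟨a, haM, haX⟩ := I.exists_max_image id ⟨0, hI0⟩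
    obtain ⟨b, hbM, hbX⟩ := J.exists_min_image id ⟨_, hJl⟩
    simp only [id] at haX hbX
    have hab : a < b := by
      refine lt_of_le_of_ne (hX b hbM a haM) ?_
      rintro rfl
      exact Finset.disjoint_left.1 hdis haM hbM
    obtain ⟨hal, ha⟩ := (hIm a).1 haM
    obtain ⟨hbl, hb⟩ := (hJm b).1 hbM
    obtain ⟨c, hc, hcl⟩ := hG.exists_cycleList_of_lt hcol hp (s := 2 * a + 1) (t := 2 * b)
      (by omega) (by omega) (by omega) ha hb
      (by
        intro x hx
        obtain ⟨m, hm, rfl⟩ := hodd x hx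
        have := haX m ((hIm m).2 ⟨hm, hx⟩)
        exact ⟨_, by omega, rfl⟩)
      (by
        intro x hx
        obtain ⟨m, hm, rfl⟩ := heven x hx
        have := hbX m ((hJm m).2 ⟨hm, hx⟩)
        exact ⟨_, by omega, by omega, rfl⟩)
    have := hno c hc
    omega

end LongestPath

/-- Every vertex of `J` can be reached from `r ∈ J` inside `J`. -/
def ConnectedFrom (G : SimpleGraph V) (J : Finset V) (r : V) : Prop :=
  r ∈ J ∧ ∀ S ⊆ J, r ∈ S → S ≠ J → ∃ u ∈ S, ∃ w ∈ J, w ∉ S ∧ G.Adj u w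

/-- `K` is a union of connected components of the subgraph induced on `O`. -/
def ClosedIn (G : SimpleGraph V) (O K : Finset V) : Prop :=
  K ⊆ O ∧ ∀ x ∈ K, ∀ y ∈ O, G.Adj x y → y ∈ K

theorem exists_component [DecidableEq V] {O : Finset V} {w : V} (hw : w ∈ O) :
    ∃ K, ClosedIn G O K ∧ ConnectedFrom G K w := by
  classical
  obtain ⟨K, hK, hmin⟩ := Finset.exists_min_image
    (O.powerset.filter fun K => w ∈ K ∧ ClosedIn G O K) Finset.card
    ⟨O, by simpa [hw] using ⟨subset_rfl, fun x _ y hy _ => hy⟩⟩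
  simp only [Finset.mem_filter, Finset.mem_powerset, and_imp] at hK hmin
  obtain ⟨-, hwK, hcl⟩ := hK
  refine ⟨K, hcl, hwK, ?_⟩
  intro S hSK hwS hne
  by_contra! hcon
  have hlt := Finset.card_lt_card (hSK.ssubset_of_ne hne)
  have := hmin S (hSK.trans hcl.1) hwS ⟨hSK.trans hcl.1, fun x hx y hy hxy => by
    by_contra hyS
    exact hcon x hx y (hcl.2 x (hSK hx) y hy hxy) hyS hxy⟩
  omega

theorem card_filter_sdiff_add [DecidableEq V] {J K : Finset V} (h : K ⊆ J) (f : V → Prop)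
    [DecidablePred f] :
    ((J \ K).filter f).card + (K.filter f).card = (J.filter f).card := by
  rw [← Finset.card_union_of_disjoint, ← Finset.filter_union, Finset.sdiff_union_of_subset h]
  exact Finset.disjoint_filter_filter Finset.sdiff_disjoint

/-- A depth-first search from `r` in a connected bipartite graph with enough vertices of colour
`c` finds a path from `r` that ends in a vertex of colour `c` all of whose neighbours lie on the
path. -/
theorem ConnectedFrom.exists_leaf_path [DecidableEq V] {col : V → Bool}
    (hcol : ∀ u v, G.Adj u v → col u ≠ col v) (c : Bool) :
    ∀ (n : ℕ) (J : Finset V) (r : V), J.card = n → ConnectedFrom G J r →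
      ((col r = c ∧ (J.filter fun v => ¬ col v = c).card + 1 ≤ (J.filter fun v => col v = c).card) ∨
        (¬ col r = c ∧
          (J.filter fun v => ¬ col v = c).card ≤ (J.filter fun v => col v = c).card)) →
      ∃ b R, PathList G r b R ∧ (∀ x ∈ R, x ∈ J) ∧ col b = c ∧ (∀ x ∈ J, G.Adj b x → x ∈ R) ∧
        (b = r → J = {r}) := by
  intro n
  induction n using Nat.strong_induction_on with
  | _ n ih =>
    rintro J r rfl ⟨hrJ, hconn⟩ hex
    by_cases hJ : J = {r}
    · subst hJ
      have hr : col r = c := by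
        by_contra hr
        simp [hr, Finset.filter_singleton] at hex
      exact ⟨r, [r], PathList.single r, by simp, hr, by simp, fun _ => rfl⟩
    obtain ⟨u, hu, w, hwJ, hwr, hadj⟩ := hconn {r} (by simpa using hrJ) (by simp) (Ne.symm hJ)
    rw [Finset.mem_singleton] at hu hwr
    subst hu
    obtain ⟨K, hcl, hKw⟩ := exists_component (G := G) (O := J.erase u) (w := w)
      (Finset.mem_erase.2 ⟨hwr, hwJ⟩)
    have hKJ : K ⊆ J := hcl.1.trans (Finset.erase_subset _ _)
    have huK : u ∉ K := fun h => (Finset.mem_erase.1 (hcl.1 h)).1 rfl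
    have hKlt : K.card < J.card := by
      refine Finset.card_lt_card (hKJ.ssubset_of_ne ?_)
      rintro rfl
      exact huK hrJ
    have hcw := hcol _ _ hadj
    by_cases hexK : (col w = c ∧ (K.filter fun v => ¬ col v = c).card + 1 ≤
        (K.filter fun v => col v = c).card) ∨ (¬ col w = c ∧
          (K.filter fun v => ¬ col v = c).card ≤ (K.filter fun v => col v = c).card)
    · obtain ⟨b, R, hR, hRK, hb, hbR, -⟩ := ih _ hKlt K w rfl hKw hexK
      have hbK := hRK b hR.right_mem
      refine ⟨b, [u] ++ R, (PathList.single u).append hR hadj ?_, ?_, hb, ?_, ?_⟩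
      · intro x hx hxR
        rw [List.mem_singleton] at hx
        exact huK (hx ▸ hRK x hxR)
      · intro x hx
        simp only [List.singleton_append, List.mem_cons] at hx
        rcases hx with rfl | hx
        · exact hrJ
        · exact hKJ (hRK x hx)
      · intro x hx hbx
        simp only [List.singleton_append, List.mem_cons]
        by_cases hxu : x = u
        · exact Or.inl hxu
        · exact Or.inr (hbR x (hcl.2 b hbK x (Finset.mem_erase.2 ⟨hxu, hx⟩) hbx) hbx)
      · rintro rfl
        exact absurd hbK huK
    · have hcA := card_filter_sdiff_add hKJ fun v => ¬ col v = c
      have hcB := card_filter_sdiff_add hKJ fun v => col v = c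
      have huJ : u ∈ J \ K := Finset.mem_sdiff.2 ⟨hrJ, huK⟩
      have hex2 : (col u = c ∧ ((J \ K).filter fun v => ¬ col v = c).card + 2 ≤
          ((J \ K).filter fun v => col v = c).card) ∨ (¬ col u = c ∧
          ((J \ K).filter fun v => ¬ col v = c).card ≤
            ((J \ K).filter fun v => col v = c).card) := by
        by_cases hu : col u = c
        · have hw : ¬ col w = c := fun h => hcw (hu.trans h.symm)
          simp only [hu, hw, true_and, false_and, not_true, not_false_eq_true, or_false, false_or]
            at hex hexK ⊢
          omega
        · have hw : col w = c := by
            revert hcw hu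
            cases col u <;> cases col w <;> cases c <;> simp
          simp only [hu, hw, true_and, false_and, not_true, not_false_eq_true, or_false, false_or]
            at hex hexK ⊢
          omega
      have hconn2 : ConnectedFrom G (J \ K) u := by
        refine ⟨huJ, ?_⟩
        intro S hS huS hne
        obtain ⟨x, hx, y, hyJ, hyS, hxy⟩ := hconn (S ∪ K)
          (Finset.union_subset (hS.trans Finset.sdiff_subset) hKJ) (Finset.mem_union_left _ huS)
          (by
            intro h
            refine hne (Finset.Subset.antisymm hS ?_)
            intro z hz
            rw [Finset.mem_sdiff] at hz
            have := h ▸ hz.1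
            rw [Finset.mem_union] at this
            exact this.resolve_right hz.2)
        rw [Finset.mem_union] at hx hyS
        push Not at hyS
        rcases hx with hx | hx
        · exact ⟨x, hx, y, Finset.mem_sdiff.2 ⟨hyJ, hyS.2⟩, hyS.1, hxy⟩
        · refine absurd (hcl.2 x hx y (Finset.mem_erase.2 ⟨?_, hyJ⟩) hxy) hyS.2
          rintro rfl
          exact hyS.1 huS
      obtain ⟨b, R, hR, hRK, hb, hbR, hbu⟩ := ih (J \ K).card
        (Finset.card_lt_card ⟨Finset.sdiff_subset, fun h =>
          (Finset.mem_sdiff.1 (h hwJ)).2 hKw.1⟩) (J \ K) u rfl hconn2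
        (by
          rcases hex2 with ⟨h1, h2⟩ | h
          · exact Or.inl ⟨h1, by omega⟩
          · exact Or.inr h)
      have hbne : b ≠ u := by
        rintro rfl
        have hs := hbu rfl
        rw [hs] at hex2
        simp [hb, Finset.filter_singleton] at hex2
      have hbJ := Finset.mem_sdiff.1 (hRK b hR.right_mem)
      refine ⟨b, R, hR, fun x hx => (Finset.mem_sdiff.1 (hRK x hx)).1, hb, ?_,
        fun h => absurd h hbne⟩
      intro x hx hbx
      by_cases hxK : x ∈ K
      · exact absurd (hcl.2 x hxK b (Finset.mem_erase.2 ⟨hbne, hbJ.1⟩) hbx.symm) hbJ.2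
      · exact hbR x (Finset.mem_sdiff.2 ⟨hx, hxK⟩) hbx

theorem exists_closedIn_leaf_paths [DecidableEq V] {col : V → Bool}
    (hcol : ∀ u v, G.Adj u v → col u ≠ col v) (c : Bool) {O : Finset V}
    (hO : (O.filter fun v => ¬ col v = c).card + 1 ≤ (O.filter fun v => col v = c).card) :
    ∃ J, ClosedIn G O J ∧ J.Nonempty ∧ ∀ r ∈ J, ∃ b R, PathList G r b R ∧ (∀ x ∈ R, x ∈ J) ∧
      col b = c ∧ ∀ x ∈ J, G.Adj b x → x ∈ R := by
  classical
  obtain ⟨J, hJ, hmin⟩ := Finset.exists_min_image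
    (O.powerset.filter fun J => ClosedIn G O J ∧
      (J.filter fun v => ¬ col v = c).card + 1 ≤ (J.filter fun v => col v = c).card) Finset.card
    ⟨O, by simpa using ⟨⟨subset_rfl, fun x _ y hy _ => hy⟩, hO⟩⟩
  simp only [Finset.mem_filter, Finset.mem_powerset, and_imp] at hJ hmin
  obtain ⟨-, hcl, hex⟩ := hJ
  refine ⟨J, hcl, ?_, ?_⟩
  · rw [Finset.nonempty_iff_ne_empty]
    rintro rfl
    simp at hex
  intro r hr
  have hconn : ConnectedFrom G J r := by
    refine ⟨hr, ?_⟩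
    intro S hS hrS hne
    by_contra! hcon
    have hcA := card_filter_sdiff_add hS fun v => ¬ col v = c
    have hcB := card_filter_sdiff_add hS fun v => col v = c
    have hlt := Finset.card_lt_card (hS.ssubset_of_ne hne)
    have hlt2 : (J \ S).card < J.card :=
      Finset.card_lt_card ⟨Finset.sdiff_subset, fun h => (Finset.mem_sdiff.1 (h hr)).2 hrS⟩
    have h1 := hmin S (hS.trans hcl.1) ⟨hS.trans hcl.1, fun x hx y hy hxy => by
      by_contra hyS
      exact hcon x hx y (hcl.2 x (hS hx) y hy hxy) hyS hxy⟩
    have h2 := hmin (J \ S) (Finset.sdiff_subset.trans hcl.1)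
      ⟨Finset.sdiff_subset.trans hcl.1, fun x hx y hy hxy => by
        rw [Finset.mem_sdiff] at hx ⊢
        refine ⟨hcl.2 x hx.1 y hy hxy, fun hyS => ?_⟩
        exact hcon y hyS x hx.1 hx.2 hxy.symm⟩
    omega
  obtain ⟨b, R, h1, h2, h3, h4, -⟩ := hconn.exists_leaf_path hcol c _ J r rfl (by
    by_cases h : col r = c
    · exact Or.inl ⟨h, hex⟩
    · exact Or.inr ⟨h, by omega⟩)
  exact ⟨b, R, h1, h2, h3, h4⟩

theorem PathFn.seg_disjoint {p : ℕ → V} {N i j i' j' : ℕ} (hp : PathFn G p N) (h : j < i')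
    (hj' : j' < N) : ∀ x ∈ seg p i j, x ∉ seg p i' j' := by
  intro x hx hx'
  obtain ⟨a, ha1, ha2, rfl⟩ := mem_seg.1 hx
  obtain ⟨b, hb1, hb2, hb⟩ := mem_seg.1 hx'
  have := hp.inj b (by omega) a (by omega) hb
  omega

theorem exists_longest_pathList [Fintype V] [Nonempty V] (G : SimpleGraph V) :
    ∃ u v l, PathList G u v l ∧ ∀ u' v' l', PathList G u' v' l' → l'.length ≤ l.length := by
  classical
  obtain ⟨x⟩ := ‹Nonempty V›
  set Q : ℕ → Prop := fun n => ∃ u v l, PathList G u v l ∧ l.length = n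
  have hQ : Q 1 := ⟨x, x, [x], PathList.single x, rfl⟩
  have hle : ∀ n, Q n → n ≤ Fintype.card V := by
    rintro n ⟨u, v, l, h, rfl⟩
    exact h.1.length_le_card
  obtain ⟨u, v, l, h, hl⟩ := Nat.findGreatest_spec (hle 1 hQ) hQ
  refine ⟨u, v, l, h, fun u' v' l' h' => ?_⟩
  rw [hl]
  have hQ' : Q l'.length := ⟨u', v', l', h', rfl⟩
  exact Nat.le_findGreatest (hle _ hQ') hQ'

theorem TwoConnected.exists_adj_notMem [Fintype V] (hG : TwoConnected G)
    (hV : 3 ≤ Fintype.card V) {S : Set V} (hS : S.Nonempty) {w : V} (hw : w ∉ S) :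
    ∃ x ∈ S, ∃ y, y ∉ S ∧ G.Adj x y := by
  by_cases h : ∃ w', w' ∉ S ∧ w' ≠ w
  · obtain ⟨x, hx, y, hy, -, hxy⟩ := hG w S hS hw h
    exact ⟨x, hx, y, hy, hxy⟩
  push Not at h
  obtain ⟨s, hs⟩ := hS
  have hsw : s ≠ w := fun h => hw (h ▸ hs)
  obtain ⟨t, hts, htw⟩ : ∃ t, t ≠ s ∧ t ≠ w := by
    classical
    by_contra! hcon
    have : (Finset.univ : Finset V) ⊆ {s, w} := by
      intro t _
      by_cases hts : t = s
      · simp [hts]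
      · simp [hcon t hts]
    have := (Finset.card_le_card this).trans Finset.card_le_two
    rw [Finset.card_univ] at this
    omega
  obtain ⟨x, hx, y, hy, -, hxy⟩ := hG s {w} ⟨w, rfl⟩ (by simpa using hsw) ⟨t, by simpa using htw, hts⟩
  rw [Set.mem_singleton_iff] at hx hy
  subst hx
  exact ⟨y, by_contra fun hyS => hy (h y hyS), x, hw, hxy.symm⟩

section DegreeSum

variable [Fintype V] [DecidableRel G.Adj]

theorem TwoConnected.exists_spanning_cycleList {col : V → Bool}
    (hcol : ∀ u v, G.Adj u v → col u ≠ col v) (hG : TwoConnected G) {k : ℕ}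
    (hdeg : ∀ u v, col u ≠ col v → k + 2 ≤ G.degree u + G.degree v)
    (hno : ∀ c, CycleList G c → c.length < 2 * k + 2) {u v : V} {l : List V}
    (h : PathList G u v l) (huv : col u ≠ col v) (hu : ∀ x, G.Adj u x → x ∈ l)
    (hv : ∀ x, G.Adj v x → x ∈ l) :
    ∃ c, CycleList G c ∧ c.length = l.length ∧ ∀ x, x ∈ c ↔ x ∈ l := by
  obtain ⟨p, hp, rfl, rfl, hmem⟩ := h.exists_pathFn
  have h0 := h.length_pos
  have hpar := hp.col_eq_iff hcol (l.length - 1) (by omega)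
  have hpar' : ¬ (l.length - 1) % 2 = 0 := fun h => huv (hpar.2 h).symm
  obtain ⟨n, hn⟩ : ∃ n, l.length = 2 * n := ⟨l.length / 2, by omega⟩
  simp only [hmem] at hu hv ⊢
  rw [hn] at hp hu hv ⊢
  exact hG.exists_spanning_or_long hcol hdeg hno (by omega) hp hu hv

/-- The core of the argument when the ends of a longest path `p` have the same colour: `R` is a
path outside `p` that starts next to `p a` and ends in a vertex `b` of the other colour all of
whose neighbours are on `R` or among `p 0, …, p a`. -/
theorem TwoConnected.false_of_longest_odd {col : V → Bool}
    (hcol : ∀ u v, G.Adj u v → col u ≠ col v) (hG : TwoConnected G) {k : ℕ}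
    (hdeg : ∀ u v, col u ≠ col v → k + 2 ≤ G.degree u + G.degree v)
    (hno : ∀ c, CycleList G c → c.length < 2 * k + 2) {p : ℕ → V} {l : ℕ}
    (hp : PathFn G p (2 * l + 1))
    (hmax : ∀ u v L, PathList G u v L → L.length ≤ 2 * l + 1)
    (h0 : ∀ x, G.Adj (p 0) x → ∃ q < 2 * l + 1, p q = x)
    (hM : ∀ x, G.Adj (p (2 * l)) x → ∃ q < 2 * l + 1, p q = x) {a : ℕ} (ha : a < 2 * l) {r b : V}
    {R : List V} (hR : PathList G r b R) (har : G.Adj (p a) r)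
    (hRp : ∀ q < 2 * l + 1, p q ∉ R) (hbcol : col b ≠ col (p 0))
    (hb : ∀ x, G.Adj b x → x ∈ R ∨ ∃ q ≤ a, p q = x) : False := by
  classical
  have hpar := hp.col_eq_iff hcol
  have hMcol : col (p (2 * l)) = col (p 0) := (hpar _ (by omega)).2 (by omega)
  have hRpos := hR.length_pos
  have hsegR : ∀ i j, j < 2 * l + 1 → ∀ x ∈ seg p i j, x ∉ R := by
    intro i j hj x hx
    obtain ⟨q, -, hq, rfl⟩ := mem_seg.1 hx
    exact hRp q (by omega)
  have hlow : PathList G (p 0) b (seg p 0 a ++ R) :=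
    (hp.pathList_seg (Nat.zero_le a) (by omega)).append hR har (hsegR 0 a (by omega))
  have hodd : ∀ q < 2 * l + 1, ∀ x, col x = col (p 0) → G.Adj x (p q) → q % 2 = 1 := by
    intro q hq x hx hxq
    have h1 := hcol _ _ hxq
    rw [hx] at h1
    have := hpar q hq
    have : ¬ q % 2 = 0 := fun h => h1 (this.2 h).symm
    omega
  by_cases hI : ∃ i, a < i ∧ i < 2 * l + 1 ∧ G.Adj (p 0) (p i)
  swap
  · push Not at hI
    obtain ⟨c, hc, hcl, hcm⟩ := hG.exists_spanning_cycleList hcol hdeg hno hlow hbcol.symm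
      (by
        intro x hx
        obtain ⟨q, hq, rfl⟩ := h0 x hx
        rw [List.mem_append, mem_seg]
        by_cases hqa : q ≤ a
        · exact Or.inl ⟨q, by omega, hqa, rfl⟩
        · exact absurd hx (hI q (by omega) hq))
      (by
        intro x hx
        rw [List.mem_append, mem_seg]
        rcases hb x hx with h | ⟨q, hq, rfl⟩
        · exact Or.inr h
        · exact Or.inl ⟨q, by omega, hq, rfl⟩)
    obtain ⟨c', z, hc', -, hperm⟩ := hc.rotate (w := p a) ((hcm _).2 (by
      rw [List.mem_append, mem_seg]
      exact Or.inl ⟨a, by omega, le_rfl, rfl⟩))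
    have := hmax _ _ _ (hc'.reverse.append
      (hp.pathList_seg (i := a + 1) (j := 2 * l) (by omega) (by omega)) (hp.adj a (by omega)) (by
        intro x hx hx'
        rw [List.mem_reverse, hperm.mem_iff, hcm, List.mem_append] at hx
        rcases hx with hx | hx
        · exact hp.seg_disjoint (by omega) (by omega) x hx hx'
        · exact hsegR _ _ (by omega) x hx' hx))
    rw [List.length_append, List.length_reverse, hperm.length_eq, hcl, List.length_append,
      length_seg, length_seg] at this
    omega
  obtain ⟨hai, hiM, h0i⟩ := Nat.find_spec hI
  have himin : ∀ q, a < q → q < 2 * l + 1 → G.Adj (p 0) (p q) → Nat.find hI ≤ q :=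
    fun q h1 h2 h3 => Nat.find_min' hI ⟨h1, h2, h3⟩
  generalize Nat.find hI = i at hai hiM h0i himin
  have hthrough : PathList G b (p (2 * l)) ((seg p 0 a ++ R).reverse ++ seg p i (2 * l)) := by
    refine hlow.reverse.append (hp.pathList_seg (by omega) (by omega)) h0i ?_
    intro x hx hx'
    rw [List.mem_reverse, List.mem_append] at hx
    rcases hx with hx | hx
    · exact hp.seg_disjoint hai (by omega) x hx hx'
    · exact hsegR _ _ (by omega) x hx' hx
  by_cases hJ : ∃ j, a < j ∧ j < i ∧ G.Adj (p (2 * l)) (p j)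
  swap
  · push Not at hJ
    obtain ⟨c, hc, hcl, hcm⟩ := hG.exists_spanning_cycleList hcol hdeg hno hthrough
      (by rwa [hMcol])
      (by
        intro x hx
        rw [List.mem_append, List.mem_reverse, List.mem_append, mem_seg]
        rcases hb x hx with h | ⟨q, hq, rfl⟩
        · exact Or.inl (Or.inr h)
        · exact Or.inl (Or.inl ⟨q, by omega, hq, rfl⟩))
      (by
        intro x hx
        obtain ⟨q, hq, rfl⟩ := hM x hx
        rw [List.mem_append, List.mem_reverse, List.mem_append, mem_seg, mem_seg]
        by_cases hqa : q ≤ a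
        · exact Or.inl (Or.inl ⟨q, by omega, hqa, rfl⟩)
        by_cases hqi : q < i
        · exact absurd hx (hJ q (by omega) hqi)
        · exact Or.inr ⟨q, by omega, by omega, rfl⟩)
    obtain ⟨c', z, hc', -, hperm⟩ := hc.rotate (w := p a) ((hcm _).2 (by
      rw [List.mem_append, List.mem_reverse, List.mem_append, mem_seg]
      exact Or.inl (Or.inl ⟨a, by omega, le_rfl, rfl⟩)))
    have hcl' : c'.length = a + 1 + R.length + (2 * l + 1 - i) := by
      rw [hperm.length_eq, hcl, List.length_append, List.length_reverse, List.length_append,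
        length_seg, length_seg]
      omega
    by_cases hia : i = a + 1
    · have := hmax _ _ _ hc'
      omega
    have := hmax _ _ _ (hc'.reverse.append
      (hp.pathList_seg (i := a + 1) (j := i - 1) (by omega) (by omega)) (hp.adj a (by omega)) (by
        intro x hx hx'
        rw [List.mem_reverse, hperm.mem_iff, hcm, List.mem_append, List.mem_reverse,
          List.mem_append] at hx
        rcases hx with (hx | hx) | hx
        · exact hp.seg_disjoint (by omega) (by omega) x hx hx'
        · exact hsegR _ _ (by omega) x hx' hx
        · exact hp.seg_disjoint (by omega) (by omega) x hx' hx))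
    rw [List.length_append, List.length_reverse, hcl', length_seg] at this
    omega
  obtain ⟨j, haj, hji, hMj⟩ := hJ
  have hcyc := hno _ (hp.cycleList_crossing hji hiM h0i (by simpa using hMj))
  rw [List.length_append, List.length_reverse, length_seg, length_seg] at hcyc
  have hlong := hmax _ _ _ (hthrough.append
    (hp.pathList_seg (i := j) (j := i - 1) (by omega) (by omega)) hMj (by
      intro x hx hx'
      rw [List.mem_append, List.mem_reverse, List.mem_append] at hx
      rcases hx with (hx | hx) | hx
      · exact hp.seg_disjoint (by omega) (by omega) x hx hx'
      · exact hsegR _ _ (by omega) x hx' hx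
      · exact hp.seg_disjoint (by omega) (by omega) x hx' hx))
  rw [List.length_append, List.length_append, List.length_reverse, List.length_append, length_seg,
    length_seg, length_seg] at hlong
  have hshift : ∀ w ≤ a, G.Adj b (p w) → ¬ G.Adj (p 0) (p (w + 1)) := by
    intro w hw hbw h0w
    have h1 := ((hp.pathList_seg (i := w + 1) (j := 2 * l) (by omega) (by omega)).reverse.append
      (hp.pathList_seg (Nat.zero_le w) (by omega)) h0w.symm (by
        intro x hx hx'
        rw [List.mem_reverse] at hx
        exact hp.seg_disjoint (by omega) (by omega) x hx' hx)).append (PathList.single b) hbw.symm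
      (by
        intro x hx hxb
        rw [List.mem_singleton] at hxb
        subst hxb
        rw [List.mem_append, List.mem_reverse] at hx
        rcases hx with hx | hx <;> exact hsegR _ _ (by omega) x hx hR.right_mem)
    have h2 := hmax _ _ _ h1
    rw [List.length_append, List.length_append, List.length_reverse, length_seg, length_seg,
      List.length_singleton] at h2
    omega
  have hi2 := hodd i hiM (p 0) rfl h0i
  have hj2 := hodd j (by omega) _ hMcol hMj
  set I := (Finset.range (a / 2 + 1)).filter fun m => 2 * m + 1 ≤ a ∧ G.Adj (p 0) (p (2 * m + 1))
    with hIdef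
  set W := (Finset.range (a / 2 + 1)).filter fun m => G.Adj b (p (2 * m)) with hWdef
  have hIW : I.card + W.card ≤ a / 2 + 1 := by
    rw [← Finset.card_union_of_disjoint]
    · refine (Finset.card_le_card ?_).trans (Finset.card_range _).le
      exact Finset.union_subset (Finset.filter_subset _ _) (Finset.filter_subset _ _)
    · rw [Finset.disjoint_left]
      intro m hmI hmW
      simp only [hIdef, hWdef, Finset.mem_filter, Finset.mem_range] at hmI hmW
      exact hshift (2 * m) (by omega) hmW.2 hmI.2.2
  have hdeg0 : G.degree (p 0) ≤ I.card + (l - i / 2) := by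
    rw [← SimpleGraph.card_neighborFinset_eq_degree]
    refine (Finset.card_le_card (t := (I ∪ Finset.Ico (i / 2) l).image fun m => p (2 * m + 1))
      ?_).trans (Finset.card_image_le.trans ((Finset.card_union_le _ _).trans (by
        rw [Nat.card_Ico])))
    intro x hx
    rw [SimpleGraph.mem_neighborFinset] at hx
    obtain ⟨q, hq, rfl⟩ := h0 x hx
    have hq2 := hodd q hq (p 0) rfl hx
    rw [Finset.mem_image]
    refine ⟨q / 2, ?_, by congr 1; omega⟩
    rw [Finset.mem_union, Finset.mem_Ico]
    by_cases hqa : q ≤ a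
    · refine Or.inl ?_
      simp only [hIdef, Finset.mem_filter, Finset.mem_range]
      refine ⟨by omega, by omega, ?_⟩
      rwa [show 2 * (q / 2) + 1 = q by omega]
    · have := himin q (by omega) hq hx
      exact Or.inr ⟨by omega, by omega⟩
  set T := (G.neighborFinset b).filter fun x => x ∈ R with hTdef
  have hT : 2 * T.card ≤ R.length := by
    refine hR.two_mul_card_le_of_right hcol (c := !col b) (by simp) ?_
    intro x hx
    simp only [hTdef, Finset.mem_filter, SimpleGraph.mem_neighborFinset] at hx
    refine ⟨hx.2, ?_⟩
    have := hcol _ _ hx.1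
    revert this
    cases col b <;> cases col x <;> simp
  have hdegb : G.degree b ≤ W.card + T.card := by
    rw [← SimpleGraph.card_neighborFinset_eq_degree]
    refine (Finset.card_le_card (t := (W.image fun m => p (2 * m)) ∪ T) ?_).trans
      ((Finset.card_union_le _ _).trans (Nat.add_le_add_right Finset.card_image_le _))
    intro x hx
    rw [Finset.mem_union]
    have hx' := hx
    rw [SimpleGraph.mem_neighborFinset] at hx'
    rcases hb x hx' with h | ⟨q, hq, rfl⟩
    · exact Or.inr (Finset.mem_filter.2 ⟨hx, h⟩)
    · left
      have h1 := hcol _ _ hx'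
      have h2 : col (p q) = col (p 0) := by
        revert h1 hbcol
        cases col b <;> cases col (p q) <;> cases col (p 0) <;> simp
      rw [hpar q (by omega)] at h2
      rw [Finset.mem_image]
      refine ⟨q / 2, ?_, by congr 1; omega⟩
      simp only [hWdef, Finset.mem_filter, Finset.mem_range]
      refine ⟨by omega, ?_⟩
      rwa [show 2 * (q / 2) = q by omega]
  have := hdeg _ _ hbcol
  omega

/-- A 2-connected balanced bipartite graph on `2 n ≥ 2 k + 2` vertices in which any two vertices of
different colours have degree sum at least `k + 2` has a cycle of length at least `2 k + 2`. -/
theorem TwoConnected.exists_long_cycleList {col : V → Bool}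
    (hcol : ∀ u v, G.Adj u v → col u ≠ col v) (hG : TwoConnected G) {k n : ℕ} (hk : 1 ≤ k)
    (hkn : k + 1 ≤ n)
    (hn : ∀ c, (Finset.univ.filter fun v => col v = c).card = n)
    (hdeg : ∀ u v, col u ≠ col v → k + 2 ≤ G.degree u + G.degree v) :
    ∃ c, CycleList G c ∧ 2 * k + 2 ≤ c.length := by
  classical
  by_contra! hno
  have hcompl : ∀ c, (Finset.univ.filter fun v => ¬ col v = c).card = n := by
    intro c
    rw [← hn (!c)]
    congr 1
    ext v
    cases col v <;> cases c <;> simp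
  have hV : Fintype.card V = 2 * n := by
    rw [← Finset.card_univ, ← Finset.card_filter_add_card_filter_not (fun v => col v = true),
      hn, hcompl]
    omega
  have : Nonempty V := Fintype.card_pos_iff.1 (by omega)
  obtain ⟨u, v, L, hL, hmax⟩ := exists_longest_pathList G
  have hu : ∀ x, G.Adj u x → x ∈ L := by
    intro x hx
    by_contra hxL
    have := hmax _ _ _ ((PathList.single x).append hL hx.symm (by simpa using hxL))
    simp at this
  have hv : ∀ x, G.Adj v x → x ∈ L := by
    intro x hx
    by_contra hxL
    have := hmax _ _ _ (hL.append (PathList.single x) hx (by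
      rintro y hy hyx
      rw [List.mem_singleton] at hyx
      exact hxL (hyx ▸ hy)))
    simp at this
  by_cases huv : col u = col v
  swap
  · obtain ⟨c, hc, hcl, hcm⟩ := hG.exists_spanning_cycleList hcol hdeg hno hL huv hu hv
    by_cases hall : ∀ x, x ∈ c
    · have h1 := hno c hc
      have h2 : Fintype.card V ≤ c.length := by
        rw [← Finset.card_univ]
        refine (Finset.card_le_card (t := c.toFinset) ?_).trans (List.toFinset_card_le _)
        intro x _
        simpa using hall x
      omega
    · push Not at hall
      obtain ⟨w, hw⟩ := hall
      obtain ⟨x, hx, y, hy, hxy⟩ := hG.exists_adj_notMem (by omega) (S := {x | x ∈ c})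
        ⟨u, (hcm u).2 hL.left_mem⟩ hw
      obtain ⟨c', z, hc', -, hperm⟩ := hc.rotate (w := x) hx
      have := hmax _ _ _ (hc'.reverse.append (PathList.single y) hxy (by
        rintro t ht hty
        rw [List.mem_singleton] at hty
        subst hty
        rw [List.mem_reverse, hperm.mem_iff] at ht
        exact hy ht))
      rw [List.length_append, List.length_reverse, hperm.length_eq, hcl] at this
      simp at this
  obtain ⟨p, hp, hp0, hpN, hmem⟩ := hL.exists_pathFn
  have hpos := hL.length_pos
  obtain ⟨l, hl⟩ : ∃ l, L.length = 2 * l + 1 := by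
    have := (hp.col_eq_iff hcol (L.length - 1) (by omega)).1 (by rw [hp0, hpN, huv])
    exact ⟨L.length / 2, by omega⟩
  rw [hl] at hp hpN hmax
  rw [Nat.add_sub_cancel] at hpN
  simp only [hl] at hmem
  subst hp0 hpN
  set O : Finset V := Finset.univ \ L.toFinset with hOdef
  have hOm : ∀ x, x ∈ O ↔ x ∉ L := by simp [hOdef]
  have hO : (O.filter fun v => ¬ col v = !col (p 0)).card + 1 ≤
      (O.filter fun v => col v = !col (p 0)).card := by
    have h1 := card_filter_sdiff_add (Finset.subset_univ L.toFinset)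
      fun v => ¬ col v = !col (p 0)
    have h2 := card_filter_sdiff_add (Finset.subset_univ L.toFinset) fun v => col v = !col (p 0)
    rw [hcompl] at h1
    rw [hn] at h2
    have h3 := Finset.card_filter_add_card_filter_not (s := L.toFinset)
      (fun v => col v = !col (p 0))
    rw [List.toFinset_card_of_nodup hL.1, hl] at h3
    have h4 := hL.two_mul_card_le_of_right hcol (c := !col (p 0)) (by rw [← huv]; simp)
      (T := L.toFinset.filter fun v => col v = !col (p 0)) (by
        intro x hx
        simpa using hx)
    rw [← hOdef] at h1 h2
    omega
  obtain ⟨J, hJcl, ⟨r₀, hr₀⟩, hJ⟩ := exists_closedIn_leaf_paths hcol (!col (p 0)) hO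
  have hJL : ∀ x ∈ J, x ∉ L := fun x hx => (hOm x).1 (hJcl.1 hx)
  obtain ⟨x, hx, y, hy, hxy⟩ := hG.exists_adj_notMem (by omega) (S := {x | x ∈ J}) ⟨r₀, hr₀⟩
    (w := p 0) (fun h => hJL _ h hL.left_mem)
  have hyL : y ∈ L := by
    by_contra hyL
    exact hy (hJcl.2 x hx y ((hOm y).2 hyL) hxy)
  obtain ⟨q, hq, rfl⟩ := (hmem y).1 hyL
  obtain ⟨a, ha, hamax⟩ := Finset.exists_max_image
    ((Finset.range (2 * l + 1)).filter fun q => ∃ r ∈ J, G.Adj (p q) r) id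
    ⟨q, by
      rw [Finset.mem_filter, Finset.mem_range]
      exact ⟨hq, x, hx, hxy.symm⟩⟩
  simp only [Finset.mem_filter, Finset.mem_range, id, and_imp] at ha hamax
  obtain ⟨haN, r, hr, har⟩ := ha
  obtain ⟨b, R, hR, hRJ, hbcol, hbR⟩ := hJ r hr
  have hbJ := hRJ b hR.right_mem
  refine hG.false_of_longest_odd hcol hdeg hno hp hmax (fun x hx => (hmem x).1 (hu x hx))
    (fun x hx => (hmem x).1 (hv x hx)) (a := a) ?_ hR har ?_ ?_ ?_
  · by_contra hcon
    have : a = 2 * l := by omega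
    subst this
    exact hJL r hr (hv r har)
  · intro q hq hqR
    exact hJL _ (hRJ _ hqR) ((hmem _).2 ⟨q, hq, rfl⟩)
  · rw [hbcol]
    simp
  · intro x hx
    by_cases hxL : x ∈ L
    · obtain ⟨q, hq, rfl⟩ := (hmem x).1 hxL
      exact Or.inr ⟨q, hamax q hq ⟨b, hbJ, hx.symm⟩, rfl⟩
    · exact Or.inl (hbR x (hJcl.2 b hbJ x ((hOm x).2 hxL) hx) hx)

end DegreeSum

theorem exists_long_cycleList_of_degree [Fintype V] [Nonempty V] [DecidableRel G.Adj]
    {col : V → Bool} (hcol : ∀ u v, G.Adj u v → col u ≠ col v) {k : ℕ}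
    (hdeg : ∀ v, k + 1 ≤ G.degree v) : ∃ c, CycleList G c ∧ 2 * k + 2 ≤ c.length := by
  classical
  obtain ⟨u, v, L, hL, hmax⟩ := exists_longest_pathList G
  obtain ⟨p, hp, rfl, -, hmem⟩ := hL.exists_pathFn
  have hu : ∀ x, G.Adj (p 0) x → x ∈ L := by
    intro x hx
    by_contra hxL
    have := hmax _ _ _ ((PathList.single x).append hL hx.symm (by simpa using hxL))
    simp at this
  set I := (Finset.range L.length).filter fun q => G.Adj (p 0) (p q) with hI
  have hne : I.Nonempty := by
    have h0 := hdeg (p 0)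
    rw [← SimpleGraph.card_neighborFinset_eq_degree] at h0
    obtain ⟨x, hx⟩ := Finset.card_pos.1 (show 0 < (G.neighborFinset (p 0)).card by omega)
    rw [SimpleGraph.mem_neighborFinset] at hx
    obtain ⟨q, hq, rfl⟩ := (hmem x).1 (hu x hx)
    exact ⟨q, by simp [hI, hq, hx]⟩
  obtain ⟨s, hs, hsmax⟩ := I.exists_max_image id hne
  simp only [hI, Finset.mem_filter, Finset.mem_range, id, and_imp] at hs hsmax
  have hseg := hp.pathList_seg (Nat.zero_le s) hs.1
  refine ⟨_, ⟨p 0, p s, hseg, hs.2.symm⟩, ?_⟩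
  have h1 := hseg.reverse.two_mul_card_le_of_right hcol (c := !col (p 0)) (by simp)
    (T := G.neighborFinset (p 0)) (by
      intro x hx
      rw [SimpleGraph.mem_neighborFinset] at hx
      refine ⟨?_, ?_⟩
      · obtain ⟨q, hq, rfl⟩ := (hmem x).1 (hu x hx)
        rw [List.mem_reverse, mem_seg]
        exact ⟨q, by omega, hsmax q hq hx, rfl⟩
      · have := hcol _ _ hx
        revert this
        cases col (p 0) <;> cases col x <;> simp)
  have h2 := hdeg (p 0)
  rw [SimpleGraph.card_neighborFinset_eq_degree, List.length_reverse] at h1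
  omega

/-- `X` and `Y` are disjoint independent sets. -/
structure IndepPair (G : SimpleGraph V) (X Y : Finset V) : Prop where
  disj : Disjoint X Y
  left : ∀ u ∈ X, ∀ v ∈ X, ¬ G.Adj u v
  right : ∀ u ∈ Y, ∀ v ∈ Y, ¬ G.Adj u v

theorem IndepPair.symm {X Y : Finset V} (h : IndepPair G X Y) : IndepPair G Y X :=
  ⟨h.disj.symm, h.right, h.left⟩

theorem IndepPair.mono {X Y X' Y' : Finset V} (h : IndepPair G X Y) (hX : X' ⊆ X) (hY : Y' ⊆ Y) :
    IndepPair G X' Y' :=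
  ⟨Finset.disjoint_of_subset_left hX (Finset.disjoint_of_subset_right hY h.disj),
    fun u hu v hv => h.left u (hX hu) v (hX hv), fun u hu v hv => h.right u (hY hu) v (hY hv)⟩

/-- Every cycle with vertices in `X ∪ Y` has length less than `2 k + 2`. -/
def NoLongCycle (G : SimpleGraph V) (X Y : Finset V) (k : ℕ) : Prop :=
  ∀ c, CycleList G c → (∀ x ∈ c, x ∈ X ∨ x ∈ Y) → c.length < 2 * k + 2

theorem NoLongCycle.symm {X Y : Finset V} {k : ℕ} (h : NoLongCycle G X Y k) :
    NoLongCycle G Y X k :=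
  fun c hc hm => h c hc fun x hx => (hm x hx).symm

theorem NoLongCycle.mono {X Y X' Y' : Finset V} {k : ℕ} (h : NoLongCycle G X Y k) (hX : X' ⊆ X)
    (hY : Y' ⊆ Y) : NoLongCycle G X' Y' k :=
  fun c hc hm => h c hc fun x hx => (hm x hx).imp (fun h => hX h) (fun h => hY h)

section Count

variable [DecidableRel G.Adj]

variable (G) in
/-- The number of neighbours of `x` in `Y`. -/
def nbCount (x : V) (Y : Finset V) : ℕ := (Y.filter (G.Adj x)).card

variable (G) in
/-- The number of edges between two disjoint sets. -/
def edgesBetween (X Y : Finset V) : ℕ := ∑ x ∈ X, nbCount G x Y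

theorem edgesBetween_comm (X Y : Finset V) : edgesBetween G X Y = edgesBetween G Y X := by
  simp only [edgesBetween, nbCount, Finset.card_filter]
  rw [Finset.sum_comm]
  simp only [G.adj_comm]

theorem nbCount_le (x : V) (Y : Finset V) : nbCount G x Y ≤ Y.card :=
  Finset.card_filter_le _ _

theorem edgesBetween_le (X Y : Finset V) : edgesBetween G X Y ≤ X.card * Y.card := by
  rw [edgesBetween, ← smul_eq_mul]
  exact Finset.sum_le_card_nsmul _ _ _ fun x _ => nbCount_le x Y

variable [DecidableEq V]

theorem edgesBetween_erase {X : Finset V} (Y : Finset V) {x : V} (hx : x ∈ X) :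
    edgesBetween G X Y = edgesBetween G (X.erase x) Y + nbCount G x Y := by
  rw [edgesBetween, edgesBetween, Finset.sum_erase_add _ _ hx]

theorem edgesBetween_erase_right (X : Finset V) {Y : Finset V} {y : V} (hy : y ∈ Y) :
    edgesBetween G X Y = edgesBetween G X (Y.erase y) + nbCount G y X := by
  rw [edgesBetween_comm, edgesBetween_erase X hy, edgesBetween_comm]

theorem edgesBetween_sdiff (X Y R : Finset V) :
    edgesBetween G X Y = edgesBetween G (X \ R) Y + edgesBetween G (X ∩ R) Y := by
  simp only [edgesBetween]
  rw [← Finset.sum_union (Finset.disjoint_sdiff_inter X R), Finset.sdiff_union_inter]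

/-- Removing a set `R` that is separated from the rest of `X ∪ Y` by one vertex of `Y`. -/
theorem edgesBetween_le_of_separated {X Y R : Finset V} {v : V} (hvX : v ∉ X)
    (hXR : ∀ x ∈ X ∩ R, ∀ y ∈ Y, G.Adj x y → y ∈ R ∨ y = v)
    (hYR : ∀ y ∈ Y ∩ R, ∀ x ∈ X, G.Adj y x → x ∈ R ∨ x = v) :
    edgesBetween G X Y ≤ edgesBetween G (X \ R) (Y \ R) +
      ((X ∩ R).card * (Y ∩ R).card + (X ∩ R).card) := by
  rw [edgesBetween_sdiff X Y R, edgesBetween_comm (X \ R) Y, edgesBetween_sdiff Y _ R,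
    edgesBetween_comm (Y \ R)]
  have h1 : edgesBetween G (Y ∩ R) (X \ R) = 0 := by
    refine Finset.sum_eq_zero fun y hy => ?_
    rw [nbCount, Finset.card_eq_zero, Finset.filter_eq_empty_iff]
    intro x hx hyx
    rw [Finset.mem_sdiff] at hx
    rcases hYR y hy x hx.1 hyx with h | rfl
    · exact hx.2 h
    · exact hvX hx.1
  have h2 : edgesBetween G (X ∩ R) Y ≤ (X ∩ R).card * ((Y ∩ R).card + 1) := by
    rw [edgesBetween, ← smul_eq_mul]
    refine Finset.sum_le_card_nsmul _ _ _ fun x hx => ?_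
    refine (Finset.card_le_card (t := insert v (Y ∩ R)) ?_).trans (Finset.card_insert_le _ _)
    intro y hy
    rw [Finset.mem_filter] at hy
    rw [Finset.mem_insert, Finset.mem_inter]
    rcases hXR x hx y hy.1 hy.2 with h | h
    · exact Or.inr ⟨hy.1, h⟩
    · exact Or.inl h
  rw [mul_add, mul_one] at h2
  omega

end Count

/-- A set of vertices that can be left only through `v` contains all or nothing of a path
avoiding `v`. -/
theorem forall_mem_or_forall_notMem {v : V} {S T : Set V}
    (hS : ∀ x ∈ S, ∀ y ∈ T, y ∉ S → y ≠ v → ¬ G.Adj x y) :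
    ∀ l : List V, l.IsChain G.Adj → v ∉ l → (∀ x ∈ l, x ∈ T) → (∀ x ∈ l, x ∈ S) ∨ ∀ x ∈ l, x ∉ S := by
  intro l
  induction l with
  | nil => simp
  | cons a t ih =>
    intro hch hv hT
    rw [List.mem_cons, not_or] at hv
    rcases t with _ | ⟨b, t⟩
    · simpa using em (a ∈ S)
    · have hab := (List.isChain_cons_cons.1 hch).1
      have hvb : b ≠ v := fun h => hv.2 (h ▸ List.mem_cons_self)
      rcases ih hch.tail hv.2 (fun x hx => hT x (List.mem_cons_of_mem _ hx)) with h | h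
      · left
        intro x hx
        rcases List.mem_cons.1 hx with rfl | hx
        · by_contra hxS
          exact hS b (h b List.mem_cons_self) x (hT x List.mem_cons_self) hxS (Ne.symm hv.1)
            hab.symm
        · exact h x hx
      · right
        intro x hx
        rcases List.mem_cons.1 hx with rfl | hx
        · intro hxS
          exact hS x hxS b (hT b (by simp)) (h b List.mem_cons_self) hvb hab
        · exact h x hx

theorem CycleList.forall_mem_or_forall_notMem {v : V} {S T : Set V} (hvS : v ∉ S)
    (hS : ∀ x ∈ S, ∀ y ∈ T, y ∉ S → y ≠ v → ¬ G.Adj x y) {c : List V} (hc : CycleList G c)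
    (hT : ∀ x ∈ c, x ∈ T) : (∀ x ∈ c, x = v ∨ x ∈ S) ∨ ∀ x ∈ c, x ∉ S := by
  by_cases hv : v ∈ c
  · obtain ⟨c', z, hc', -, hperm⟩ := hc.rotate hv
    obtain ⟨t, rfl⟩ := hc'.exists_cons
    simp only [← hperm.mem_iff] at hT ⊢
    rcases BipartiteCycle.forall_mem_or_forall_notMem hS t hc'.2.1.tail (List.nodup_cons.1 hc'.1).1
      (fun x hx => hT x (List.mem_cons_of_mem _ hx)) with h | h
    · exact Or.inl fun x hx => (List.mem_cons.1 hx).imp id (h x)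
    · refine Or.inr fun x hx => ?_
      rcases List.mem_cons.1 hx with rfl | hx
      · exact hvS
      · exact h x hx
  · have hch : c.IsChain G.Adj := by
      obtain ⟨u, w, h, -⟩ := hc
      exact h.2.1
    exact (BipartiteCycle.forall_mem_or_forall_notMem hS c hch hv hT).imp
      (fun h x hx => Or.inr (h x hx)) id

section Induced

variable [DecidableEq V]

/-- The subgraph induced on `X ∪ Y`. -/
abbrev inducedPair (G : SimpleGraph V) (X Y : Finset V) : SimpleGraph {x // x ∈ X ∪ Y} :=
  G.comap Subtype.val

/-- The side of the bipartition a vertex belongs to. -/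
def side (X Y : Finset V) (v : {x // x ∈ X ∪ Y}) : Bool := decide (v.1 ∈ X)

theorem IndepPair.side_ne {X Y : Finset V} (h : IndepPair G X Y) (u v : {x // x ∈ X ∪ Y})
    (huv : (inducedPair G X Y).Adj u v) : side X Y u ≠ side X Y v := by
  obtain ⟨u, hu⟩ := u
  obtain ⟨v, hv⟩ := v
  rw [SimpleGraph.comap_adj] at huv
  simp only [side, ne_eq, decide_eq_decide]
  rw [Finset.mem_union] at hu hv
  intro hiff
  by_cases huX : u ∈ X
  · exact h.left u huX v (hiff.1 huX) huv
  · exact h.right u (hu.resolve_left huX) v (hv.resolve_left fun hvX => huX (hiff.2 hvX)) huv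

theorem CycleList.map_val {X Y : Finset V} {c : List {x // x ∈ X ∪ Y}}
    (h : CycleList (inducedPair G X Y) c) : CycleList G (c.map Subtype.val) := by
  obtain ⟨u, v, ⟨h1, h2, h3, h4⟩, hadj⟩ := h
  refine ⟨u, v, ⟨h1.map Subtype.val_injective, ?_, by rw [List.head?_map, h3]; rfl,
    by rw [List.getLast?_map, h4]; rfl⟩, hadj⟩
  rw [List.isChain_map]
  exact h2

theorem NoLongCycle.induced {X Y : Finset V} {k : ℕ} (h : NoLongCycle G X Y k) :
    ¬ ∃ c, CycleList (inducedPair G X Y) c ∧ 2 * k + 2 ≤ c.length := by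
  rintro ⟨c, hc, hcl⟩
  have := h _ hc.map_val (by
    intro x hx
    rw [List.mem_map] at hx
    obtain ⟨y, -, rfl⟩ := hx
    exact Finset.mem_union.1 y.2)
  rw [List.length_map] at this
  omega

theorem nbCount_le_degree [DecidableRel G.Adj] {X Y Z : Finset V} (hZ : Z ⊆ X ∪ Y)
    [DecidableRel (inducedPair G X Y).Adj] (v : {x // x ∈ X ∪ Y}) :
    nbCount G v Z ≤ (inducedPair G X Y).degree v := by
  rw [← SimpleGraph.card_neighborFinset_eq_degree,
    ← Finset.card_image_of_injective _ Subtype.val_injective]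
  refine Finset.card_le_card fun y hy => ?_
  rw [Finset.mem_filter] at hy
  rw [Finset.mem_image]
  refine ⟨⟨y, hZ hy.1⟩, ?_, rfl⟩
  rw [SimpleGraph.mem_neighborFinset]
  exact hy.2

theorem NoLongCycle.exists_nbCount_le [DecidableRel G.Adj] {X Y : Finset V} {k : ℕ}
    (hI : IndepPair G X Y) (h : NoLongCycle G X Y k) (hX : X.Nonempty) :
    (∃ x ∈ X, nbCount G x Y ≤ k) ∨ ∃ y ∈ Y, nbCount G y X ≤ k := by
  classical
  by_contra! hcon
  obtain ⟨x, hx⟩ := hX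
  have : Nonempty {x // x ∈ X ∪ Y} := ⟨⟨x, Finset.mem_union_left _ hx⟩⟩
  refine h.induced (exists_long_cycleList_of_degree hI.side_ne ?_)
  rintro ⟨v, hv⟩
  rcases Finset.mem_union.1 hv with hv' | hv'
  · exact (Nat.succ_le_of_lt (hcon.1 v hv')).trans
      (nbCount_le_degree Finset.subset_union_right ⟨v, hv⟩)
  · exact (Nat.succ_le_of_lt (hcon.2 v hv')).trans
      (nbCount_le_degree Finset.subset_union_left ⟨v, hv⟩)

theorem card_filter_side {X Y : Finset V} (h : Disjoint X Y) (c : Bool) :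
    (Finset.univ.filter fun v => side X Y v = c).card = bif c then X.card else Y.card := by
  rw [← Finset.card_image_of_injective _ Subtype.val_injective]
  have key : ∀ Z : Finset V, (∀ v, v ∈ Z ↔ ∃ hv : v ∈ X ∪ Y, side X Y ⟨v, hv⟩ = c) →
      ((Finset.univ.filter fun v => side X Y v = c).image Subtype.val) = Z := by
    intro Z hZ
    ext v
    rw [hZ, Finset.mem_image]
    constructor
    · rintro ⟨⟨w, hw⟩, h1, rfl⟩
      exact ⟨hw, (Finset.mem_filter.1 h1).2⟩
    · rintro ⟨hv, h1⟩
      exact ⟨⟨v, hv⟩, Finset.mem_filter.2 ⟨Finset.mem_univ _, h1⟩, rfl⟩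
  have hd := Finset.disjoint_left.1 h
  cases c
  · rw [key Y]
    · rfl
    · intro v
      simp only [side, decide_eq_false_iff_not, Finset.mem_union, exists_prop]
      have := @hd v
      tauto
  · rw [key X]
    · rfl
    · intro v
      simp only [side, decide_eq_true_eq, Finset.mem_union, exists_prop]
      tauto

theorem exists_separated_of_not_twoConnected {X Y : Finset V}
    (h : ¬ TwoConnected (inducedPair G X Y)) {c : List V} (hc : CycleList G c)
    (hcm : ∀ x ∈ c, x ∈ X ∨ x ∈ Y) :
    ∃ v ∈ X ∪ Y, ∃ R ⊆ X ∪ Y, R.Nonempty ∧ (∀ x ∈ R, ∀ y ∈ X ∪ Y, G.Adj x y → y ∈ R ∨ y = v) ∧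
      ∀ x ∈ c, x ∉ R := by
  classical
  simp only [TwoConnected] at h
  push Not at h
  obtain ⟨⟨v, hv⟩, S, hSne, hvS, ⟨w, hwS, hwv⟩, hcl⟩ := h
  set S' : Set V := Subtype.val '' S with hS'
  have hmem : ∀ (y : V) (hy : y ∈ X ∪ Y), y ∉ S' → (⟨y, hy⟩ : {x // x ∈ X ∪ Y}) ∉ S :=
    fun y hy hyS hyS' => hyS ⟨_, hyS', rfl⟩
  have hS'cl : ∀ x ∈ S', ∀ y ∈ ((X ∪ Y : Finset V) : Set V), y ∉ S' → y ≠ v → ¬ G.Adj x y := by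
    rintro _ ⟨x, hx, rfl⟩ y hy hyS hyv hxy
    exact hcl x hx ⟨y, hy⟩ (hmem y hy hyS) (fun h => hyv (congrArg Subtype.val h)) hxy
  have hvS' : v ∉ S' := by
    rintro ⟨x, hx, rfl⟩
    exact hvS hx
  refine ⟨v, hv, ?_⟩
  rcases hc.forall_mem_or_forall_notMem hvS' hS'cl
    (fun x hx => by simpa using hcm x hx) with h | h
  · refine ⟨(X ∪ Y).filter fun x => x ∉ S' ∧ x ≠ v, Finset.filter_subset _ _, ⟨w, ?_⟩, ?_, ?_⟩
    · rw [Finset.mem_filter]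
      refine ⟨w.2, ?_, fun h => hwv (Subtype.ext h)⟩
      rintro ⟨x, hx, hxw⟩
      exact hwS (Subtype.ext hxw ▸ hx)
    · intro x hx y hy hxy
      rw [Finset.mem_filter] at hx
      by_contra! hcon
      rw [Finset.mem_filter, not_and, not_and, not_not] at hcon
      refine hcon.2 (hcon.1 hy ?_)
      intro hyS
      exact hS'cl y hyS x hx.1 hx.2.1 hx.2.2 hxy.symm
    · intro x hx hxf
      rw [Finset.mem_filter] at hxf
      rcases h x hx with h | h
      · exact hxf.2.2 h
      · exact hxf.2.1 h
  · refine ⟨(X ∪ Y).filter fun x => x ∈ S', Finset.filter_subset _ _, ?_, ?_, ?_⟩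
    · obtain ⟨s, hs⟩ := hSne
      exact ⟨s, Finset.mem_filter.2 ⟨s.2, s, hs, rfl⟩⟩
    · intro x hx y hy hxy
      rw [Finset.mem_filter] at hx
      by_contra! hcon
      rw [Finset.mem_filter, not_and] at hcon
      exact hS'cl x hx.2 y hy (hcon.1 hy) hcon.2 hxy
    · intro x hx hxf
      exact h x hx (Finset.mem_filter.1 hxf).2

end Induced

theorem IndepPair.le_card_sdiff [DecidableEq V] {X Y R : Finset V} (hI : IndepPair G X Y)
    {c : List V} (hc : CycleList G c) (hcm : ∀ x ∈ c, x ∈ X ∨ x ∈ Y) (hcR : ∀ x ∈ c, x ∉ R) {k : ℕ}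
    (hk : 2 * k ≤ c.length) : k ≤ (X \ R).card := by
  obtain ⟨u, v, hp, -⟩ := hc
  have h1 := two_mul_countP_le (col := fun v => decide (v ∈ X)) false c
    (hp.2.1.imp_of_mem_imp fun x y hx hy hxy hxy' => by
      have hiff := decide_eq_decide.1 hxy'
      by_cases hxX : x ∈ X
      · exact hI.left x hxX y (hiff.1 hxX) hxy
      · exact hI.right x ((hcm x hx).resolve_left hxX) y
          ((hcm y hy).resolve_left fun hyX => hxX (hiff.2 hyX)) hxy)
  have h2 := List.length_eq_countP_add_countP (fun v => decide (v ∈ X)) (l := c)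
  have h3 : c.countP (fun v => decide (v ∈ X)) ≤ (X \ R).card := by
    rw [List.countP_eq_length_filter, ← List.toFinset_card_of_nodup (hp.1.filter _)]
    refine Finset.card_le_card fun x hx => ?_
    simp only [List.mem_toFinset, List.mem_filter, decide_eq_true_eq] at hx
    exact Finset.mem_sdiff.2 ⟨hx.2, hcR x hx.1⟩
  simp only [decide_eq_false_iff_not, decide_eq_true_eq] at h1 h2
  split_ifs at h1 <;> omega

section Extremal

variable [DecidableRel G.Adj]

variable (G) in
/-- The extremal number of edges between `X` and `Y` when all cycles are shorter than
`2 k + 2`. -/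
def EdgeBound (X Y : Finset V) (k : ℕ) : Prop :=
  (Y.card ≤ 2 * k → edgesBetween G X Y + k ≤ Y.card + X.card * k) ∧
    (2 * k ≤ Y.card → edgesBetween G X Y + 2 * k * k ≤ (X.card + Y.card + 1) * k)

variable (G) in
/-- The extremal bound holds whenever the total size of the parameters is less than `N`. -/
def EdgeBoundBelow (N : ℕ) : Prop :=
  ∀ (X Y : Finset V) (k : ℕ), X.card + Y.card + k < N → IndepPair G X Y → NoLongCycle G X Y k →
    1 ≤ k → k ≤ Y.card → Y.card ≤ X.card → EdgeBound G X Y k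

theorem EdgeBound.of_le {X Y : Finset V} {k : ℕ} (hY : Y.card ≤ 2 * k)
    (h : edgesBetween G X Y + k ≤ Y.card + X.card * k) : EdgeBound G X Y k := by
  refine ⟨fun _ => h, fun h2 => ?_⟩
  have : Y.card = 2 * k := le_antisymm hY h2
  rw [this] at h ⊢
  nlinarith

theorem edgesBetween_eq_zero {X Y : Finset V} (hN : NoLongCycle G X Y 0) :
    edgesBetween G X Y = 0 := by
  refine Finset.sum_eq_zero fun x hx => ?_
  rw [nbCount, Finset.card_eq_zero, Finset.filter_eq_empty_iff]
  intro y hy hxy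
  have := hN [x, y] ⟨x, y, ⟨by simp [hxy.ne], by simp [hxy], rfl, rfl⟩, hxy.symm⟩ (by simp [hx, hy])
  simp at this

/-- The balanced case when the cycle bound holds with a smaller parameter. -/
theorem edgesBetween_add_le_of_noLongCycle {X Y : Finset V} {n k : ℕ}
    (hB : EdgeBoundBelow G (n + n + (k + 1))) (hI : IndepPair G X Y) (hN : NoLongCycle G X Y k)
    (hX : X.card = n) (hY : Y.card = n) (hkn : k < n) (hnk : n ≤ 2 * (k + 1)) :
    edgesBetween G X Y + (k + 1) ≤ n + n * (k + 1) := by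
  rcases Nat.eq_zero_or_pos k with rfl | hk
  · rw [edgesBetween_eq_zero hN]
    omega
  · obtain ⟨h1, h2⟩ := hB X Y k (by omega) hI hN hk (by omega) (by omega)
    rw [hX, hY] at h1 h2
    rcases le_total n (2 * k) with h | h
    · have := h1 h
      rw [mul_add]
      omega
    · have := h2 h
      obtain rfl | rfl | rfl : n = 2 * k ∨ n = 2 * k + 1 ∨ n = 2 * k + 2 := by omega
      all_goals nlinarith

variable [DecidableEq V]

/-- The bound passes to sets separated from a long cycle by a vertex of `Y`. -/
theorem edgesBetween_add_le_of_separated {X Y R : Finset V} {v : V} {n k : ℕ}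
    (hB : EdgeBoundBelow G (n + n + k)) (hI : IndepPair G X Y) (hN : NoLongCycle G X Y k)
    (hX : X.card = n) (hY : Y.card = n) (hk : 1 ≤ k) (hnk : n ≤ 2 * k) (hv : v ∈ Y)
    (hR : R ⊆ X ∪ Y) (hRne : R.Nonempty)
    (hsep : ∀ x ∈ R, ∀ y ∈ X ∪ Y, G.Adj x y → y ∈ R ∨ y = v)
    (hXR : k ≤ (X \ R).card) (hYR : k ≤ (Y \ R).card) :
    edgesBetween G X Y + k ≤ n + n * k := by
  have h1 := edgesBetween_le_of_separated (G := G) (X := X) (Y := Y) (R := R) (v := v)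
    (fun h => Finset.disjoint_left.1 hI.disj h hv)
    (fun x hx y hy => hsep x (Finset.mem_inter.1 hx).2 y (Finset.mem_union_right _ hy))
    (fun y hy x hx => hsep y (Finset.mem_inter.1 hy).2 x (Finset.mem_union_left _ hx))
  have hx := Finset.card_sdiff_add_card_inter X R
  have hy := Finset.card_sdiff_add_card_inter Y R
  have hpos : 0 < (X ∩ R).card + (Y ∩ R).card := by
    obtain ⟨r, hr⟩ := hRne
    rcases Finset.mem_union.1 (hR hr) with h | h
    · have := Finset.card_pos.2 ⟨r, Finset.mem_inter.2 ⟨h, hr⟩⟩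
      omega
    · have := Finset.card_pos.2 ⟨r, Finset.mem_inter.2 ⟨h, hr⟩⟩
      omega
  have hI' := hI.mono (Finset.sdiff_subset (s := X) (t := R)) (Finset.sdiff_subset (s := Y) (t := R))
  have hN' := hN.mono (Finset.sdiff_subset (s := X) (t := R)) (Finset.sdiff_subset (s := Y) (t := R))
  rcases le_total (X ∩ R).card (Y ∩ R).card with h | h
  · have h2 := (hB _ _ k (by omega) hI' hN' hk hYR (by omega)).1 (by omega)
    have h3 : (X ∩ R).card * (Y ∩ R).card ≤ (X ∩ R).card * k := Nat.mul_le_mul_left _ (by omega)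
    have h4 : n * k = (X \ R).card * k + (X ∩ R).card * k := by rw [← add_mul, hx, hX]
    omega
  · have h2 := (hB _ _ k (by omega) hI'.symm hN'.symm hk hXR (by omega)).1 (by omega)
    rw [edgesBetween_comm] at h2
    have h3 : (X ∩ R).card * (Y ∩ R).card ≤ k * (Y ∩ R).card := Nat.mul_le_mul_right _ (by omega)
    have h4 : n * k = (Y \ R).card * k + k * (Y ∩ R).card := by
      rw [mul_comm k, ← add_mul, hy, hY]
    omega

theorem edgesBetween_add_le_of_balanced {X Y : Finset V} {n k : ℕ}
    (hB : EdgeBoundBelow G (n + n + k)) (hI : IndepPair G X Y) (hN : NoLongCycle G X Y k)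
    (hX : X.card = n) (hY : Y.card = n) (hk : 1 ≤ k) (hkn : k < n) (hnk : n ≤ 2 * k) :
    edgesBetween G X Y + k ≤ n + n * k := by
  by_cases hN1 : NoLongCycle G X Y (k - 1)
  · obtain ⟨j, rfl⟩ := Nat.exists_eq_add_of_le' hk
    exact edgesBetween_add_le_of_noLongCycle hB hI hN1 hX hY (by omega) hnk
  simp only [NoLongCycle, not_forall, not_lt] at hN1
  obtain ⟨c, hc, hcm, hcl⟩ := hN1
  by_cases hdeg : ∃ x ∈ X, ∃ y ∈ Y, nbCount G x Y + nbCount G y X ≤ k + 1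
  · obtain ⟨x, hx, y, hy, hxy⟩ := hdeg
    have hx' := Finset.card_erase_of_mem hx
    have hy' := Finset.card_erase_of_mem hy
    have h1 := (hB (X.erase x) (Y.erase y) k (by omega)
      (hI.mono (Finset.erase_subset _ _) (Finset.erase_subset _ _))
      (hN.mono (Finset.erase_subset _ _) (Finset.erase_subset _ _)) hk (by omega) (by omega)).1
      (by omega)
    have h2 := edgesBetween_erase (G := G) Y hx
    have h3 := edgesBetween_erase_right (G := G) (X.erase x) hy
    have h4 : nbCount G y (X.erase x) ≤ nbCount G y X :=
      Finset.card_le_card (Finset.filter_subset_filter _ (Finset.erase_subset _ _))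
    have h5 : n * k = (X.erase x).card * k + k := by
      rw [← Nat.succ_mul]
      congr 1
      omega
    omega
  push Not at hdeg
  by_cases h2c : TwoConnected (inducedPair G X Y)
  · refine absurd (h2c.exists_long_cycleList hI.side_ne hk hkn ?_ ?_) hN.induced
    · intro c
      rw [card_filter_side hI.disj]
      cases c <;> simp [hX, hY]
    · have key : ∀ u v : {x // x ∈ X ∪ Y}, u.1 ∈ X → v.1 ∈ Y →
          k + 2 ≤ (inducedPair G X Y).degree u + (inducedPair G X Y).degree v := by
        intro u v hu hv
        have h1 := nbCount_le_degree (G := G) (Finset.subset_union_right (s₁ := X) (s₂ := Y)) u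
        have h2 := nbCount_le_degree (G := G) (Finset.subset_union_left (s₁ := X) (s₂ := Y)) v
        have h3 := hdeg u hu v hv
        omega
      intro u v huv
      have hu := Finset.mem_union.1 u.2
      have hv := Finset.mem_union.1 v.2
      simp only [side, ne_eq, decide_eq_decide] at huv
      by_cases huX : u.1 ∈ X
      · exact key u v huX (hv.resolve_left fun h => huv (iff_of_true huX h))
      · rw [add_comm (SimpleGraph.degree _ u)]
        exact key v u (by_contra fun h => huv (iff_of_false huX h)) (hu.resolve_left huX)
  · obtain ⟨v, hv, R, hR, hRne, hsep, hcR⟩ := exists_separated_of_not_twoConnected h2c hc hcm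
    have hXR := hI.le_card_sdiff hc hcm hcR (k := k) (by omega)
    have hYR := hI.symm.le_card_sdiff hc (fun x hx => (hcm x hx).symm) hcR (k := k) (by omega)
    rcases Finset.mem_union.1 hv with hv | hv
    · rw [edgesBetween_comm]
      rw [Finset.union_comm] at hR hsep
      exact edgesBetween_add_le_of_separated hB hI.symm hN.symm hY hX hk hnk hv hR hRne hsep hYR hXR
    · exact edgesBetween_add_le_of_separated hB hI hN hX hY hk hnk hv hR hRne hsep hXR hYR

/-- The unbalanced case with a small second side. -/
theorem edgesBetween_add_le_of_lt {X Y : Finset V} {k : ℕ}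
    (hB : EdgeBoundBelow G (X.card + Y.card + k)) (hI : IndepPair G X Y)
    (hN : NoLongCycle G X Y k) (hk : 1 ≤ k) (hkY : k ≤ Y.card) (hYk : Y.card ≤ 2 * k)
    (hYX : Y.card < X.card) : edgesBetween G X Y + k ≤ Y.card + X.card * k := by
  by_cases hdeg : ∃ x ∈ X, nbCount G x Y ≤ k
  · obtain ⟨x, hx, hxk⟩ := hdeg
    have hx' := Finset.card_erase_add_one hx
    have h1 := (hB (X.erase x) Y k (by omega) (hI.mono (Finset.erase_subset _ _) subset_rfl)
      (hN.mono (Finset.erase_subset _ _) subset_rfl) hk hkY (by omega)).1 hYk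
    have h2 := edgesBetween_erase (G := G) Y hx
    rw [← hx', add_mul]
    omega
  · push Not at hdeg
    obtain ⟨X', hX', hcard⟩ := Finset.exists_subset_card_eq hYX.le
    have h1 := (hB X' Y k (by omega) (hI.mono hX' subset_rfl) (hN.mono hX' subset_rfl) hk hkY
      (by omega)).1 hYk
    have h2 : X'.card • (k + 1) ≤ edgesBetween G X' Y :=
      Finset.card_nsmul_le_sum _ _ _ fun x hx => hdeg x (hX' hx)
    rw [smul_eq_mul, mul_add] at h2
    omega

/-- The case of a large second side. -/
theorem edgesBetween_add_le_of_two_mul_lt {X Y : Finset V} {k : ℕ}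
    (hB : EdgeBoundBelow G (X.card + Y.card + k)) (hI : IndepPair G X Y)
    (hN : NoLongCycle G X Y k) (hk : 1 ≤ k) (hkY : 2 * k < Y.card) (hYX : Y.card ≤ X.card) :
    edgesBetween G X Y + 2 * k * k ≤ (X.card + Y.card + 1) * k := by
  rcases hN.exists_nbCount_le hI (Finset.card_pos.1 (by omega)) with ⟨x, hx, hxk⟩ | ⟨y, hy, hyk⟩
  · have hx' := Finset.card_erase_add_one hx
    have h2 := edgesBetween_erase (G := G) Y hx
    have hI' := hI.mono (Finset.erase_subset x X) (subset_refl Y)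
    have hN' := hN.mono (Finset.erase_subset x X) (subset_refl Y)
    rcases lt_or_ge Y.card X.card with h | h
    · have h1 := (hB (X.erase x) Y k (by omega) hI' hN' hk (by omega) (by omega)).2 (by omega)
      nlinarith
    · have h1 := (hB Y (X.erase x) k (by omega) hI'.symm hN'.symm hk (by omega) (by omega)).2
        (by omega)
      rw [edgesBetween_comm] at h1
      nlinarith
  · have hy' := Finset.card_erase_add_one hy
    have h2 := edgesBetween_erase_right (G := G) X hy
    have h1 := (hB X (Y.erase y) k (by omega) (hI.mono subset_rfl (Finset.erase_subset y Y))
      (hN.mono subset_rfl (Finset.erase_subset y Y)) hk (by omega) (by omega)).2 (by omega)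
    nlinarith

theorem edgeBoundBelow (N : ℕ) : EdgeBoundBelow G N := by
  induction N with
  | zero => exact fun X Y k h => absurd h (Nat.not_lt_zero _)
  | succ N ih =>
    intro X Y k hlt hI hN hk hkY hYX
    rcases Nat.lt_succ_iff_lt_or_eq.1 hlt with h | rfl
    · exact ih X Y k h hI hN hk hkY hYX
    rcases lt_or_ge (2 * k) Y.card with h | hYk
    · exact ⟨fun h' => absurd h' (by omega),
        fun _ => edgesBetween_add_le_of_two_mul_lt ih hI hN hk h hYX⟩
    refine EdgeBound.of_le hYk ?_
    rcases hYX.lt_or_eq with h | h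
    · exact edgesBetween_add_le_of_lt ih hI hN hk hkY hYk h
    rcases hkY.lt_or_eq with hkY | hkY
    · rw [h]
      rw [h] at ih hkY hYk
      exact edgesBetween_add_le_of_balanced ih hI hN rfl h hk hkY hYk
    · have := edgesBetween_le (G := G) X Y
      rw [← hkY] at this ⊢
      omega

end Extremal

theorem CycleList.exists_isCycle {c : List V} (hc : CycleList G c) (h : 3 ≤ c.length) :
    ∃ (v : V) (w : G.Walk v v), w.IsCycle ∧ w.length = c.length := by
  classical
  obtain ⟨u, v, hp, hadj⟩ := hc
  have hw : ∃ w : G.Walk u v, w.support = c := by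
    refine ⟨(SimpleGraph.Walk.ofSupport c hp.ne_nil hp.2.1).copy ?_ ?_, ?_⟩
    · exact Option.some_injective _ ((List.head?_eq_some_head hp.ne_nil).symm.trans hp.2.2.1)
    · exact Option.some_injective _
        ((List.getLast?_eq_some_getLast hp.ne_nil).symm.trans hp.2.2.2)
    · rw [SimpleGraph.Walk.support_copy, SimpleGraph.Walk.support_ofSupport]
  obtain ⟨w, rfl⟩ := hw
  rw [SimpleGraph.Walk.length_support] at h ⊢
  have hpath : w.IsPath := SimpleGraph.Walk.IsPath.mk' hp.1
  refine ⟨v, w.cons hadj, ?_, rfl⟩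
  rw [SimpleGraph.Walk.cons_isCycle_iff]
  refine ⟨hpath, fun hmem => ?_⟩
  rw [Sym2.eq_swap] at hmem
  have := hpath.length_eq_one_of_mem_edges hmem
  omega

theorem edgeCount_eq_edgesBetween {V : Type*} [Fintype V] [DecidableEq V] {G : SimpleGraph V}
    [DecidableRel G.Adj] {A B : Finset V} (hI : IndepPair G A B) (hunion : A ∪ B = Finset.univ) :
    edgeCount G = edgesBetween G A B := by
  have hAB : ∀ v, v ∈ A ∨ v ∈ B := fun v => Finset.mem_union.1 (hunion ▸ Finset.mem_univ v)
  have h : G.IsBipartiteWith (A : Set V) (B : Set V) := by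
    refine ⟨Finset.disjoint_coe.2 hI.disj, fun v w hvw => ?_⟩
    rcases hAB v with hv | hv <;> rcases hAB w with hw | hw
    · exact absurd hvw (hI.left v hv w hw)
    · exact Or.inl ⟨hv, hw⟩
    · exact Or.inr ⟨hv, hw⟩
    · exact absurd hvw (hI.right v hv w hw)
  have h1 : edgeCount G = G.edgeFinset.card := by
    rw [edgeCount]
    congr!
  rw [h1, ← SimpleGraph.isBipartiteWith_sum_degrees_eq_card_edges h, edgesBetween]
  refine Finset.sum_congr rfl fun x hx => ?_
  rw [nbCount, ← SimpleGraph.card_neighborFinset_eq_degree]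
  congr 1
  ext y
  rw [SimpleGraph.mem_neighborFinset, Finset.mem_filter]
  exact ⟨fun hxy => ⟨(hAB y).resolve_left fun hy => hI.left x hx y hy hxy, hxy⟩, And.right⟩

end BipartiteCycle

theorem stmt9 (V : Type) [Fintype V] [DecidableEq V] (G : SimpleGraph V)
    (A B : Finset V) (a b m : ℕ)
    (hdisj : Disjoint A B) (hunion : A ∪ B = Finset.univ)
    (hA : ∀ u ∈ A, ∀ v ∈ A, ¬G.Adj u v) (hB : ∀ u ∈ B, ∀ v ∈ B, ¬G.Adj u v)
    (ha : A.card = a) (hb : B.card = b)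
    (hm2 : 2 ≤ m) (hmb : m ≤ b) (hba : b ≤ a)
    (hE : (b ≤ 2 * m - 2 ∧
            (b : ℤ) + ((a : ℤ) - 1) * ((m : ℤ) - 1) < (edgeCount G : ℤ)) ∨
          (2 * m - 2 ≤ b ∧
            ((b : ℤ) + (a : ℤ) - 2 * (m : ℤ) + 3) * ((m : ℤ) - 1) < (edgeCount G : ℤ))) :
    ∃ (v : V) (w : G.Walk v v), w.IsCycle ∧ 2 * m ≤ w.length := by
  classical
  have hI : BipartiteCycle.IndepPair G A B := ⟨hdisj, hA, hB⟩
  by_cases hN : BipartiteCycle.NoLongCycle G A B (m - 1)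
  · exfalso
    obtain ⟨k, rfl⟩ := Nat.exists_eq_add_of_le' (show 1 ≤ m by omega)
    obtain ⟨h1, h2⟩ := BipartiteCycle.edgeBoundBelow (G := G) _ A B k (Nat.lt_succ_self _) hI hN
      (by omega) (by omega) (by omega)
    rw [← BipartiteCycle.edgeCount_eq_edgesBetween hI hunion, ha, hb] at h1 h2
    rcases hE with ⟨hbm, hE⟩ | ⟨hbm, hE⟩
    · have h3 := h1 (by omega)
      zify at h3
      push_cast at hE
      linarith
    · have h3 := h2 (by omega)
      zify at h3
      push_cast at hE
      linarith
  · simp only [BipartiteCycle.NoLongCycle, not_forall, not_lt] at hN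
    obtain ⟨c, hc, -, hcl⟩ := hN
    obtain ⟨v, w, hw, hwl⟩ := hc.exists_isCycle (by omega)
    exact ⟨v, w, hw, by omega⟩
end

section
/- Let G be a bipartite graph with bipartition (A, B) and minimum degree at least k ≥ 2. If |B| < min(|A|, 2k−2), then for any two vertices u, v of G there exists a path from u to v in G that contains all vertices of B. -/
/-- The degree of a vertex (classical version, no decidability assumptions). -/
noncomputable def deg {V : Type*} [Fintype V] (G : SimpleGraph V) (v : V) : ℕ := by
  classical exact G.degree v

open Finset

/-- Two sets of indices any two of whose elements are far apart leave a gap. -/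
theorem card_add_card_add_le_of_alternating {m t : ℕ} {X Y : Finset ℕ}
    (hX : X ⊆ range m) (hY : Y ⊆ range (m + 1)) (hX0 : X.Nonempty) (hY0 : Y.Nonempty)
    (ht : 1 ≤ t) (h₁ : ∀ i ∈ X, ∀ j ∈ Y, i < j → i + 1 + t ≤ j)
    (h₂ : ∀ i ∈ X, ∀ j ∈ Y, j ≤ i → j + t ≤ i) :
    #X + #Y + t ≤ m + 2 := by
  obtain ⟨i₀, hi₀⟩ := hX0
  obtain ⟨j₀, hj₀⟩ := hY0
  have hXY : Disjoint X Y := by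
    rw [Finset.disjoint_left]
    intro i hi hi'
    have := h₂ i hi i hi' le_rfl
    omega
  suffices h : ∃ Z : Finset ℕ, t ≤ #Z + 1 ∧ Disjoint (X ∪ Y) Z ∧ Z ⊆ range (m + 1) by
    obtain ⟨Z, hZt, hZ, hZm⟩ := h
    have h1 := card_le_card (union_subset (union_subset
      (hX.trans (range_subset_range.2 (Nat.le_succ m))) hY) hZm)
    rw [card_union_of_disjoint hZ, card_union_of_disjoint hXY, card_range] at h1
    omega
  have hm := mem_range.1 (hX hi₀)
  have hm' := mem_range.1 (hY hj₀)
  rcases lt_or_ge i₀ j₀ with hlt | hge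
  · obtain ⟨i, hi, hmax⟩ := (X.filter (· < j₀)).exists_max_image id
      ⟨i₀, mem_filter.2 ⟨hi₀, hlt⟩⟩
    simp only [mem_filter, id] at hi hmax
    have hij := h₁ i hi.1 j₀ hj₀ hi.2
    refine ⟨Ioo i (i + 1 + t), by simp; omega, ?_, ?_⟩
    · rw [Finset.disjoint_left]
      intro c hc hc'
      rw [mem_Ioo] at hc'
      rcases mem_union.1 hc with hc | hc
      · have := hmax c ⟨hc, by omega⟩
        omega
      · have := h₁ i hi.1 c hc hc'.1
        omega
    · intro c hc
      rw [mem_Ioo] at hc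
      rw [mem_range]
      omega
  · obtain ⟨j, hj, hmax⟩ := (Y.filter (· ≤ i₀)).exists_max_image id
      ⟨j₀, mem_filter.2 ⟨hj₀, hge⟩⟩
    simp only [mem_filter, id] at hj hmax
    have hij := h₂ i₀ hi₀ j hj.1 hj.2
    refine ⟨Ioo j (j + t), by simp; omega, ?_, ?_⟩
    · rw [Finset.disjoint_left]
      intro c hc hc'
      rw [mem_Ioo] at hc'
      rcases mem_union.1 hc with hc | hc
      · have := h₂ c hc j hj.1 hc'.1.le
        omega
      · have := hmax c ⟨hc, by omega⟩
        omega
    · intro c hc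
      rw [mem_Ioo] at hc
      rw [mem_range]
      omega

theorem card_add_card_add_le_of_lt {n t i₀ j₀ : ℕ} {X Y : Finset ℕ}
    (hX : X ⊆ range n) (hY : Y ⊆ range n) (ht : 1 ≤ t)
    (h : ∀ i ∈ X, ∀ j ∈ Y, i ≠ j → i + t < j ∨ j + t < i)
    (hi₀ : i₀ ∈ X) (hj₀ : j₀ ∈ Y) (hlt : i₀ < j₀) :
    #X + #Y + t ≤ n + 2 := by
  obtain ⟨i, hi, hmax⟩ := (X.filter (· < j₀)).exists_max_image id
    ⟨i₀, mem_filter.2 ⟨hi₀, hlt⟩⟩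
  simp only [mem_filter, id] at hi hmax
  have hn := mem_range.1 (hY hj₀)
  have hij := h i hi.1 j₀ hj₀ hi.2.ne
  set O := (X ∩ Y).image (· + 1) with hO
  have hOc : #O = #(X ∩ Y) := card_image_of_injective _ (add_left_injective 1)
  have hd₁ : Disjoint (X ∪ Y) O := by
    rw [Finset.disjoint_left]
    intro c hc hc'
    obtain ⟨e, he, rfl⟩ := mem_image.1 hc'
    rw [mem_inter] at he
    rcases mem_union.1 hc with hc | hc
    · have := h _ hc _ he.2 (by omega)
      omega
    · have := h _ he.1 _ hc (by omega)
      omega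
  have hd₂ : Disjoint (X ∪ Y ∪ O) (Ioc (i + 1) (i + t)) := by
    rw [Finset.disjoint_left]
    intro c hc hc'
    rw [mem_Ioc] at hc'
    rcases mem_union.1 hc with hc | hc
    · rcases mem_union.1 hc with hc | hc
      · have := hmax c ⟨hc, by omega⟩
        omega
      · have := h i hi.1 c hc (by omega)
        omega
    · obtain ⟨e, he, rfl⟩ := mem_image.1 hc
      rw [mem_inter] at he
      have := hmax e ⟨he.1, by omega⟩
      omega
  have hsub : X ∪ Y ∪ O ∪ Ioc (i + 1) (i + t) ⊆ range (n + 1) := by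
    intro c hc
    rw [mem_range]
    rcases mem_union.1 hc with hc | hc
    · rcases mem_union.1 hc with hc | hc
      · have := mem_range.1 ((union_subset hX hY) hc)
        omega
      · obtain ⟨e, he, rfl⟩ := mem_image.1 hc
        have := mem_range.1 (hX (mem_inter.1 he).1)
        omega
    · rw [mem_Ioc] at hc
      omega
  have h1 := card_le_card hsub
  rw [card_union_of_disjoint hd₂, card_union_of_disjoint hd₁, card_range, hOc, Nat.card_Ioc] at h1
  have h2 := card_union_add_card_inter X Y
  omega

theorem card_add_card_add_le_of_two_le {n t : ℕ} {X Y : Finset ℕ}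
    (hX : X ⊆ range n) (hY : Y ⊆ range n) (ht : 1 ≤ t) (hX2 : 2 ≤ #X) (hY0 : Y.Nonempty)
    (h : ∀ i ∈ X, ∀ j ∈ Y, i ≠ j → i + t < j ∨ j + t < i) :
    #X + #Y + t ≤ n + 2 := by
  obtain ⟨j, hj⟩ := hY0
  obtain ⟨i, hi, hij⟩ := exists_mem_ne hX2 j
  rcases lt_or_gt_of_ne hij with hlt | hlt
  · exact card_add_card_add_le_of_lt hX hY ht h hi hj hlt
  · rw [add_comm #X]
    exact card_add_card_add_le_of_lt hY hX ht
      (fun i hi j hj hij => (h j hj i hi hij.symm).symm) hj hi hlt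

variable {W : Type*} {H : SimpleGraph W} {A B : Finset W} {s e : W} {P Q : List W}

/-- `P` is the list of vertices of a path from `s` to `e`. -/
structure IsPathList (H : SimpleGraph W) (s e : W) (P : List W) : Prop where
  chain : P.IsChain H.Adj
  nodup : P.Nodup
  head : P.head? = some s
  last : P.getLast? = some e

namespace IsPathList

theorem singleton (x : W) : IsPathList H x x [x] := ⟨by simp, by simp, rfl, rfl⟩

theorem reverse (h : IsPathList H s e P) : IsPathList H e s P.reverse where
  chain := by
    rw [List.isChain_reverse]
    exact h.chain.imp fun _ _ hab => hab.symm
  nodup := List.nodup_reverse.2 h.nodup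
  head := by rw [List.head?_reverse, h.last]
  last := by rw [List.getLast?_reverse, h.head]

theorem append {a b : W} (hP : IsPathList H s a P) (hQ : IsPathList H b e Q) (hab : H.Adj a b)
    (hd : P.Disjoint Q) : IsPathList H s e (P ++ Q) where
  chain := by
    rw [List.isChain_append]
    refine ⟨hP.chain, hQ.chain, ?_⟩
    simp [hP.last, hQ.head, hab]
  nodup := List.nodup_append'.2 ⟨hP.nodup, hQ.nodup, hd⟩
  head := by simp [hP.head]
  last := by simp [hQ.last]

theorem ne_nil (h : IsPathList H s e P) : P ≠ [] := by
  rintro rfl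
  simpa using h.head

theorem head_mem (h : IsPathList H s e P) : s ∈ P := List.mem_of_head? h.head

theorem last_mem (h : IsPathList H s e P) : e ∈ P := List.mem_of_getLast? h.last

theorem take (h : IsPathList H s e P) {i : ℕ} (hi : i < P.length) :
    IsPathList H s P[i] (P.take (i + 1)) where
  chain := h.chain.take _
  nodup := h.nodup.sublist (List.take_sublist _ _)
  head := by simp [List.head?_take, h.head]
  last := by simp [List.getLast?_take, hi]

theorem drop (h : IsPathList H s e P) {i : ℕ} (hi : i < P.length) :
    IsPathList H P[i] e (P.drop i) where
  chain := h.chain.drop _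
  nodup := h.nodup.sublist (List.drop_sublist _ _)
  head := by simp [hi]
  last := by simp [List.getLast?_drop, hi, h.last]

/-- Replacing the part of a path between two of its vertices by another path. -/
theorem splice {a b : W} (hP : IsPathList H s e P) (hQ : IsPathList H a b Q)
    (hd : P.Disjoint Q) {i j : ℕ} (hij : i < j) (hj : j < P.length)
    (ha : H.Adj P[i] a) (hb : H.Adj b P[j]) :
    IsPathList H s e (P.take (i + 1) ++ (Q ++ P.drop j)) := by
  refine (hP.take (hij.trans hj)).append (hQ.append (hP.drop hj) hb ?_) ha ?_
  · intro x hx hx'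
    exact hd (List.mem_of_mem_drop hx') hx
  · intro x hx hx'
    rcases List.mem_append.1 hx' with hx' | hx'
    · exact hd (List.mem_of_mem_take hx) hx'
    · exact absurd hx' (List.disjoint_take_drop hP.nodup hij hx)

/-- Inserting two new vertices into a path, reversing the part between them. -/
theorem crossing {x y : W} (hP : IsPathList H s e P) (hx : x ∉ P) (hy : y ∉ P) (hxy : x ≠ y)
    {i j : ℕ} (hij : i < j) (hj : j + 1 < P.length)
    (hi₁ : H.Adj P[i] y) (hj₁ : H.Adj y P[j]) (hi₂ : H.Adj P[i + 1] x)
    (hj₂ : H.Adj x P[j + 1]) :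
    ∃ P', IsPathList H s e P' ∧ P'.length = P.length + 2 := by
  have hM : IsPathList H P[i + 1] P[j] ((P.take (j + 1)).drop (i + 1)) := by
    have := (hP.take (i := j) (by omega)).drop (i := i + 1) (by simp; omega)
    simpa using this
  have hMP : ∀ z ∈ (P.take (j + 1)).drop (i + 1), z ∈ P := fun z hz =>
    List.mem_of_mem_take (List.mem_of_mem_drop hz)
  have hMi : ∀ z ∈ (P.take (j + 1)).drop (i + 1), z ∈ P.drop (i + 1) := fun z hz =>
    ((List.take_sublist _ _).drop _).subset hz
  have h₁ := (singleton (H := H) x).append (hP.drop hj) hj₂ (by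
    simpa using fun h => hx (List.mem_of_mem_drop h))
  have h₂ := hM.reverse.append h₁ hi₂ (by
    intro z hz hz'
    rw [List.mem_reverse] at hz
    rcases List.mem_append.1 hz' with hz' | hz'
    · rw [List.mem_singleton] at hz'
      exact hx (hz' ▸ hMP z hz)
    · exact List.disjoint_take_drop hP.nodup le_rfl (List.mem_of_mem_drop hz) hz')
  have h₃ := (singleton (H := H) y).append h₂ hj₁ (by
    intro z hz hz'
    rw [List.mem_singleton] at hz
    subst hz
    simp only [List.mem_append, List.mem_reverse, List.mem_singleton] at hz'
    rcases hz' with hz' | hz' | hz'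
    · exact hy (hMP z hz')
    · exact hxy hz'.symm
    · exact hy (List.mem_of_mem_drop hz'))
  have h₄ := (hP.take (i := i) (by omega)).append h₃ hi₁ (by
    intro z hz hz'
    have hzP := List.mem_of_mem_take hz
    simp only [List.mem_append, List.mem_reverse, List.mem_singleton] at hz'
    rcases hz' with hz' | hz' | hz' | hz'
    · exact hy (hz' ▸ hzP)
    · exact List.disjoint_take_drop hP.nodup le_rfl hz (hMi z hz')
    · exact hx (hz' ▸ hzP)
    · exact List.disjoint_take_drop hP.nodup (by omega) hz hz')
  exact ⟨_, h₄, by simp; omega⟩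

/-- Two distinct vertices of a path are joined by a subpath. -/
theorem exists_subpath (h : IsPathList H s e P) {x y : W} (hx : x ∈ P) (hy : y ∈ P)
    (hxy : x ≠ y) : ∃ R, IsPathList H x y R ∧ R ⊆ P ∧ 2 ≤ R.length := by
  obtain ⟨i, hi, rfl⟩ := List.getElem_of_mem hx
  obtain ⟨j, hj, rfl⟩ := List.getElem_of_mem hy
  have key : ∀ {i j : ℕ} (hij : i < j) (hj : j < P.length),
      ∃ R, IsPathList H P[i] P[j] R ∧ R ⊆ P ∧ 2 ≤ R.length := by
    intro i j hij hj
    have := (h.take hj).drop (i := i) (by simp; omega)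
    refine ⟨_, by simpa using this, fun z hz => List.mem_of_mem_take (List.mem_of_mem_drop hz), ?_⟩
    simp
    omega
  rcases lt_trichotomy i j with hij | rfl | hij
  · exact key hij hj
  · exact absurd rfl hxy
  · obtain ⟨R, hR, hRP, hR2⟩ := key hij hi
    exact ⟨R.reverse, hR.reverse, fun z hz => hRP (List.mem_reverse.1 hz), by simpa using hR2⟩

theorem last_eq_getElem (h : IsPathList H s e P) {i : ℕ} (hi : i + 1 = P.length) :
    P[i] = e := by
  have := h.last
  rw [List.getLast?_eq_getElem?, List.getElem?_eq_getElem (by omega)] at this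
  simpa [← hi] using this

theorem head_eq_getElem (h : IsPathList H s e P) (hi : 0 < P.length) : P[0] = s := by
  have := h.head
  rw [List.head?_eq_getElem?, List.getElem?_eq_getElem hi] at this
  simpa using this

theorem getElem_mem (hAB : H.IsBipartiteWith (A : Set W) B) (h : IsPathList H s e P)
    (hs : s ∈ A) (i : ℕ) (hi : i < P.length) :
    (Even i → P[i] ∈ A) ∧ (Odd i → P[i] ∈ B) := by
  induction i with
  | zero =>
    simp [h.head_eq_getElem hi, hs]
  | succ i ih =>
    have hadj := List.isChain_iff_getElem.1 h.chain i hi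
    have ih := ih (by omega)
    constructor
    · intro h'
      exact hAB.symm.mem_of_mem_adj (ih.2 (by grind)) hadj
    · intro h'
      exact hAB.mem_of_mem_adj (ih.1 (by grind)) hadj

theorem odd_length (hAB : H.IsBipartiteWith (A : Set W) B) (h : IsPathList H s e P)
    (hs : s ∈ A) (he : e ∈ A) : Odd P.length := by
  have hpos := List.length_pos_of_ne_nil h.ne_nil
  by_contra hodd
  have := (h.getElem_mem hAB hs (P.length - 1) (by omega)).2 (by grind)
  rw [h.last_eq_getElem (by omega)] at this
  exact Set.disjoint_left.1 hAB.disjoint he this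

theorem even_length (hAB : H.IsBipartiteWith (A : Set W) B) (h : IsPathList H s e P)
    (hs : s ∈ A) (he : e ∈ B) : Even P.length := by
  have hpos := List.length_pos_of_ne_nil h.ne_nil
  by_contra hodd
  have := (h.getElem_mem hAB hs (P.length - 1) (by omega)).1 (by grind)
  rw [h.last_eq_getElem (by omega)] at this
  exact Set.disjoint_left.1 hAB.disjoint this he

theorem card_inter [DecidableEq W] (hAB : H.IsBipartiteWith (A : Set W) B)
    (h : IsPathList H s e P) (hs : s ∈ A) :
    #(P.toFinset ∩ A) = (P.length + 1) / 2 ∧ #(P.toFinset ∩ B) = P.length / 2 := by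
  induction P generalizing s A B with
  | nil => exact absurd rfl h.ne_nil
  | cons x T ih =>
    obtain rfl : x = s := by simpa using h.head
    have hxB : x ∉ B := fun hx => (Finset.disjoint_left.1 (by exact_mod_cast hAB.disjoint)) hs hx
    cases T with
    | nil => simp [hs, hxB]
    | cons y T =>
      have hc := List.isChain_cons_cons.1 h.chain
      have hn := List.nodup_cons.1 h.nodup
      have hy : y ∈ B := hAB.mem_of_mem_adj hs hc.1
      have := ih hAB.symm ⟨hc.2, hn.2, rfl, by simpa using h.last⟩ hy
      rw [List.toFinset_cons, insert_inter_of_mem hs, insert_inter_of_notMem hxB,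
        card_insert_of_notMem (by simpa using fun h' => absurd h' (by simpa using hn.1)),
        this.1, this.2]
      rw [List.length_cons (a := x)]
      constructor <;> omega

end IsPathList

/-- The neighbours of a vertex, as a finset. -/
noncomputable def nbrs [Fintype W] (H : SimpleGraph W) (z : W) : Finset W := by
  classical exact univ.filter (H.Adj z)

theorem mem_nbrs [Fintype W] {z w : W} : w ∈ nbrs H z ↔ H.Adj z w := by
  classical simp [nbrs]

/-- The indices `i < n` for which `z` is adjacent to the entry of `P` at position `2 * i + r`. -/
noncomputable def nbrIndices (H : SimpleGraph W) (P : List W) (n r : ℕ) (z : W) : Finset ℕ := by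
  classical exact (range n).filter fun i => ∃ h : 2 * i + r < P.length, H.Adj z P[2 * i + r]

theorem mem_nbrIndices {n r i : ℕ} {z : W} : i ∈ nbrIndices H P n r z ↔
    i < n ∧ ∃ h : 2 * i + r < P.length, H.Adj z P[2 * i + r] := by
  classical simp [nbrIndices]

theorem nbrIndices_subset {n r : ℕ} {z : W} : nbrIndices H P n r z ⊆ range n := fun _ hi =>
  mem_range.2 (mem_nbrIndices.1 hi).1

theorem card_nbrs_inter_le [Fintype W] [DecidableEq W] {n r : ℕ} {z : W}
    (hn : P.length ≤ 2 * n + r) (hr : ∀ i (hi : i < P.length), H.Adj z P[i] → i % 2 = r) :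
    #(nbrs H z ∩ P.toFinset) ≤ #(nbrIndices H P n r z) := by
  refine le_trans (card_le_card ?_)
    (card_image_le (s := nbrIndices H P n r z) (f := fun i => P.getD (2 * i + r) z))
  intro w hw
  rw [mem_inter, mem_nbrs, List.mem_toFinset] at hw
  obtain ⟨i, hi, rfl⟩ := List.getElem_of_mem hw.2
  have hir := hr i hi hw.1
  have hi2 : 2 * (i / 2) + r = i := by omega
  refine mem_image.2 ⟨i / 2, mem_nbrIndices.2 ⟨by omega, ?_⟩, ?_⟩
  · simp only [hi2]
    exact ⟨hi, hw.1⟩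
  · simp [hi2, hi]

namespace IsPathList

theorem mod_two_of_mem_left (hAB : H.IsBipartiteWith (A : Set W) B) (hP : IsPathList H s e P)
    (hs : s ∈ A) {z : W} (hz : z ∈ A) (i : ℕ) (hi : i < P.length) (hzi : H.Adj z P[i]) :
    i % 2 = 1 := by
  by_contra h
  have h₁ := (hP.getElem_mem hAB hs i hi).1 (by grind)
  exact Set.disjoint_left.1 hAB.disjoint h₁ (hAB.mem_of_mem_adj hz hzi)

theorem mod_two_of_mem_right (hAB : H.IsBipartiteWith (A : Set W) B) (hP : IsPathList H s e P)
    (hs : s ∈ A) {z : W} (hz : z ∈ B) (i : ℕ) (hi : i < P.length) (hzi : H.Adj z P[i]) :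
    i % 2 = 0 := by
  by_contra h
  have h₁ := (hP.getElem_mem hAB hs i hi).2 (by grind)
  exact Set.disjoint_left.1 hAB.disjoint (hAB.symm.mem_of_mem_adj hz hzi) h₁

/-- A detour off a longest path is no longer than the part it bypasses. -/
theorem add_length_lt (hP : IsPathList H s e P)
    (hmax : ∀ P', IsPathList H s e P' → P'.length ≤ P.length) {a b : W}
    (hQ : IsPathList H a b Q) (hd : P.Disjoint Q) {i j : ℕ} (hij : i < j) (hj : j < P.length)
    (ha : H.Adj a P[i]) (hb : H.Adj b P[j]) : i + Q.length < j := by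
  have := hmax _ (hP.splice hQ hd hij hj ha.symm hb)
  simp only [List.length_append, List.length_take, List.length_drop] at this
  omega

theorem add_length_lt_or (hP : IsPathList H s e P)
    (hmax : ∀ P', IsPathList H s e P' → P'.length ≤ P.length) {a b : W}
    (hQ : IsPathList H a b Q) (hd : P.Disjoint Q) {i j : ℕ} (hij : i ≠ j) (hi : i < P.length)
    (hj : j < P.length) (ha : H.Adj a P[i]) (hb : H.Adj b P[j]) :
    i + Q.length < j ∨ j + Q.length < i := by
  rcases lt_or_gt_of_ne hij with h | h
  · exact .inl (hP.add_length_lt hmax hQ hd h hj ha hb)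
  · have := hP.add_length_lt hmax hQ.reverse (by simpa using hd) h hi hb ha
    rw [List.length_reverse] at this
    exact .inr this

variable [Fintype W] [DecidableEq W] {k m t : ℕ}

theorem false_of_isolated (hAB : H.IsBipartiteWith (A : Set W) B) (hP : IsPathList H s e P)
    (hmax : ∀ P', IsPathList H s e P' → P'.length ≤ P.length) (hs : s ∈ A)
    (hlen : P.length = 2 * m + 1) {x y : W} (hx : x ∈ A) (hy : y ∈ B) (hxP : x ∉ P) (hyP : y ∉ P)
    (hkx : k ≤ #(nbrs H x ∩ P.toFinset)) (hky : k ≤ #(nbrs H y ∩ P.toFinset))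
    (hmk : m + 4 ≤ 2 * k) : False := by
  have hxy : x ≠ y := by
    rintro rfl
    exact Set.disjoint_left.1 hAB.disjoint hx hy
  have hX := hkx.trans (card_nbrs_inter_le (n := m) (r := 1) (by omega)
    (hP.mod_two_of_mem_left hAB hs hx))
  have hY := hky.trans (card_nbrs_inter_le (n := m + 1) (r := 0) (by omega)
    (hP.mod_two_of_mem_right hAB hs hy))
  set X := nbrIndices H P m 1 x
  set Y := nbrIndices H P (m + 1) 0 y
  have hXs : X ⊆ range m := nbrIndices_subset
  have hYs : Y ⊆ range (m + 1) := nbrIndices_subset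
  have h₁ := card_le_card (union_subset
    (hXs.trans (range_subset_range.2 (Nat.le_succ m))) hYs)
  have h₂ := card_union_add_card_inter X Y
  rw [card_range] at h₁
  obtain ⟨i, hi, j, hj, hij⟩ := one_lt_card.1 (show 1 < #(X ∩ Y) by omega)
  wlog hlt : i < j generalizing i j
  · exact this j hj i hi hij.symm (by omega)
  obtain ⟨hiX, hiY⟩ := mem_inter.1 hi
  obtain ⟨hjX, hjY⟩ := mem_inter.1 hj
  obtain ⟨_, hi₁, hiX⟩ := mem_nbrIndices.1 hiX
  obtain ⟨_, hi₂, hiY⟩ := mem_nbrIndices.1 hiY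
  obtain ⟨_, hj₁, hjX⟩ := mem_nbrIndices.1 hjX
  obtain ⟨_, hj₂, hjY⟩ := mem_nbrIndices.1 hjY
  obtain ⟨P', hP', hl⟩ := hP.crossing hxP hyP hxy (i := 2 * i) (j := 2 * j) (by omega) hj₁
    hiY.symm hjY hiX.symm hjX
  have := hmax P' hP'
  omega

theorem false_of_mixed_ends (hAB : H.IsBipartiteWith (A : Set W) B) (hP : IsPathList H s e P)
    (hmax : ∀ P', IsPathList H s e P' → P'.length ≤ P.length) (hs : s ∈ A)
    (hlen : P.length = 2 * m + 1) {x y : W} (hx : x ∈ A) (hy : y ∈ B)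
    (hQ : IsPathList H x y Q) (hd : P.Disjoint Q) (hQt : Q.length = 2 * t) (ht : 1 ≤ t)
    (htk : t < k) (hkx : k ≤ #(nbrs H x ∩ P.toFinset) + t)
    (hky : k ≤ #(nbrs H y ∩ P.toFinset) + t) (hmk : m + t + 3 ≤ 2 * k) : False := by
  have hX := card_nbrs_inter_le (n := m) (r := 1) (by omega) (hP.mod_two_of_mem_left hAB hs hx)
  have hY := card_nbrs_inter_le (n := m + 1) (r := 0) (by omega)
    (hP.mod_two_of_mem_right hAB hs hy)
  have := card_add_card_add_le_of_alternating (m := m) (t := t)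
    (X := nbrIndices H P m 1 x) (Y := nbrIndices H P (m + 1) 0 y)
    nbrIndices_subset nbrIndices_subset (card_pos.1 (by omega)) (card_pos.1 (by omega)) ht
    (by
      intro i hi j hj hij
      obtain ⟨_, hi₁, hi⟩ := mem_nbrIndices.1 hi
      obtain ⟨_, hj₁, hj⟩ := mem_nbrIndices.1 hj
      have := hP.add_length_lt_or hmax hQ hd (by omega) hi₁ hj₁ hi hj
      omega)
    (by
      intro i hi j hj hij
      obtain ⟨_, hi₁, hi⟩ := mem_nbrIndices.1 hi
      obtain ⟨_, hj₁, hj⟩ := mem_nbrIndices.1 hj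
      have := hP.add_length_lt_or hmax hQ hd (by omega) hi₁ hj₁ hi hj
      omega)
  omega

theorem false_of_same_ends (hP : IsPathList H s e P)
    (hmax : ∀ P', IsPathList H s e P' → P'.length ≤ P.length) {n r : ℕ}
    (hn : P.length ≤ 2 * n + r) {x y : W}
    (hx : ∀ i (hi : i < P.length), H.Adj x P[i] → i % 2 = r)
    (hy : ∀ i (hi : i < P.length), H.Adj y P[i] → i % 2 = r)
    (hQ : IsPathList H x y Q) (hd : P.Disjoint Q) (hQt : Q.length = 2 * t + 1) (ht : 1 ≤ t)
    (htk : t + 2 ≤ k) (hkx : k ≤ #(nbrs H x ∩ P.toFinset) + t)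
    (hky : k ≤ #(nbrs H y ∩ P.toFinset) + t) (hmk : n + t + 3 ≤ 2 * k) : False := by
  have hX := card_nbrs_inter_le hn hx
  have hY := card_nbrs_inter_le hn hy
  have := card_add_card_add_le_of_two_le (n := n) (t := t)
    (X := nbrIndices H P n r x) (Y := nbrIndices H P n r y)
    nbrIndices_subset nbrIndices_subset ht (by omega) (card_pos.1 (by omega))
    (by
      intro i hi j hj hij
      obtain ⟨_, hi₁, hi⟩ := mem_nbrIndices.1 hi
      obtain ⟨_, hj₁, hj⟩ := mem_nbrIndices.1 hj
      have := hP.add_length_lt_or hmax hQ hd (by omega) hi₁ hj₁ hi hj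
      omega)
  omega

/-- Two vertices at distance two on a longest path cannot both have two neighbours on a path
disjoint from it. -/
theorem false_of_two_nbrs (hP : IsPathList H s e P)
    (hmax : ∀ P', IsPathList H s e P' → P'.length ≤ P.length) {x y : W}
    (hQ : IsPathList H x y Q) (hd : P.Disjoint Q) {i : ℕ} (hi : i + 2 < P.length)
    (h₁ : 0 < #(nbrs H P[i] ∩ Q.toFinset)) (h₂ : 1 < #(nbrs H P[i + 2] ∩ Q.toFinset)) :
    False := by
  obtain ⟨a, ha⟩ := card_pos.1 h₁
  obtain ⟨b, hb, hba⟩ := exists_mem_ne h₂ a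
  rw [mem_inter, mem_nbrs, List.mem_toFinset] at ha hb
  obtain ⟨R, hR, hRQ, hR2⟩ := hQ.exists_subpath ha.2 hb.2 hba.symm
  have := hP.add_length_lt hmax hR (fun z hz hz' => hd hz (hRQ hz')) (by omega) hi
    ha.1.symm hb.1.symm
  omega

end IsPathList

theorem exists_longest_list [Fintype W] {p : List W → Prop} (hp : ∀ l, p l → l.Nodup)
    (h : ∃ l, p l) : ∃ l, p l ∧ ∀ l', p l' → l'.length ≤ l.length := by
  have hfin : {l | p l}.Finite := (List.finite_length_le W (Fintype.card W)).subset
    fun l hl => (hp l hl).length_le_card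
  obtain ⟨l, hl, hmax⟩ := Set.Finite.exists_maximalFor List.length _ hfin h
  exact ⟨l, hl, fun l' hl' => (le_total l'.length l.length).elim id (hmax hl')⟩

namespace IsPathList

variable [Fintype W] [DecidableEq W] {k : ℕ}

/-- The neighbours of an end of a longest path off `P` lie on that path or on `P`. -/
theorem card_nbrs_le (hAB : H.IsBipartiteWith (A : Set W) B) {x y : W}
    (hQ : IsPathList H x y Q) (hd : P.Disjoint Q)
    (hQmax : ∀ x y Q', IsPathList H x y Q' → P.Disjoint Q' → Q'.length ≤ Q.length)
    (hx : x ∈ A) : #(nbrs H x) ≤ #(nbrs H x ∩ P.toFinset) + #(Q.toFinset ∩ B) := by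
  refine (card_le_card ?_).trans (card_union_le _ _)
  intro z hz
  have hxz := mem_nbrs.1 hz
  have hzB : z ∈ B := hAB.mem_of_mem_adj hx hxz
  simp only [mem_union, mem_inter, hz, hzB, List.mem_toFinset, true_and, and_true]
  by_contra! hcon
  have := hQmax z y _ ((singleton (H := H) z).append hQ hxz.symm (by simpa using hcon.2))
    (by simpa using ⟨hcon.1, hd⟩)
  simp at this

/-- A longest path between two vertices of `A` covers `B`. -/
theorem mem_of_longest (hAB : H.IsBipartiteWith (A : Set W) B) (hs : s ∈ A) (he : e ∈ A)
    (hdA : ∀ x ∈ A, x ≠ s → x ≠ e → k ≤ #(nbrs H x)) (hdB : ∀ y ∈ B, k ≤ #(nbrs H y))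
    (hBk : #B + 3 ≤ 2 * k) (hBA : #B < #A) (hP : IsPathList H s e P)
    (hmax : ∀ P', IsPathList H s e P' → P'.length ≤ P.length) (hP7 : 7 ≤ P.length)
    {y₀ : W} (hy₀ : y₀ ∈ B) : y₀ ∈ P := by
  by_contra hy₀P
  obtain ⟨m, hm⟩ := hP.odd_length hAB hs he
  obtain ⟨hPA, hPB⟩ := hP.card_inter hAB hs
  rw [hm] at hPA hPB
  have hmB : m < #B := by
    have := card_lt_card (show P.toFinset ∩ B ⊂ B from
      ⟨inter_subset_right, fun h => hy₀P (List.mem_toFinset.1 (mem_inter.1 (h hy₀)).1)⟩)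
    omega
  obtain ⟨x₀, hx₀, hx₀P⟩ : ∃ x ∈ A, x ∉ P := by
    by_contra! hcon
    have := card_le_card (show A ⊆ P.toFinset ∩ A from
      fun x hx => mem_inter.2 ⟨List.mem_toFinset.2 (hcon x hx), hx⟩)
    omega
  have hdA' : ∀ x ∈ A, x ∉ P → k ≤ #(nbrs H x) := fun x hx hxP =>
    hdA x hx (fun h => hxP (h ▸ hP.head_mem)) (fun h => hxP (h ▸ hP.last_mem))
  obtain ⟨Q, ⟨⟨a, b, hQ⟩, hd⟩, hQmax⟩ := exists_longest_list
    (p := fun l => (∃ a b, IsPathList H a b l) ∧ P.Disjoint l)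
    (fun l hl => hl.1.elim fun _ h => h.elim fun _ h => h.nodup)
    ⟨[y₀], ⟨y₀, y₀, singleton y₀⟩, by simpa using hy₀P⟩
  replace hQmax : ∀ x y Q', IsPathList H x y Q' → P.Disjoint Q' → Q'.length ≤ Q.length :=
    fun x y Q' h h' => hQmax Q' ⟨⟨x, y, h⟩, h'⟩
  have hQpos := List.length_pos_of_ne_nil hQ.ne_nil
  have haP : a ∉ P := fun h => hd h hQ.head_mem
  have hbP : b ∉ P := fun h => hd h hQ.last_mem
  have hPQB : m + #(Q.toFinset ∩ B) ≤ #B := by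
    have hdis : Disjoint (P.toFinset ∩ B) (Q.toFinset ∩ B) := by
      rw [Finset.disjoint_left]
      intro z hz hz'
      simp only [mem_inter, List.mem_toFinset] at hz hz'
      exact hd hz.1 hz'.1
    have := card_le_card (union_subset (inter_subset_right (s₁ := P.toFinset) (s₂ := B))
      (inter_subset_right (s₁ := Q.toFinset) (s₂ := B)))
    rw [card_union_of_disjoint hdis] at this
    omega
  have hsmall : #(Q.toFinset ∩ B) + 2 ≤ k := by
    by_contra hcon
    have key : ∀ i (hi : i < P.length), Even i → 0 < i → i + 1 < P.length →
        1 < #(nbrs H P[i] ∩ Q.toFinset) := by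
      intro i hi hie hi0 hil
      have hiA := (hP.getElem_mem hAB hs i hi).1 hie
      have hk := hdA _ hiA
        (fun h => by
          rw [← hP.head_eq_getElem (by omega)] at h
          have := (hP.nodup.getElem_inj_iff).1 h
          omega)
        (fun h => by
          rw [← hP.last_eq_getElem (i := P.length - 1) (by omega)] at h
          have := (hP.nodup.getElem_inj_iff).1 h
          omega)
      have h₁ := card_le_card (show nbrs H P[i] ⊆ nbrs H P[i] ∩ Q.toFinset ∪ B \ Q.toFinset by
        intro z hz
        have hzB : z ∈ B := hAB.mem_of_mem_adj hiA (mem_nbrs.1 hz)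
        simp only [mem_union, mem_inter, mem_sdiff, hz, hzB, true_and]
        exact em _)
      have h₂ := card_union_le (nbrs H P[i] ∩ Q.toFinset) (B \ Q.toFinset)
      have h₃ := card_sdiff_add_card_inter B Q.toFinset
      rw [inter_comm B] at h₃
      omega
    exact hP.false_of_two_nbrs hmax hQ hd (i := 2) (by omega)
      (zero_lt_one.trans (key 2 (by omega) (by decide) (by omega) (by omega)))
      (key 4 (by omega) (by decide) (by omega) (by omega))
  rcases Nat.lt_or_ge Q.length 2 with hQ2 | hQ2
  · have key : ∀ z ∉ P, #(nbrs H z) ≤ #(nbrs H z ∩ P.toFinset) := by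
      intro z hzP
      refine card_le_card fun w hw => mem_inter.2 ⟨hw, ?_⟩
      rw [mem_nbrs] at hw
      by_contra hwP
      rw [List.mem_toFinset] at hwP
      have := hQmax z w _ ((singleton (H := H) z).append (singleton w) hw (by simp [hw.ne']))
        (by simp [hzP, hwP])
      simp at this
      omega
    exact hP.false_of_isolated hAB hmax hs hm hx₀ hy₀ hx₀P hy₀P
      ((hdA' x₀ hx₀ hx₀P).trans (key x₀ hx₀P)) ((hdB y₀ hy₀).trans (key y₀ hy₀P)) (by omega)
  have hQmax' : ∀ x y Q', IsPathList H x y Q' → P.Disjoint Q' →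
      Q'.length ≤ Q.reverse.length := by simpa using hQmax
  have hd' : P.Disjoint Q.reverse := by simpa using hd
  have mem_end : ∀ {x y : W} {R : List W}, IsPathList H x y R → 2 ≤ R.length →
      x ∈ A ∨ x ∈ B := by
    intro x y R hR hR2
    have hadj := List.isChain_iff_getElem.1 hR.chain 0 (by omega)
    rw [hR.head_eq_getElem (by omega)] at hadj
    exact (hAB.mem_of_adj hadj).imp And.left And.left
  have mixed : ∀ {x y : W} {R : List W}, IsPathList H x y R → P.Disjoint R →
      (∀ x y Q', IsPathList H x y Q' → P.Disjoint Q' → Q'.length ≤ R.length) →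
      R.length = Q.length → #(R.toFinset ∩ B) = #(Q.toFinset ∩ B) →
      x ∈ A → y ∈ B → False := by
    intro x y R hR hdR hRmax hRQ hRB hx hy
    obtain ⟨t, ht⟩ := hR.even_length hAB hx hy
    obtain ⟨hRA', hRB'⟩ := hR.card_inter hAB hx
    have hkx := hR.card_nbrs_le hAB hdR hRmax hx
    have hky := hR.reverse.card_nbrs_le hAB.symm (by simpa using hdR) (by simpa using hRmax) hy
    rw [List.toFinset_reverse] at hky
    have := hdA' x hx (fun h => hdR h hR.head_mem)
    have := hdB y hy
    exact hP.false_of_mixed_ends (t := t) (k := k) hAB hmax hs hm hx hy hR hdR (by omega)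
      (by omega) (by omega) (by omega) (by omega) (by omega)
  have hka := fun ha : a ∈ A => hQ.card_nbrs_le hAB hd hQmax ha
  have hka' := fun ha : a ∈ B => hQ.card_nbrs_le hAB.symm hd hQmax ha
  have hkb := fun hb : b ∈ A => hQ.reverse.card_nbrs_le hAB hd' hQmax' hb
  have hkb' := fun hb : b ∈ B => hQ.reverse.card_nbrs_le hAB.symm hd' hQmax' hb
  rw [List.toFinset_reverse] at hkb hkb'
  rcases mem_end hQ hQ2 with ha | ha <;>
    rcases mem_end hQ.reverse (by simpa using hQ2) with hb | hb
  · obtain ⟨t, ht⟩ := hQ.odd_length hAB ha hb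
    obtain ⟨hQA, hQB⟩ := hQ.card_inter hAB ha
    have := hdA' a ha haP
    have := hdA' b hb hbP
    have := hka ha
    have := hkb hb
    exact hP.false_of_same_ends (t := t) (k := k) (n := m) (r := 1) hmax (by omega)
      (hP.mod_two_of_mem_left hAB hs ha) (hP.mod_two_of_mem_left hAB hs hb) hQ hd
      (by omega) (by omega) (by omega) (by omega) (by omega) (by omega)
  · exact mixed hQ hd hQmax rfl rfl ha hb
  · exact mixed hQ.reverse hd' hQmax' (by simp) (by simp) hb ha
  · obtain ⟨t, ht⟩ := hQ.odd_length hAB.symm ha hb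
    obtain ⟨hQB, hQA⟩ := hQ.card_inter hAB.symm ha
    have := hdB a ha
    have := hdB b hb
    have := hka' ha
    have := hkb' hb
    exact hP.false_of_same_ends (t := t) (k := k) (n := m + 1) (r := 0) hmax (by omega)
      (hP.mod_two_of_mem_right hAB hs ha) (hP.mod_two_of_mem_right hAB hs hb) hQ hd
      (by omega) (by omega) (by omega) (by omega) (by omega) (by omega)

theorem exists_seven_le_length (hAB : H.IsBipartiteWith (A : Set W) B)
    (hs : s ∈ A) (he : e ∈ A) (hse : s ≠ e)
    (hdA : ∀ x ∈ A, x ≠ s → x ≠ e → k ≤ #(nbrs H x)) (hdB : ∀ y ∈ B, k ≤ #(nbrs H y))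
    (hBk : #B + 3 ≤ 2 * k) (hBA : #B < #A) {b₁ b₃ : W} (hb : b₁ ≠ b₃)
    (h₁ : H.Adj s b₁) (h₃ : H.Adj e b₃) : ∃ P, IsPathList H s e P ∧ 7 ≤ P.length := by
  have hAB' : ∀ {x y}, x ∈ A → y ∈ B → x ≠ y := by
    rintro x _ hx hy rfl
    exact Set.disjoint_left.1 hAB.disjoint hx hy
  have hnA : ∀ {x}, x ∈ A → nbrs H x ⊆ B := fun hx z hz =>
    hAB.mem_of_mem_adj hx (mem_nbrs.1 hz)
  have hnB : ∀ {y}, y ∈ B → nbrs H y ⊆ A := fun hy z hz =>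
    hAB.symm.mem_of_mem_adj hy (mem_nbrs.1 hz)
  have hb₁ : b₁ ∈ B := hAB.mem_of_mem_adj hs h₁
  have hb₃ : b₃ ∈ B := hAB.mem_of_mem_adj he h₃
  have hB2 : 1 < #B := one_lt_card.2 ⟨b₁, hb₁, b₃, hb₃, hb⟩
  have hkB : k ≤ #B := by
    obtain ⟨x, hx, hx'⟩ := exists_mem_notMem_of_card_lt_card
      (show #({s, e} : Finset W) < #A from card_le_two.trans_lt (by omega))
    simp only [mem_insert, mem_singleton, not_or] at hx'
    exact (hdA x hx hx'.1 hx'.2).trans (card_le_card (hnA hx))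
  obtain ⟨x₁, hx₁, hx₁'⟩ := exists_mem_notMem_of_card_lt_card
    (show #({s, e} : Finset W) < #(nbrs H b₁) from
      card_le_two.trans_lt (by have := hdB b₁ hb₁; omega))
  simp only [mem_insert, mem_singleton, not_or] at hx₁'
  have hx₁A := hnB hb₁ hx₁
  obtain ⟨x₂, hx₂, hx₂'⟩ : ∃ x ∈ nbrs H b₃, x ∉ ({s, e, x₁} : Finset W) := by
    rcases Nat.lt_or_ge 3 k with hk | hk
    · exact exists_mem_notMem_of_card_lt_card
        (card_le_three.trans_lt (by have := hdB b₃ hb₃; omega))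
    · obtain ⟨x, hx, hx'⟩ := exists_mem_notMem_of_card_lt_card
        (show #({s, e, x₁} : Finset W) < #A from card_le_three.trans_lt (by omega))
      refine ⟨x, ?_, hx'⟩
      simp only [mem_insert, mem_singleton, not_or] at hx'
      have := eq_of_subset_of_card_le (hnA hx)
        (by have := hdA x hx hx'.1 hx'.2.1; omega)
      rw [mem_nbrs, H.adj_comm, ← mem_nbrs, this]
      exact hb₃
  simp only [mem_insert, mem_singleton, not_or] at hx₂'
  have hx₂A := hnB hb₃ hx₂
  obtain ⟨b₂, hb₂, hb₂'⟩ := exists_mem_notMem_of_card_lt_card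
    (show #({b₁, b₃} : Finset W) < #(nbrs H x₁ ∩ nbrs H x₂) from card_le_two.trans_lt (by
      have := hdA x₁ hx₁A hx₁'.1 hx₁'.2
      have := hdA x₂ hx₂A hx₂'.1 hx₂'.2.1
      have := card_union_add_card_inter (nbrs H x₁) (nbrs H x₂)
      have := card_le_card (union_subset (hnA hx₁A) (hnA hx₂A))
      omega))
  simp only [mem_insert, mem_singleton, not_or] at hb₂'
  rw [mem_inter, mem_nbrs, mem_nbrs] at hb₂
  have hb₂B : b₂ ∈ B := hAB.mem_of_mem_adj hx₁A hb₂.1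
  rw [mem_nbrs] at hx₁ hx₂
  refine ⟨[s, b₁, x₁, b₂, x₂, b₃, e], ⟨?_, ?_, rfl, rfl⟩, le_rfl⟩
  · simp [h₁, hx₁, hb₂.1, hb₂.2.symm, hx₂.symm, h₃.symm]
  · simp only [List.nodup_cons, List.mem_cons, List.not_mem_nil]
    grind

end IsPathList

/-- A path can be extended by a vertex that is adjacent to its first vertex. -/
theorem IsPathList.exists_cons {h : W} (hP : IsPathList H h e P)
    (hs : s = h ∨ H.Adj s h ∧ s ∉ P) : ∃ P', IsPathList H s e P' ∧ P ⊆ P' ∧ P' ⊆ s :: P := by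
  rcases hs with rfl | ⟨hadj, hsP⟩
  · exact ⟨P, hP, fun _ => id, fun _ => List.mem_cons_of_mem _⟩
  · exact ⟨_, (singleton (H := H) s).append hP hadj (by simpa using hsP),
      fun _ => List.mem_cons_of_mem _, fun _ => id⟩

section Split

variable {V : Type*} [DecidableEq V]

/-- The bipartite graph with parts `A ∪ {u, v}` and `B`, placed in two disjoint copies of the
vertex type, where a vertex of the first part is joined to its neighbours and to its own copy. -/
def splitGraph (G : SimpleGraph V) (A B : Finset V) (u v : V) : SimpleGraph (V ⊕ V) where
  Adj
    | .inl x, .inr y => x ∈ A ∪ {u, v} ∧ y ∈ B ∧ (x = y ∨ G.Adj x y)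
    | .inr y, .inl x => x ∈ A ∪ {u, v} ∧ y ∈ B ∧ (x = y ∨ G.Adj x y)
    | _, _ => False
  symm := ⟨by rintro (x | x) (y | y) h <;> exact h⟩
  loopless := ⟨by rintro (x | x) h <;> exact h⟩

variable {G : SimpleGraph V} {A B : Finset V} {u v : V}

theorem splitGraph_adj {x y : V} : (splitGraph G A B u v).Adj (.inl x) (.inr y) ↔
    x ∈ A ∪ {u, v} ∧ y ∈ B ∧ (x = y ∨ G.Adj x y) := Iff.rfl

theorem isBipartiteWith_splitGraph : (splitGraph G A B u v).IsBipartiteWith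
    (((A ∪ {u, v}).map Function.Embedding.inl : Finset (V ⊕ V)) : Set (V ⊕ V))
    ((B.map Function.Embedding.inr : Finset (V ⊕ V)) : Set (V ⊕ V)) where
  disjoint := by
    rw [Set.disjoint_left]
    rintro (x | x) <;> simp
  mem_of_adj := by
    rintro (x | x) (y | y) h
    · exact h.elim
    · have := splitGraph_adj.1 h
      left
      simpa using And.intro (by simpa using this.1) this.2.1
    · have := splitGraph_adj.1 h.symm
      right
      simpa using And.intro this.2.1 (by simpa using this.1)
    · exact h.elim

/-- A path in the split graph between the copies of `u` and `v` projects to a path from `u`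
to `v`. -/
theorem exists_isPathList_of_splitGraph (hdisj : Disjoint A B) (huv : u ≠ v)
    (hu : u ∈ A ∪ B) (hv : v ∈ A ∪ B) (hB : ∀ x ∈ B, ∀ y ∈ B, ¬G.Adj x y)
    {P : List (V ⊕ V)} (hP : IsPathList (splitGraph G A B u v) (.inl u) (.inl v) P) :
    ∃ L, IsPathList G u v L ∧ ∀ b, Sum.inr b ∈ P → b ∈ L := by
  have hAB := @Finset.disjoint_left _ A B |>.1 hdisj
  obtain ⟨T, rfl⟩ : ∃ T, P = .inl u :: T := List.head?_eq_some_iff.1 hP.head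
  have hT : T ≠ [] := by
    rintro rfl
    have := hP.last
    simp [huv] at this
  obtain ⟨M, rfl⟩ : ∃ M, T = M ++ [.inl v] := by
    refine List.getLast?_eq_some_iff.1 ?_
    rw [← hP.last]
    exact (List.getLast?_cons_of_ne_nil hT).symm
  have hM : M ≠ [] := by
    rintro rfl
    have := hP.chain
    simp only [List.nil_append, List.isChain_cons_cons] at this
    exact this.1
  have hchain := hP.chain
  have hnodup := hP.nodup
  rw [← List.cons_append, List.isChain_append] at hchain
  obtain ⟨hc₁, -, hc₂⟩ := hchain
  obtain ⟨p, hp⟩ : ∃ p, M.head? = some p := ⟨_, List.head?_eq_some_head hM⟩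
  obtain ⟨q, hq⟩ : ∃ q, M.getLast? = some q := ⟨_, List.getLast?_eq_some_getLast hM⟩
  rw [List.isChain_cons] at hc₁
  have hadj₁ := hc₁.1 p hp
  have hadj₂ := hc₂ q (by rw [List.getLast?_cons_of_ne_nil hM]; exact hq) (.inl v) rfl
  have hMc := hc₁.2
  have hMn : M.Nodup := (List.nodup_append'.1 (List.nodup_cons.1 hnodup).2).1
  have huM : Sum.inl u ∉ M := fun h => (List.nodup_cons.1 hnodup).1 (List.mem_append_left _ h)
  have hvM : Sum.inl v ∉ M := fun h =>
    (List.nodup_append'.1 (List.nodup_cons.1 hnodup).2).2.2 h (List.mem_singleton_self _)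
  have hMB : ∀ y, Sum.inr y ∈ M → y ∈ B := by
    intro y hy
    obtain ⟨i, hi, h⟩ := List.getElem_of_mem
      (List.mem_cons_of_mem (Sum.inl u) (List.mem_append_left [Sum.inl v] hy))
    have := hP.getElem_mem isBipartiteWith_splitGraph (by simp) i hi
    rw [h] at this
    simpa using (Nat.even_or_odd i).imp this.1 this.2
  have hMA : ∀ x, Sum.inl x ∈ M → x ∈ A := by
    intro x hx
    obtain ⟨i, hi, h⟩ := List.getElem_of_mem
      (List.mem_cons_of_mem (Sum.inl u) (List.mem_append_left [Sum.inl v] hx))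
    have := hP.getElem_mem isBipartiteWith_splitGraph (by simp) i hi
    rw [h] at this
    have h' : x = u ∨ x = v ∨ x ∈ A := by
      simpa using (Nat.even_or_odd i).imp this.1 this.2
    rcases h' with rfl | rfl | h'
    · exact absurd hx huM
    · exact absurd hx hvM
    · exact h'
  set π : V ⊕ V → V := Sum.elim id id
  have hL : IsPathList G (π p) (π q) (M.map π) := by
    refine ⟨?_, ?_, by simp [hp], by simp [hq]⟩
    · rw [List.isChain_map]
      refine hMc.imp_of_mem_imp ?_
      have key : ∀ x y, Sum.inl x ∈ M → (splitGraph G A B u v).Adj (.inl x) (.inr y) →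
          G.Adj x y := by
        intro x y hx h
        obtain ⟨-, hy, h⟩ := splitGraph_adj.1 h
        exact h.resolve_left fun h' => hAB (hMA x hx) (h' ▸ hy)
      rintro (x | x) (y | y) hx hy h
      · exact h.elim
      · exact key x y hx h
      · exact (key y x hy h.symm).symm
      · exact h.elim
    · refine List.Nodup.map_on ?_ hMn
      rintro (x | x) hx (y | y) hy (h : x = y)
      · rw [h]
      · exact absurd (h ▸ hMB y hy) (hAB (hMA x hx))
      · exact absurd (h ▸ hMB x hx) (hAB (hMA y hy))
      · rw [h]
  have hend : ∀ w p, w ∈ A ∪ B → Sum.inl w ∉ M → (splitGraph G A B u v).Adj (.inl w) p →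
      w = π p ∨ G.Adj w (π p) ∧ w ∉ M.map π := by
    rintro w (p | p) hw hwM hadj
    · exact hadj.elim
    · obtain ⟨-, hp, h⟩ := splitGraph_adj.1 hadj
      refine h.imp id fun h => ⟨h, fun hmem => ?_⟩
      have hwA : w ∈ A := (mem_union.1 hw).resolve_right fun hwB => hB w hwB p hp h
      obtain ⟨x | x, hx, hxw⟩ := List.mem_map.1 hmem
      · exact hwM ((show x = w from hxw) ▸ hx)
      · exact hAB hwA ((show x = w from hxw) ▸ hMB x hx)
  obtain ⟨L₁, hL₁, hML₁, hL₁M⟩ := hL.exists_cons (hend u p hu huM hadj₁)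
  obtain ⟨L₂, hL₂, hL₁₂, -⟩ := hL₁.reverse.exists_cons (s := v) <| by
    refine (hend v q hv hvM hadj₂.symm).imp id (And.imp_right fun h h' => ?_)
    rcases List.mem_cons.1 (hL₁M (List.mem_reverse.1 h')) with h' | h'
    · exact huv h'.symm
    · exact h h'
  refine ⟨L₂.reverse, hL₂.reverse, fun b hb => ?_⟩
  have hbM : Sum.inr b ∈ M := by simpa using hb
  exact List.mem_reverse.2 (hL₁₂ (List.mem_reverse.2 (hML₁ (List.mem_map_of_mem (f := π) hbM))))

end Split

theorem IsPathList.exists_walk (hP : IsPathList H s e P) :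
    ∃ w : H.Walk s e, w.IsPath ∧ w.support = P := by
  obtain ⟨hc, hn, hs, he⟩ := hP
  have h0 : P ≠ [] := by
    rintro rfl
    simp at hs
  obtain rfl : P.head h0 = s := by simpa [List.head?_eq_some_head h0] using hs
  obtain rfl : P.getLast h0 = e := by simpa [List.getLast?_eq_some_getLast h0] using he
  have h := SimpleGraph.Walk.support_ofSupport h0 hc
  exact ⟨.ofSupport P h0 hc, .mk' (by rwa [h]), h⟩

theorem card_nbrs_eq_deg [Fintype W] (H : SimpleGraph W) (z : W) : #(nbrs H z) = deg H z := by
  classical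
  rw [deg, ← SimpleGraph.card_neighborFinset_eq_degree]
  congr 1
  ext w
  simp [mem_nbrs]

theorem stmt10 (V : Type) [Fintype V] [DecidableEq V] (G : SimpleGraph V)
    (A B : Finset V) (k : ℕ) (hk : 2 ≤ k)
    (hdisj : Disjoint A B) (hunion : A ∪ B = Finset.univ)
    (hA : ∀ u ∈ A, ∀ v ∈ A, ¬G.Adj u v) (hB : ∀ u ∈ B, ∀ v ∈ B, ¬G.Adj u v)
    (hdeg : ∀ v : V, k ≤ deg G v)
    (hcard : B.card < min A.card (2 * k - 2)) :
    ∀ u v : V, u ≠ v → ∃ w : G.Walk u v, w.IsPath ∧ ∀ b ∈ B, b ∈ w.support := by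
  intro u v huv
  have hmem : ∀ x, x ∈ A ∪ B := fun x => hunion ▸ mem_univ x
  have hnA : ∀ x ∈ A, nbrs G x ⊆ B := fun x hx y hy =>
    (mem_union.1 (hmem y)).resolve_left fun hyA => hA x hx y hyA (mem_nbrs.1 hy)
  have hnB : ∀ x ∈ B, nbrs G x ⊆ A := fun x hx y hy =>
    (mem_union.1 (hmem y)).resolve_right fun hyB => hB x hx y hyB (mem_nbrs.1 hy)
  have hdeg' : ∀ x, k ≤ #(nbrs G x) := fun x => card_nbrs_eq_deg G x ▸ hdeg x
  obtain ⟨hBA, hBk⟩ := lt_min_iff.1 hcard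
  set S := splitGraph G A B u v
  have hS : S.IsBipartiteWith _ _ := isBipartiteWith_splitGraph
  have hrep : ∀ x z, (x ∈ B → x ≠ z) → ∃ y ∈ B, y ≠ z ∧ (x = y ∨ G.Adj x y) := by
    intro x z hxz
    rcases mem_union.1 (hmem x) with hx | hx
    · obtain ⟨y, hy, hyz⟩ := exists_mem_ne (show 1 < #(nbrs G x) from hk.trans (hdeg' x)) z
      exact ⟨y, hnA x hx hy, hyz, .inr (mem_nbrs.1 hy)⟩
    · exact ⟨x, hx, hxz hx, .inl rfl⟩
  obtain ⟨b₁, hb₁, hb₁v, hub₁⟩ := hrep u v fun _ => huv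
  obtain ⟨b₃, hb₃, hb₃₁, hvb₃⟩ := hrep v b₁ fun _ => hb₁v.symm
  have hs : (Sum.inl u : V ⊕ V) ∈ (A ∪ {u, v}).map Function.Embedding.inl := by simp
  have he : (Sum.inl v : V ⊕ V) ∈ (A ∪ {u, v}).map Function.Embedding.inl := by simp
  have hse : (Sum.inl u : V ⊕ V) ≠ .inl v := by simpa using huv
  have hdA : ∀ x ∈ (A ∪ {u, v}).map (Function.Embedding.inl (β := V)),
      x ≠ Sum.inl u → x ≠ Sum.inl v → k ≤ #(nbrs S x) := by
    rintro (x | x) hx hxu hxv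
    · have hxA : x ∈ A := by
        simp only [ne_eq, Sum.inl.injEq] at hxu hxv
        simpa [hxu, hxv] using hx
      refine ((hdeg' x).trans_eq (card_map Function.Embedding.inr).symm).trans
        (card_le_card fun y hy => ?_)
      obtain ⟨z, hz, rfl⟩ := mem_map.1 hy
      exact mem_nbrs.2 (splitGraph_adj.2 ⟨mem_union_left _ hxA, hnA x hxA hz,
        .inr (mem_nbrs.1 hz)⟩)
    · simp at hx
  have hdB : ∀ y ∈ B.map Function.Embedding.inr, k ≤ #(nbrs S y) := by
    intro y' hy'
    obtain ⟨y, hy, rfl⟩ := mem_map.1 hy'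
    refine ((hdeg' y).trans_eq (card_map Function.Embedding.inl).symm).trans
      (card_le_card fun x' hx' => ?_)
    obtain ⟨x, hx, rfl⟩ := mem_map.1 hx'
    exact mem_nbrs.2 (splitGraph_adj.2 ⟨mem_union_left _ (hnB y hy hx), hy,
      .inr (mem_nbrs.1 hx).symm⟩).symm
  have hBk' : #(B.map (Function.Embedding.inr (α := V))) + 3 ≤ 2 * k := by
    rw [card_map]
    omega
  have hBA' : #(B.map (Function.Embedding.inr (α := V))) <
      #((A ∪ {u, v}).map (Function.Embedding.inl (β := V))) := by
    rw [card_map, card_map]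
    exact hBA.trans_le (card_le_card subset_union_left)
  obtain ⟨P₀, hP₀, hP₀7⟩ := IsPathList.exists_seven_le_length hS hs he hse hdA hdB hBk' hBA'
    (b₁ := .inr b₁) (b₃ := .inr b₃) (by simpa using hb₃₁.symm)
    (splitGraph_adj.2 ⟨by simp, hb₁, hub₁⟩) (splitGraph_adj.2 ⟨by simp, hb₃, hvb₃⟩)
  obtain ⟨P, hP, hmax⟩ := exists_longest_list
    (p := IsPathList S (.inl u) (.inl v)) (fun _ h => h.nodup) ⟨P₀, hP₀⟩
  obtain ⟨L, hL, hPL⟩ := exists_isPathList_of_splitGraph hdisj huv (hmem u) (hmem v) hB hP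
  obtain ⟨w, hw, rfl⟩ := hL.exists_walk
  exact ⟨w, hw, fun b hb => hPL b (IsPathList.mem_of_longest hS hs he hdA hdB hBk' hBA' hP hmax
    (hP₀7.trans (hmax P₀ hP₀)) (by simpa using hb))⟩
end

section
/- There exist a constant Δ₀ ∈ ℕ and a constant c > 0 such that for every Δ ≥ Δ₀ there is a threshold N₀ = N₀(Δ) ≥ 5Δ·log Δ with the property: for every integer n > N₀, every bipartite graph G with parts A and B of size n in which every vertex of A has degree at most Δ contains a bi-hole of size at least (1/2)·(log Δ/Δ)·n. -/
/-- In a bipartite graph with parts `Fin n` and `Fin n` and edge set `E`,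
`BiHole E S T` says that there is no edge between `S` and `T`. -/
def BiHole {n : ℕ} (E : Finset (Fin n × Fin n)) (S T : Finset (Fin n)) : Prop :=
  ∀ s ∈ S, ∀ t ∈ T, (s, t) ∉ E

/-- If every vertex of the first part has degree at most `Δ`, then among the vertices outside `T`
some vertex has at most `Δ * |S| / (n - |T|)` neighbours in `S`. -/
lemma exists_notMem_card_neighbors_le {n Δ : ℕ} {E : Finset (Fin n × Fin n)}
    (hE : ∀ a : Fin n, (E.filter (fun p => p.1 = a)).card ≤ Δ)
    (S T : Finset (Fin n)) (hT : T.card < n) :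
    ∃ b ∉ T, ((S.filter (fun s => (s, b) ∈ E)).card : ℝ) ≤ Δ * S.card / (n - T.card) := by
  have hcard : (Tᶜ.card : ℝ) = n - T.card := by
    rw [Finset.card_compl, Fintype.card_fin, Nat.cast_sub hT.le]
  have hpos : (0 : ℝ) < n - T.card := sub_pos.2 (by exact_mod_cast hT)
  have hne : Tᶜ.Nonempty := by
    rw [← Finset.card_pos]
    exact_mod_cast hcard ▸ hpos
  have hdeg : ∀ a : Fin n, (Tᶜ.filter (fun b => (a, b) ∈ E)).card ≤ Δ := fun a => by
    refine (Finset.card_le_card_of_injOn (fun b => (a, b)) ?_ ?_).trans (hE a)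
    · intro b hb
      simpa using (Finset.mem_filter.1 hb).2
    · intro b _ b' _ h
      exact (Prod.mk.inj h).2
  have hsum : ∑ b ∈ Tᶜ, (S.filter (fun s => (s, b) ∈ E)).card ≤ S.card * Δ := by
    have := Finset.sum_card_bipartiteAbove_eq_sum_card_bipartiteBelow
      (s := S) (t := Tᶜ) (fun a b => (a, b) ∈ E)
    simp only [Finset.bipartiteAbove, Finset.bipartiteBelow] at this
    rw [← this, ← smul_eq_mul]
    exact Finset.sum_le_card_nsmul _ _ _ fun a _ => hdeg a
  obtain ⟨b, hb, h⟩ := Finset.exists_le_of_sum_le (s := Tᶜ)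
    (f := fun b => ((S.filter (fun s => (s, b) ∈ E)).card : ℝ))
    (g := fun _ => (Δ : ℝ) * S.card / (n - T.card)) hne (by
      rw [Finset.sum_const, nsmul_eq_mul, hcard, mul_div_cancel₀ _ hpos.ne', mul_comm]
      exact_mod_cast hsum)
  exact ⟨b, Finset.mem_compl.1 hb, h⟩

/-- Greedily adding vertices of small degree to `T` keeps many common non-neighbours. -/
lemma exists_biHole_card_ge {n Δ k : ℕ} {E : Finset (Fin n × Fin n)}
    (hE : ∀ a : Fin n, (E.filter (fun p => p.1 = a)).card ≤ Δ)
    (hk : k < n) (hΔ : (Δ : ℝ) ≤ n - k) {i : ℕ} (hi : i ≤ k) :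
    ∃ S T : Finset (Fin n), T.card = i ∧ BiHole E S T ∧
      (n : ℝ) * (1 - Δ / (n - k)) ^ i ≤ S.card := by
  have hpos : (0 : ℝ) < n - k := sub_pos.2 (by exact_mod_cast hk)
  induction i with
  | zero => exact ⟨Finset.univ, ∅, by simp [BiHole]⟩
  | succ i ih =>
    obtain ⟨S, T, hT, hST, hS⟩ := ih (by omega)
    obtain ⟨b, hbT, hb⟩ := exists_notMem_card_neighbors_le hE S T (by omega)
    refine ⟨S.filter (fun s => (s, b) ∉ E), insert b T, ?_, ?_, ?_⟩
    · rw [Finset.card_insert_of_notMem hbT, hT]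
    · intro s hs t ht
      rw [Finset.mem_filter] at hs
      rcases Finset.mem_insert.1 ht with rfl | ht
      · exact hs.2
      · exact hST s hs.1 t ht
    · have hsplit : ((S.filter (fun s => (s, b) ∈ E)).card : ℝ)
          + (S.filter (fun s => (s, b) ∉ E)).card = S.card := by
        exact_mod_cast Finset.card_filter_add_card_filter_not (s := S) (fun s => (s, b) ∈ E)
      have hik : (n : ℝ) - k ≤ n - T.card := by
        have : (T.card : ℝ) ≤ k := by exact_mod_cast (by omega : T.card ≤ k)
        linarith
      have hle : (Δ : ℝ) * S.card / (n - T.card) ≤ Δ * S.card / (n - k) := by gcongr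
      have hx : 0 ≤ 1 - (Δ : ℝ) / (n - k) := sub_nonneg.2 ((div_le_one hpos).2 hΔ)
      calc (n : ℝ) * (1 - Δ / (n - k)) ^ (i + 1)
          = n * (1 - Δ / (n - k)) ^ i * (1 - Δ / (n - k)) := by ring
        _ ≤ S.card * (1 - Δ / (n - k)) := by gcongr
        _ = S.card - Δ * S.card / (n - k) := by ring
        _ ≤ (S.filter (fun s => (s, b) ∉ E)).card := by linarith

lemma exp_neg_div_sub_le_one_sub_div {d m : ℝ} (hd : d < m) (hm : 0 < m) :
    Real.exp (-(d / (m - d))) ≤ 1 - d / m := by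
  have h : 0 < m - d := sub_pos.2 hd
  have h1 : 1 - d / m = (d / (m - d) + 1)⁻¹ := by
    rw [div_add_one h.ne', add_sub_cancel, inv_div, sub_div, div_self hm.ne']
  rw [h1, Real.exp_neg]
  have h2 : 0 < d / (m - d) + 1 := by
    rw [div_add_one h.ne', add_sub_cancel]
    positivity
  exact inv_anti₀ h2 (Real.add_one_le_exp _)

theorem stmt12 :
    ∃ (Δ₀ : ℕ) (c : ℝ), 0 < c ∧ ∀ Δ : ℕ, Δ₀ ≤ Δ →
      ∃ N₀ : ℝ, 5 * (Δ : ℝ) * Real.log Δ ≤ N₀ ∧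
        ∀ n : ℕ, N₀ < (n : ℝ) →
          ∀ E : Finset (Fin n × Fin n),
            (∀ a : Fin n, (E.filter (fun p => p.1 = a)).card ≤ Δ) →
            ∃ (k : ℕ) (S T : Finset (Fin n)), S.card = k ∧ T.card = k ∧ BiHole E S T ∧
              (1 / 2 : ℝ) * (Real.log Δ / Δ) * n ≤ (k : ℝ) := by
  refine ⟨⌈Real.exp 30⌉₊, 1, one_pos, fun Δ hΔ₀ => ⟨5 * Δ * Real.log Δ, le_rfl, ?_⟩⟩
  intro n hn E hE
  have hexp : Real.exp 30 ≤ Δ := Nat.ceil_le.1 hΔ₀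
  have hΔ : (0 : ℝ) < Δ := (Real.exp_pos _).trans_le hexp
  have hL : 30 ≤ Real.log Δ := (Real.le_log_iff_exp_le hΔ).2 hexp
  have hΔL : (Δ : ℝ) = Real.exp (Real.log Δ) := (Real.exp_log hΔ).symm
  set L := Real.log Δ
  have hnΔ : 150 * (Δ : ℝ) ≤ n := by nlinarith
  have hn0 : (0 : ℝ) < n := by linarith
  have hratio : L / Δ ≤ Real.exp (-(3 / 4 * L)) := by
    rw [div_le_iff₀ hΔ, hΔL, ← Real.exp_add]
    have := Real.quadratic_le_exp_of_nonneg (x := L / 4) (by linarith)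
    rw [show -(3 / 4 * L) + L = L / 4 by ring]
    nlinarith
  have hsmall : Real.exp (-(3 / 4 * L)) ≤ 1 / 20 := by
    rw [Real.exp_neg, one_div]
    exact inv_anti₀ (by norm_num) (by linarith [Real.add_one_le_exp (3 / 4 * L)])
  set k := ⌈(1 / 2 : ℝ) * (L / Δ) * n⌉₊
  have hk_lower : (1 / 2 : ℝ) * (L / Δ) * n ≤ k := Nat.le_ceil _
  have hk_upper : (k : ℝ) < 1 / 2 * (L / Δ) * n + 1 := Nat.ceil_lt_add_one (by positivity)
  have hone : 1 ≤ 1 / 2 * (L / Δ) * n := by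
    rw [show 1 / 2 * (L / Δ) * n = L * n / (2 * Δ) by field_simp, le_div_iff₀ (by positivity)]
    nlinarith
  have hk_exp : (k : ℝ) ≤ n * Real.exp (-(3 / 4 * L)) := by
    have := mul_le_mul_of_nonneg_right hratio hn0.le
    linarith
  have hk20 : (k : ℝ) ≤ n / 20 := by nlinarith
  have hkn : k < n := by
    have : (k : ℝ) < n := by linarith
    exact_mod_cast this
  obtain ⟨S, T, hT, hST, hS⟩ := exists_biHole_card_ge hE hkn (by linarith) le_rfl
  have hkΔ : k * (Δ : ℝ) ≤ L * n / 2 + Δ := by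
    calc k * (Δ : ℝ) ≤ (1 / 2 * (L / Δ) * n + 1) * Δ := by gcongr
      _ = L * n / 2 + Δ := by field_simp
  have hexponent : k * ((Δ : ℝ) / (n - k - Δ)) ≤ 3 / 4 * L := by
    rw [← mul_div_assoc, div_le_iff₀ (by linarith)]
    have : L * (9 / 10 * n) ≤ L * (n - k - Δ) := by
      gcongr
      linarith
    nlinarith
  have hkS : k ≤ S.card := by
    have h : (k : ℝ) ≤ S.card := by
      calc (k : ℝ) ≤ n * Real.exp (-(3 / 4 * L)) := hk_exp
        _ ≤ n * Real.exp (k * -((Δ : ℝ) / (n - k - Δ))) := by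
          gcongr
          linarith
        _ = n * Real.exp (-((Δ : ℝ) / (n - k - Δ))) ^ k := by rw [← Real.exp_nat_mul]
        _ ≤ n * (1 - Δ / (n - k)) ^ k := by
          gcongr
          exact exp_neg_div_sub_le_one_sub_div (by linarith) (by linarith)
        _ ≤ S.card := hS
    exact_mod_cast h
  obtain ⟨S', hS'S, hS'⟩ := Finset.exists_subset_card_eq hkS
  exact ⟨k, S', T, hS', hT, fun s hs t ht => hST s (hS'S hs) t ht, hk_lower⟩
end

section
/- For every Δ ≥ 27 and every integer n ≥ Δ/log Δ, there exists a bipartite graph G with parts A and B of size n in which every vertex of A has degree at most Δ and whose largest bi-hole has size at most 8·(log Δ/Δ)·n; that is, f(n, Δ) ≤ 8·(log Δ/Δ)·n. -/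
open Finset in
/-- The number of functions assigning to each vertex `s` a list of `d` vertices, such that all
lists of vertices in `S` avoid `T`. -/
lemma card_piFinset_avoiding {n d k : ℕ} (S T : Finset (Fin n)) (hS : S.card = k)
    (hT : T.card = k) :
    (Fintype.piFinset fun s : Fin n =>
      if s ∈ S then Fintype.piFinset (fun _ : Fin d => Tᶜ) else univ).card =
      ((n - k) ^ d) ^ k * (n ^ d) ^ (n - k) := by
  have h (s : Fin n) :
      (if s ∈ S then Fintype.piFinset (fun _ : Fin d => Tᶜ) else univ).card =
        if s ∈ S then (n - k) ^ d else n ^ d := by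
    split_ifs <;> simp [card_compl, hT]
  rw [Fintype.card_piFinset, prod_congr rfl fun s _ => h s, prod_ite]
  simp only [prod_const, filter_mem_eq_inter, univ_inter, hS]
  congr 2
  rw [filter_not, filter_mem_eq_inter, univ_inter, ← compl_eq_univ_sdiff, card_compl, hS,
    Fintype.card_fin]

open Finset in
/-- Union bound: if the expected number of bi-holes of size `k` is less than one, some choice of
`d` neighbours for each vertex leaves no bi-hole of size `k`. -/
lemma exists_neighbours_meeting {n d k : ℕ}
    (h : n.choose k * n.choose k * (((n - k) ^ d) ^ k * (n ^ d) ^ (n - k)) < (n ^ d) ^ n) :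
    ∃ f : Fin n → Fin d → Fin n, ∀ S T : Finset (Fin n), S.card = k → T.card = k →
      ∃ s ∈ S, ∃ i, f s i ∈ T := by
  by_contra! hbad
  let P := powersetCard k (univ : Finset (Fin n)) ×ˢ powersetCard k (univ : Finset (Fin n))
  have hcover : (univ : Finset (Fin n → Fin d → Fin n)) ⊆
      P.biUnion fun p => Fintype.piFinset fun s : Fin n =>
        if s ∈ p.1 then Fintype.piFinset (fun _ : Fin d => p.2ᶜ) else univ := by
    intro f _
    obtain ⟨S, T, hS, hT, hf⟩ := hbad f
    rw [mem_biUnion]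
    refine ⟨(S, T), by simp [P, hS, hT], ?_⟩
    rw [Fintype.mem_piFinset]
    intro s
    split_ifs with hs
    · simpa using hf s hs
    · exact mem_univ _
  have hcard := (card_le_card hcover).trans
    (card_biUnion_le_card_mul P _ (((n - k) ^ d) ^ k * (n ^ d) ^ (n - k)) fun p hp => by
      simp only [P, mem_product, mem_powersetCard_univ] at hp
      exact (card_piFinset_avoiding p.1 p.2 hp.1 hp.2).le)
  simp only [P, card_product, card_powersetCard, card_univ, Fintype.card_fun,
    Fintype.card_fin] at hcard
  exact absurd h hcard.not_gt

lemma choose_le_exp_mul_div_pow {n k : ℕ} (hk : 0 < k) :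
    (n.choose k : ℝ) ≤ (Real.exp 1 * (n / k)) ^ k := by
  have hk' : (0 : ℝ) < k := by exact_mod_cast hk
  have hfac : (0 : ℝ) < k.factorial := by exact_mod_cast k.factorial_pos
  have hexp := Real.pow_div_factorial_le_exp (k : ℝ) hk'.le k
  calc (n.choose k : ℝ) ≤ (n : ℝ) ^ k / k.factorial := Nat.choose_le_pow_div k n
    _ = (k : ℝ) ^ k / k.factorial * (n / k) ^ k := by
      rw [div_pow]; field_simp
    _ ≤ Real.exp k * (n / k) ^ k := by gcongr
    _ = _ := by rw [mul_pow, ← Real.exp_nat_mul, mul_one]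

/-- The expected number of bi-holes of size `k` is less than one once `k > 8 (log d / d) n`. -/
lemma choose_mul_choose_mul_lt {n d k : ℕ} (hd : 27 ≤ d) (hk : 0 < k) (hkn : k ≤ n)
    (hlarge : 8 * (Real.log d / d) * n < k) :
    n.choose k * n.choose k * (((n - k) ^ d) ^ k * (n ^ d) ^ (n - k)) < (n ^ d) ^ n := by
  have hk' : (0 : ℝ) < k := by exact_mod_cast hk
  have hn' : (0 : ℝ) < n := by exact_mod_cast hk.trans_le hkn
  have hd' : (27 : ℝ) ≤ d := by exact_mod_cast hd
  have hd0 : (0 : ℝ) < d := by linarith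
  have hlog : 1 ≤ Real.log d := by
    rw [Real.le_log_iff_exp_le hd0]
    linarith [Real.exp_one_lt_d9]
  have hratio : 8 * Real.log d < k / n * d := by
    have : 8 * (Real.log d / d) < k / n := (lt_div_iff₀ hn').2 hlarge
    calc 8 * Real.log d = 8 * (Real.log d / d) * d := by field_simp
      _ < _ := by gcongr
  have hinv : (n : ℝ) / k ≤ d / 8 := by
    rw [div_le_div_iff₀ hk' (by norm_num)]
    have : (8 : ℝ) < k / n * d := by linarith
    rw [div_mul_eq_mul_div, lt_div_iff₀ hn'] at this
    linarith
  have hexp : Real.exp (-(k / n * d)) ≤ ((d : ℝ) ^ 8)⁻¹ := by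
    rw [Real.exp_neg]
    gcongr
    calc (d : ℝ) ^ 8 = Real.exp (8 * Real.log d) := by
          rw [← Real.exp_log hd0, ← Real.exp_nat_mul, Real.exp_log hd0]; norm_num
      _ ≤ _ := Real.exp_le_exp.2 hratio.le
  have hbase : (Real.exp 1 * (n / k)) ^ 2 * Real.exp (-(k / n * d)) < 1 := by
    calc (Real.exp 1 * (n / k)) ^ 2 * Real.exp (-(k / n * d))
        ≤ (8 * (d / 8)) ^ 2 * ((d : ℝ) ^ 8)⁻¹ := by
          gcongr
          linarith [Real.exp_one_lt_d9]
      _ = ((d : ℝ) ^ 6)⁻¹ := by field_simp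
      _ < 1 := inv_lt_one_of_one_lt₀ (one_lt_pow₀ (by linarith) (by norm_num))
  have hsub : ((n - k : ℕ) : ℝ) ≤ n * Real.exp (-(k / n)) := by
    rw [Nat.cast_sub hkn]
    calc (n : ℝ) - k = n * (-(k / n) + 1) := by field_simp; ring
      _ ≤ _ := by gcongr; exact Real.add_one_le_exp _
  have hpow : (((n - k : ℕ) : ℝ) ^ d) ^ k ≤
      ((n : ℝ) ^ d) ^ k * Real.exp (-(k / n * d)) ^ k := by
    rw [← mul_pow]
    gcongr
    calc ((n - k : ℕ) : ℝ) ^ d ≤ (n * Real.exp (-(k / n))) ^ d := by gcongr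
      _ = _ := by rw [mul_pow, ← Real.exp_nat_mul]; ring_nf
  have hchoose := choose_le_exp_mul_div_pow (n := n) hk
  have key : (n.choose k : ℝ) * n.choose k *
      ((((n - k : ℕ) : ℝ) ^ d) ^ k * ((n : ℝ) ^ d) ^ (n - k)) < ((n : ℝ) ^ d) ^ n := by
    calc _ ≤ (Real.exp 1 * (n / k)) ^ k * (Real.exp 1 * (n / k)) ^ k *
          ((((n : ℝ) ^ d) ^ k * Real.exp (-(k / n * d)) ^ k) * ((n : ℝ) ^ d) ^ (n - k)) := by
          gcongr
      _ = ((Real.exp 1 * (n / k)) ^ 2 * Real.exp (-(k / n * d))) ^ k *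
          (((n : ℝ) ^ d) ^ k * ((n : ℝ) ^ d) ^ (n - k)) := by
          rw [mul_pow _ (Real.exp _) k, sq, mul_pow (_ * _) (_ * _) k]; ring
      _ = ((Real.exp 1 * (n / k)) ^ 2 * Real.exp (-(k / n * d))) ^ k * ((n : ℝ) ^ d) ^ n := by
          rw [← pow_add, Nat.add_sub_cancel' hkn]
      _ < 1 * ((n : ℝ) ^ d) ^ n := by
          gcongr
          exact pow_lt_one₀ (by positivity) hbase hk.ne'
      _ = _ := one_mul _
  exact_mod_cast key

theorem stmt13 :
    ∀ Δ : ℕ, 27 ≤ Δ → ∀ n : ℕ, (Δ : ℝ) / Real.log Δ ≤ (n : ℝ) →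
      ∃ E : Finset (Fin n × Fin n),
        (∀ a : Fin n, (E.filter (fun p => p.1 = a)).card ≤ Δ) ∧
        ∀ (k : ℕ) (S T : Finset (Fin n)), S.card = k → T.card = k → BiHole E S T →
          (k : ℝ) ≤ 8 * (Real.log Δ / Δ) * n := by
  intro Δ hΔ n _
  set x : ℝ := 8 * (Real.log Δ / Δ) * n
  have hx0 : 0 ≤ x := by positivity
  have hfloor : x < (⌊x⌋₊ + 1 : ℕ) := by exact_mod_cast Nat.lt_floor_add_one x
  by_cases hkn : ⌊x⌋₊ + 1 ≤ n
  · obtain ⟨f, hf⟩ := exists_neighbours_meeting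
      (choose_mul_choose_mul_lt hΔ (Nat.succ_pos _) hkn hfloor)
    refine ⟨Finset.univ.image fun p : Fin n × Fin Δ => (p.1, f p.1 p.2), fun a => ?_, ?_⟩
    · calc _ ≤ (Finset.univ.image fun i : Fin Δ => (a, f a i)).card := by
            refine Finset.card_le_card fun p hp => ?_
            simp only [Finset.mem_filter, Finset.mem_image, Finset.mem_univ, true_and] at hp ⊢
            obtain ⟨⟨q, rfl⟩, rfl⟩ := hp
            exact ⟨q.2, rfl⟩
        _ ≤ Δ := Finset.card_image_le.trans (by simp)
    · intro k S T hS hT hhole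
      by_contra! hlt
      have hk : ⌊x⌋₊ + 1 ≤ k := (Nat.floor_lt hx0).2 hlt
      obtain ⟨S', hSS, hS'⟩ := Finset.exists_subset_card_eq (hk.trans_eq hS.symm)
      obtain ⟨T', hTT, hT'⟩ := Finset.exists_subset_card_eq (hk.trans_eq hT.symm)
      obtain ⟨s, hs, i, hi⟩ := hf S' T' hS' hT'
      exact hhole s (hSS hs) _ (hTT hi)
        (Finset.mem_image.2 ⟨(s, i), Finset.mem_univ _, rfl⟩)
  · refine ⟨∅, by simp, fun k S T hS _ _ => ?_⟩
    have hk : k ≤ n := by simpa [hS] using Finset.card_le_univ S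
    exact (Nat.cast_le.2 (by omega : k ≤ ⌊x⌋₊)).trans (Nat.floor_le hx0)
end

section
/- Let D = (d₀, …, d_{n−1}) and D' = (d₀', …, d_{n−1}') be two non-increasing graphic degree sequences with D ⊲ D'. Then there exist graphic degree sequences D₁, …, D_k such that D ⊲ D₁ ⊲ ⋯ ⊲ D_k ⊲ D', and each consecutive pair of sequences in this chain differs in exactly two entries, each by exactly 1 (one entry increased by 1 and another decreased by 1). -/
/-- A sequence of naturals (indexed by `Fin n`) is graphic if it is the degree
sequence of some simple graph. -/
def Graphic {n : ℕ} (d : Fin n → ℕ) : Prop :=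
  ∃ G : SimpleGraph (Fin n), ∀ i, deg G i = d i

/-- Dominance (majorization) order `d ⊲ d'` on non-increasing sequences with equal
sums: every initial partial sum of `d` is at most that of `d'`, and `d ≠ d'`. -/
def DomLT {n : ℕ} (d d' : Fin n → ℕ) : Prop :=
  (∑ i, d i = ∑ i, d' i) ∧
  (∀ l : Fin n, ∑ i ∈ Finset.Iic l, d i ≤ ∑ i ∈ Finset.Iic l, d' i) ∧ d ≠ d'

/-- `b` differs from `a` in exactly two entries, one increased by 1 and one
decreased by 1. -/
def UnitStep {n : ℕ} (a b : Fin n → ℕ) : Prop :=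
  ∃ i j : Fin n, i ≠ j ∧ b i = a i + 1 ∧ a j = b j + 1 ∧
    ∀ t : Fin n, t ≠ i → t ≠ j → b t = a t

/-- Move one unit of `d` from position `i` to position `j`. -/
def transfer {n : ℕ} (d : Fin n → ℕ) (i j t : Fin n) : ℕ :=
  d t + (if t = j then 1 else 0) - (if t = i then 1 else 0)

theorem deg_eq_card {V : Type*} [Fintype V] (G : SimpleGraph V) (v : V) (s : Finset V)
    (h : ∀ x, x ∈ s ↔ G.Adj v x) : deg G v = s.card := by
  classical
  unfold deg
  rw [← SimpleGraph.card_neighborFinset_eq_degree]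
  congr 1
  ext x
  simp [h]

/-- Replacing an edge at `i` by an edge at `j` with the same other end `w`. -/
theorem Graphic.transfer {n : ℕ} {d : Fin n → ℕ} (hd : Graphic d) {i j : Fin n}
    (hij : d j < d i) : Graphic (transfer d i j) := by
  classical
  obtain ⟨G, hG⟩ := hd
  have hcard : ∀ v, (G.neighborFinset v).card = d v := fun v => by
    rw [← hG v]
    exact (deg_eq_card G v _ (by simp)).symm
  have hne : i ≠ j := by rintro rfl; exact lt_irrefl _ hij
  obtain ⟨w, hiw, hwj, hjw⟩ : ∃ w, G.Adj i w ∧ w ≠ j ∧ ¬ G.Adj j w := by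
    by_contra! hcon
    have hsub : (G.neighborFinset i).erase j ⊆ (G.neighborFinset j).erase i := by
      intro x hx
      simp only [Finset.mem_erase, SimpleGraph.mem_neighborFinset] at hx ⊢
      exact ⟨hx.2.ne', hcon x hx.2 hx.1⟩
    have hle := Finset.card_le_card hsub
    by_cases hadj : G.Adj i j
    · have hi := Finset.card_erase_add_one ((G.mem_neighborFinset i j).mpr hadj)
      have hj := Finset.card_erase_add_one ((G.mem_neighborFinset j i).mpr hadj.symm)
      rw [hcard] at hi hj
      omega
    · rw [Finset.erase_eq_of_notMem (by simpa), Finset.erase_eq_of_notMem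
        (by simpa [G.adj_comm j i]), hcard, hcard] at hle
      omega
  have hwi : w ≠ i := hiw.ne'
  let H : SimpleGraph (Fin n) :=
    { Adj := fun x y => (G.Adj x y ∧ ¬ (x = i ∧ y = w) ∧ ¬ (x = w ∧ y = i)) ∨
        (x = j ∧ y = w) ∨ (x = w ∧ y = j)
      symm := ⟨fun x y h => by
        rw [G.adj_comm y x]
        tauto⟩
      loopless := ⟨fun x h => by
        rcases h with h | ⟨h, h'⟩ | ⟨h, h'⟩
        · exact h.1.ne rfl
        · exact hwj (h'.symm.trans h)
        · exact hwj (h.symm.trans h')⟩ }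
  refine ⟨H, fun t => ?_⟩
  unfold _root_.transfer
  by_cases hti : t = i
  · subst hti
    rw [deg_eq_card H t ((G.neighborFinset t).erase w), Finset.card_erase_of_mem (by simpa), hcard]
    · simp [hne]
    · intro x
      simp only [Finset.mem_erase, SimpleGraph.mem_neighborFinset, H]
      grind
  by_cases htj : t = j
  · subst htj
    rw [deg_eq_card H t (insert w (G.neighborFinset t)),
      Finset.card_insert_of_notMem (by simpa), hcard]
    · simp [hti]
    · intro x
      simp only [Finset.mem_insert, SimpleGraph.mem_neighborFinset, H]
      grind
  by_cases htw : t = w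
  · subst htw
    rw [deg_eq_card H t (insert j ((G.neighborFinset t).erase i)),
      Finset.card_insert_of_notMem (by simp [G.adj_comm t j, hjw]),
      Finset.card_erase_add_one (by simpa using hiw.symm), hcard]
    · simp [hti, htj]
    · intro x
      simp only [Finset.mem_insert, Finset.mem_erase, SimpleGraph.mem_neighborFinset, H]
      grind
  · rw [deg_eq_card H t (G.neighborFinset t), hcard]
    · simp [hti, htj]
    · intro x
      simp only [SimpleGraph.mem_neighborFinset, H]
      grind

theorem sum_transfer {n : ℕ} {d : Fin n → ℕ} {i j : Fin n} (hi : 0 < d i) (s : Finset (Fin n)) :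
    ∑ t ∈ s, transfer d i j t + (if i ∈ s then 1 else 0) =
      ∑ t ∈ s, d t + (if j ∈ s then 1 else 0) := by
  rw [← Finset.sum_ite_eq' s i fun _ => 1, ← Finset.sum_ite_eq' s j fun _ => 1,
    ← Finset.sum_add_distrib, ← Finset.sum_add_distrib]
  refine Finset.sum_congr rfl fun t _ => ?_
  unfold transfer
  grind

/-- Below an antitone sequence that strictly dominates `d` there is a one-unit transfer which is
still antitone and still weakly dominates `d`. -/
theorem DomLT.exists_transfer {n : ℕ} {d d' : Fin n → ℕ} (hd : Antitone d) (hd' : Antitone d')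
    (h : DomLT d d') : ∃ i j : Fin n, i < j ∧ d' j + 2 ≤ d' i ∧ Antitone (transfer d' i j) ∧
      ∀ l, ∑ t ∈ Finset.Iic l, d t ≤ ∑ t ∈ Finset.Iic l, transfer d' i j t := by
  classical
  obtain ⟨hsum, hle, hne⟩ := h
  obtain ⟨a, ha, hamin⟩ : ∃ a, d a ≠ d' a ∧ ∀ s < a, d s = d' s := by
    obtain ⟨a, ha⟩ := (Set.toFinite {a | d a ≠ d' a}).exists_minimal (Function.ne_iff.mp hne)
    refine ⟨a, ha.prop, fun s hs => ?_⟩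
    by_contra hs'
    exact ha.not_lt hs' hs
  have hda : d a < d' a := by
    refine lt_of_not_ge fun hge => (hle a).not_gt ?_
    refine Finset.sum_lt_sum (fun s hs => ?_) ⟨a, by simp, lt_of_le_of_ne hge ha.symm⟩
    rcases (Finset.mem_Iic.mp hs).lt_or_eq with hs | rfl
    · exact (hamin s hs).ge
    · exact hge
  have hpt : ∀ s, d' a < d' s + 2 → d s ≤ d' s := fun s hs => by
    rcases lt_or_ge s a with hsa | hsa
    · exact (hamin s hsa).le
    · have := hd hsa
      omega
  obtain ⟨j, hj, hjmin⟩ : ∃ j, d' j + 2 ≤ d' a ∧ ∀ s < j, d' a < d' s + 2 := by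
    have hex : {j | d' j + 2 ≤ d' a}.Nonempty := by
      by_contra hcon
      refine hsum.not_lt (Finset.sum_lt_sum (fun s _ => hpt s ?_) ⟨a, by simp, hda⟩)
      exact lt_of_not_ge fun hs => hcon ⟨s, hs⟩
    obtain ⟨j, hj⟩ := (Set.toFinite _).exists_minimal hex
    exact ⟨j, hj.prop, fun s hs => lt_of_not_ge fun hs' => hj.not_lt hs' hs⟩
  obtain ⟨i, hi, himax⟩ : ∃ i, d' i = d' a ∧ ∀ s, i < s → d' s ≠ d' a := by
    obtain ⟨i, hi⟩ := (Set.toFinite {i | d' i = d' a}).exists_maximal ⟨a, rfl⟩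
    exact ⟨i, hi.prop, fun s hs hs' => hi.not_gt hs' hs⟩
  have hai : a ≤ i := le_of_not_gt fun hia => himax a hia rfl
  have hij : i < j := lt_of_not_ge fun hji => by
    have := hd' hji
    omega
  refine ⟨i, j, hij, by omega, fun s t hst => ?_, fun l => ?_⟩
  · rcases hst.eq_or_lt with rfl | hst
    · exact le_rfl
    have h1 := hd' hst.le
    have h2 := hjmin s
    have h3 := himax t
    unfold transfer
    grind
  · have hs := sum_transfer (d := d') (i := i) (j := j) (by omega) (Finset.Iic l)
    simp only [Finset.mem_Iic] at hs
    have hl := hle l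
    by_cases hil : i ≤ l
    · by_cases hjl : j ≤ l
      · simp only [hil, hjl, if_true] at hs
        omega
      · have hlt : ∑ t ∈ Finset.Iic l, d t < ∑ t ∈ Finset.Iic l, d' t :=
          Finset.sum_lt_sum
            (fun s hs => hpt s (hjmin s ((Finset.mem_Iic.mp hs).trans_lt (not_le.mp hjl))))
            ⟨a, Finset.mem_Iic.mpr (hai.trans hil), hda⟩
        simp only [hil, hjl, if_true, if_false] at hs
        omega
    · simp only [hil, if_false] at hs
      omega

theorem unitStep_transfer {n : ℕ} {d : Fin n → ℕ} {i j : Fin n} (hij : i ≠ j) (hi : 0 < d i) :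
    UnitStep (transfer d i j) d := by
  refine ⟨i, j, hij, ?_, ?_, fun t hti htj => ?_⟩
  · simp only [transfer, if_neg hij, if_true]
    omega
  · simp [transfer, hij.symm]
  · simp [transfer, hti, htj]

theorem domLT_transfer {n : ℕ} {d : Fin n → ℕ} {i j : Fin n} (hij : i < j) (hi : 0 < d i) :
    DomLT (transfer d i j) d := by
  refine ⟨by simpa using sum_transfer (j := j) hi Finset.univ, fun l => ?_, fun h => ?_⟩
  · have hs := sum_transfer (j := j) hi (Finset.Iic l)
    simp only [Finset.mem_Iic] at hs
    grind
  · have := congrFun h j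
    simp [transfer, hij.ne'] at this

theorem DomLT.sum_sum_lt {n : ℕ} {d d' : Fin n → ℕ} (h : DomLT d d') :
    ∑ l, ∑ t ∈ Finset.Iic l, d t < ∑ l, ∑ t ∈ Finset.Iic l, d' t := by
  obtain ⟨-, hle, hne⟩ := h
  refine lt_of_le_of_ne (Finset.sum_le_sum fun l _ => hle l) fun heq => hne ?_
  have hall := (Finset.sum_eq_sum_iff_of_le fun l _ => hle l).mp heq
  funext l
  induction l using WellFoundedLT.induction with
  | ind l ih =>
    have hl := hall l (Finset.mem_univ l)
    rw [← Finset.Iio_insert, Finset.sum_insert (by simp), Finset.sum_insert (by simp),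
      Finset.sum_congr rfl fun s hs => ih s (Finset.mem_Iio.mp hs)] at hl
    exact Nat.add_right_cancel hl

theorem stmt17 (n : ℕ) (d d' : Fin n → ℕ)
    (hd : Antitone d) (hd' : Antitone d')
    (hg : Graphic d) (hg' : Graphic d') (hdom : DomLT d d') :
    ∃ (k : ℕ) (C : ℕ → Fin n → ℕ), C 0 = d ∧ C (k + 1) = d' ∧
      (∀ m, 1 ≤ m → m ≤ k → Graphic (C m) ∧ Antitone (C m)) ∧
      (∀ m ≤ k, DomLT (C m) (C (m + 1)) ∧ UnitStep (C m) (C (m + 1))) := by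
  induction hN : ∑ l, ∑ t ∈ Finset.Iic l, d' t using Nat.strong_induction_on generalizing d' with
  | _ N ih =>
    obtain ⟨i, j, hij, hlt, hanti, hle⟩ := hdom.exists_transfer hd hd'
    have hstep : UnitStep (transfer d' i j) d' := unitStep_transfer hij.ne (by omega)
    have hdom' : DomLT (transfer d' i j) d' := domLT_transfer hij (by omega)
    have hgr : Graphic (transfer d' i j) := hg'.transfer (by omega)
    by_cases heq : d = transfer d' i j
    · refine ⟨0, fun m => if m = 0 then d else d', by simp, by simp, by omega, fun m hm => ?_⟩
      obtain rfl : m = 0 := by omega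
      simpa [heq] using And.intro hdom' hstep
    · obtain ⟨k, C, hC0, hCk, hC, hCstep⟩ := ih _ (hN ▸ hdom'.sum_sum_lt) _ hanti hgr
        ⟨hdom.1.trans hdom'.1.symm, hle, heq⟩ rfl
      refine ⟨k + 1, fun m => if m ≤ k + 1 then C m else d', by simpa, by simp,
        fun m hm hmk => ?_, fun m hm => ?_⟩
      · simp only [hmk, if_true]
        rcases hmk.lt_or_eq with hlt | rfl
        · exact hC m hm (by omega)
        · exact hCk ▸ ⟨hgr, hanti⟩
      · rcases hm.lt_or_eq with hlt | rfl
        · simpa [hm, show m ≤ k by omega] using hCstep m (by omega)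
        · simpa [hCk] using And.intro hdom' hstep
end
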